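/- arXiv:1412.2075 — 10 statements merged into one kernel-verified Lean document; each statement's English description precedes it below -/
import Mathlib

section
/- Let G be a finite group and (V_i)_{i∈I} a complete family of irreducible representations of G, with characters χ_i. Then for all g₁, g₂, g₃ ∈ G, writing C₁ and C₂ for the conjugacy classes of g₁ and g₂, the following identity holds in ℂ: #{(x,y) ∈ C₁ × C₂ : x·y = g₃} = (|C₁|·|C₂|/|G|) · Σ_{i∈I} χ_i(g₁)·χ_i(g₂)·χ_i(g₃⁻¹)/χ_i(1). (The left-hand side is the structure coefficient of the conjugacy class of g₃ in the product of the class sums of C₁ and C₂ in the center Z(ℂ[G]) of the group algebra.) -/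
open CategoryTheory

lemma fr_finrank_ne {G : Type} [Group G] (V : FDRep ℂ G) [Simple V] :
    (Module.finrank ℂ V : ℂ) ≠ 0 := by
  intro h
  have h0 : Module.finrank ℂ V = 0 := by exact_mod_cast h
  have : Subsingleton V := Module.finrank_zero_iff.mp h0
  apply id_nonzero V
  ext x
  exact Subsingleton.elim (α := V) _ _

lemma fr_schur {G : Type} [Group G] (V : FDRep ℂ G) [Simple V]
    (f : V →ₗ[ℂ] V) (hf : ∀ g, f ∘ₗ V.ρ g = V.ρ g ∘ₗ f) :
    f = (LinearMap.trace ℂ V f / (Module.finrank ℂ V : ℂ)) • LinearMap.id := by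
  let F : V ⟶ V := ⟨InducedCategory.homMk (ModuleCat.ofHom f), fun g ↦ by
    ext x
    exact LinearMap.congr_fun (hf g) x⟩
  obtain ⟨c, hc⟩ := (finrank_eq_one_iff_of_nonzero' _ (id_nonzero V)).mp
    (finrank_endomorphism_simple_eq_one ℂ V) F
  have hfc : f = c • LinearMap.id := by
    have := congrArg (fun F : V ⟶ V => F.hom.hom.hom) hc
    exact this.symm
  have ht : LinearMap.trace ℂ V f = c * Module.finrank ℂ V := by
    rw [hfc]; simp
  rw [ht, mul_div_cancel_right₀ _ (fr_finrank_ne V)]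
  exact hfc

lemma fr_central {G : Type} [Group G] [Fintype G] (V : FDRep ℂ G) [Simple V]
    (c : G → ℂ) (hc : ∀ g h, c (h * g * h⁻¹) = c g) :
    ∑ g, c g • V.ρ g = ((∑ g, c g * V.character g) / V.character 1) • LinearMap.id := by
  rw [FDRep.char_one]
  convert fr_schur V (∑ g, c g • V.ρ g) ?_ using 3
  · simp [FDRep.character]
  · intro h
    change (∑ g, c g • V.ρ g) * V.ρ h = V.ρ h * (∑ g, c g • V.ρ g)
    rw [Finset.sum_mul, Finset.mul_sum]
    rw [← Equiv.sum_comp (MulAut.conj h).toEquiv]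
    refine Finset.sum_congr rfl fun g _ => ?_
    simp [hc, ← map_mul]

lemma fr_simple {G : Type} [Group G] [Fintype G] {M : Type} [AddCommGroup M] [Module ℂ M]
    [Module.Finite ℂ M] (ρ : Representation ℂ G M) [ρ.IsIrreducible] :
    Simple (FDRep.of ρ) := by
  have := invertibleOfNonzero (NeZero.ne (Nat.card G : ℂ))
  rw [FDRep.simple_iff_char_is_norm_one]
  have := Representation.char_orthonormal ρ ρ
  rw [if_pos ⟨Representation.Equiv.refl ρ⟩, inv_mul_eq_one₀ (NeZero.ne _)] at this
  exact this.symm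

lemma fr_module {G : Type} [Group G] [Fintype G] (c : G → ℂ)
    (h : ∀ W : FDRep ℂ G, Simple W → ∑ g, c g • W.ρ g = 0)
    (M : Type) [AddCommGroup M] [Module ℂ M] [Module (MonoidAlgebra ℂ G) M]
    [IsScalarTower ℂ (MonoidAlgebra ℂ G) M] [Module.Finite ℂ M]
    [IsSimpleModule (MonoidAlgebra ℂ G) M] (x : M) :
    (∑ g, MonoidAlgebra.single g (c g) : MonoidAlgebra ℂ G) • x = 0 := by
  let ρ : Representation ℂ G M := Representation.ofModule' M
  have hρ : ρ.asAlgebraHom = Algebra.lsmul ℂ ℂ M := by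
    simp [ρ, Representation.asAlgebraHom, Representation.ofModule']
  have hρ' : ∀ (a : MonoidAlgebra ℂ G) (y : M), ρ.asAlgebraHom a y = a • y := by
    intro a y; rw [hρ]; rfl
  let e : ρ.asModule ≃ₗ[MonoidAlgebra ℂ G] M :=
    { ρ.asModuleEquiv.toAddEquiv with
      map_smul' := fun a y => by
        simp [hρ'] }
  have hs : IsSimpleModule (MonoidAlgebra ℂ G) ρ.asModule := IsSimpleModule.congr e
  have hi : ρ.IsIrreducible := (Representation.irreducible_iff_isSimpleModule_asModule ρ).mpr hs
  have h1 : ∑ g, c g • ρ g = 0 := h (FDRep.of ρ) (fr_simple ρ)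
  rw [← hρ']
  simp only [map_sum, Representation.asAlgebraHom_single]
  rw [h1]; rfl

lemma fr_zero {G : Type} [Group G] [Fintype G] (c : G → ℂ)
    (h : ∀ W : FDRep ℂ G, Simple W → ∑ g, c g • W.ρ g = 0) : c = 0 := by
  let a : MonoidAlgebra ℂ G := ∑ g, MonoidAlgebra.single g (c g)
  have key : a ∈ Ring.jacobson (MonoidAlgebra ℂ G) := by
    rw [Ring.jacobson_eq_sInf_isMaximal, Submodule.mem_sInf]
    intro m hm
    have hm : Ideal.IsMaximal m := hm
    have hs : IsSimpleModule (MonoidAlgebra ℂ G) (MonoidAlgebra ℂ G ⧸ m) :=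
      isSimpleModule_iff_isCoatom.mpr hm.out
    have h1 : Module.Finite ℂ (MonoidAlgebra ℂ G) :=
      Module.Finite.of_basis (MonoidAlgebra.basis G ℂ)
    have : Module.Finite ℂ (MonoidAlgebra ℂ G ⧸ m) :=
      Module.Finite.of_surjective (m.mkQ.restrictScalars ℂ) m.mkQ_surjective
    have h4 := fr_module c h (MonoidAlgebra ℂ G ⧸ m) (Submodule.Quotient.mk 1)
    rw [← Submodule.Quotient.mk_smul, Submodule.Quotient.mk_eq_zero] at h4
    simpa using h4
  have hj : Ring.jacobson (MonoidAlgebra ℂ G) = ⊥ := IsSemisimpleRing.jacobson_eq_bot _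
  rw [hj, Submodule.mem_bot] at key
  ext g
  classical
  have := congrArg (fun x : MonoidAlgebra ℂ G => x.coeff g) key
  simpa [a, Finsupp.single_apply, Finsupp.finsetSum_apply] using this

lemma fr_regular {G : Type} [Group G] [Fintype G] [DecidableEq G] {I : Type} [Fintype I]
    (V : I → FDRep ℂ G)
    (hsimple : ∀ i, Simple (V i))
    (hpairwise : ∀ i j : I, i ≠ j → IsEmpty (V i ≅ V j))
    (hcomplete : ∀ W : FDRep ℂ G, Simple W → ∃ i : I, Nonempty (W ≅ V i)) (g : G) :
    ∑ i, (V i).character 1 * (V i).character g = if g = 1 then (Fintype.card G : ℂ) else 0 := by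
  classical
  have := invertibleOfNonzero (NeZero.ne (Nat.card G : ℂ))
  let c : G → ℂ := fun g => (if g = 1 then (Fintype.card G : ℂ) else 0) -
    ∑ i, (V i).character 1 * (V i).character g⁻¹
  have hc0 : c = 0 := by
    apply fr_zero
    intro W hW
    rw [fr_central W c]
    · obtain ⟨j, ⟨e⟩⟩ := hcomplete W hW
      have hz : ∑ g, c g * W.character g = 0 := by
        have ho : ∀ i, ∑ g, (V i).character g⁻¹ * W.character g
            = if i = j then (Fintype.card G : ℂ) else 0 := by
          intro i
          have h1 := FDRep.char_orthonormal W (V i)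
          rw [inv_mul_eq_iff_eq_mul₀ (NeZero.ne _)] at h1
          simp_rw [mul_comm ((V i).character _)]
          rw [h1]
          by_cases hij : i = j
          · subst hij
            simp [Nonempty.intro e]
          · have : ¬ Nonempty (W ≅ V i) := fun ⟨f⟩ =>
              (hpairwise i j hij).false (f.symm ≪≫ e)
            simp [this, hij]
        simp only [c, sub_mul, Finset.sum_sub_distrib, Finset.sum_mul, ite_mul, zero_mul,
          Finset.sum_ite_eq', Finset.mem_univ, if_true]
        rw [Finset.sum_comm]
        simp_rw [mul_assoc, ← Finset.mul_sum, ho]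
        simp only [mul_ite, mul_zero, Finset.sum_ite_eq', Finset.mem_univ, if_true]
        rw [FDRep.char_iso e]; ring
      rw [hz]; simp
    · intro g h
      have hh : (h * g * h⁻¹)⁻¹ = h * g⁻¹ * h⁻¹ := by group
      have h2 : h * g * h⁻¹ = 1 ↔ g = 1 := conj_eq_one_iff
      simp only [c, hh, FDRep.char_conj, h2]
  have := congrFun hc0 g⁻¹
  simp only [c, inv_inv, inv_eq_one, Pi.zero_apply] at this
  exact (sub_eq_zero.mp this).symm

lemma fr_class {G : Type} [Group G] [Fintype G] (V : FDRep ℂ G) [Simple V] (a : G)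
    [DecidablePred (IsConj a)] :
    ∑ x with IsConj a x, V.ρ x =
      ((Nat.card {x : G // IsConj a x} : ℂ) * V.character a / V.character 1) • LinearMap.id := by
  have h := fr_central V (fun x => if IsConj a x then 1 else 0) (by
    intro g h
    have : IsConj a (h * g * h⁻¹) ↔ IsConj a g :=
      ⟨fun H => H.trans (isConj_iff.mpr ⟨h, rfl⟩).symm, fun H => H.trans (isConj_iff.mpr ⟨h, rfl⟩)⟩
    simp only [this])
  simp only [ite_smul, one_smul, zero_smul, ite_mul, one_mul, zero_mul, ← Finset.sum_filter] at h
  rw [h]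
  congr 2
  have : ∀ x ∈ Finset.univ.filter (fun x => IsConj a x), V.character x = V.character a := by
    intro x hx
    obtain ⟨y, rfl⟩ := isConj_iff.mp (Finset.mem_filter.mp hx).2
    simp
  rw [Finset.sum_congr rfl this]
  rw [Finset.sum_const, nsmul_eq_mul, Nat.card_eq_fintype_card, Fintype.card_subtype]

/-- **Frobenius' formula** for the structure coefficients of the center of the group
algebra of a finite group, expressed via irreducible characters. -/
theorem stmt0 {G : Type} [Group G] [Fintype G] {I : Type} [Fintype I]
    (V : I → FDRep ℂ G)
    (hsimple : ∀ i, Simple (V i))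
    (hpairwise : ∀ i j : I, i ≠ j → IsEmpty (V i ≅ V j))
    (hcomplete : ∀ W : FDRep ℂ G, Simple W → ∃ i : I, Nonempty (W ≅ V i))
    (g₁ g₂ g₃ : G) :
    (Nat.card {p : G × G // IsConj g₁ p.1 ∧ IsConj g₂ p.2 ∧ p.1 * p.2 = g₃} : ℂ) =
      (Nat.card {x : G // IsConj g₁ x} : ℂ) * (Nat.card {x : G // IsConj g₂ x} : ℂ)
          / (Fintype.card G : ℂ) *
        ∑ i : I, (V i).character g₁ * (V i).character g₂ * (V i).character g₃⁻¹
          / (V i).character 1 := by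
  classical
  have hG : (Fintype.card G : ℂ) ≠ 0 := by simp
  have hV : ∀ i, ∑ x with IsConj g₁ x, ∑ y with IsConj g₂ y,
      (V i).character 1 * (V i).character (x * y * g₃⁻¹) =
      (Nat.card {x : G // IsConj g₁ x} : ℂ) * (Nat.card {x : G // IsConj g₂ x} : ℂ) *
      ((V i).character g₁ * (V i).character g₂ * (V i).character g₃⁻¹
          / (V i).character 1) := by
    intro i
    have := hsimple i
    have hd : (V i).character 1 ≠ 0 := by
      rw [FDRep.char_one]; exact fr_finrank_ne (V i)
    have h : (∑ x with IsConj g₁ x, (V i).ρ x) * (∑ y with IsConj g₂ y, (V i).ρ y) * (V i).ρ g₃⁻¹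
      = ∑ x with IsConj g₁ x, ∑ y with IsConj g₂ y, (V i).ρ (x * y * g₃⁻¹) := by
      simp only [Finset.sum_mul, Finset.mul_sum, map_mul]
      rw [Finset.sum_comm]
    rw [fr_class, fr_class] at h
    have h2 := congrArg (LinearMap.trace ℂ (V i)) h
    simp only [map_sum] at h2
    simp_rw [← Finset.mul_sum]
    change _ = ∑ x with IsConj g₁ x, ∑ y with IsConj g₂ y, (V i).character (x * y * g₃⁻¹) at h2
    rw [← h2]
    change _ * LinearMap.trace ℂ (V i) (((_ : ℂ) • (1 : Module.End ℂ (V i))) *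
      ((_ : ℂ) • (1 : Module.End ℂ (V i))) * _) = _
    rw [smul_mul_smul_comm, smul_mul_assoc, one_mul, one_mul, map_smul]
    change _ * (_ • (V i).character g₃⁻¹) = _
    rw [smul_eq_mul]
    field_simp
  have hsum := Finset.sum_congr (rfl : (Finset.univ : Finset I) = _) (fun i _ => hV i)
  rw [← Finset.mul_sum, Finset.sum_comm] at hsum
  rw [div_mul_eq_mul_div, ← hsum, eq_div_iff hG]
  have hx : ∀ x y : G, ∑ i, (V i).character 1 * (V i).character (x * y * g₃⁻¹) =
      if x * y = g₃ then (Fintype.card G : ℂ) else 0 := by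
    intro x y
    rw [fr_regular V hsimple hpairwise hcomplete]
    simp only [mul_inv_eq_one]
  have hxx : ∀ x : G, ∑ i, ∑ y with IsConj g₂ y,
      (V i).character 1 * (V i).character (x * y * g₃⁻¹) =
      ∑ y with IsConj g₂ y, if x * y = g₃ then (Fintype.card G : ℂ) else 0 := by
    intro x
    rw [Finset.sum_comm]
    exact Finset.sum_congr rfl fun y _ => hx x y
  simp_rw [hxx]
  rw [Nat.card_eq_fintype_card, Fintype.card_subtype, Finset.card_filter, Fintype.sum_prod_type]
  push_cast
  simp only [Finset.sum_filter, Finset.sum_mul]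
  refine Finset.sum_congr rfl fun x _ => ?_
  by_cases h1 : IsConj g₁ x
  · simp only [h1, true_and, if_true]
    refine Finset.sum_congr rfl fun y _ => ?_
    by_cases h2 : IsConj g₂ y <;> simp [h2, -isConj_iff]
  · simp [h1, -isConj_iff]
end

section
/- Let G be a finite group and K a subgroup such that (G,K) is a Gelfand pair, and let (V_i)_{i∈I} be a complete family of irreducible representations of G with characters χ_i. For each i define the zonal spherical function ω_i : G → ℂ by ω_i(x) := (1/|K|) · Σ_{k∈K} χ_i(x⁻¹k). Then for all x₁, x₂, x₃ ∈ G, writing D_j := K x_j K, the following identity holds in ℂ: #{(y₁,y₂) ∈ D₁ × D₂ : y₁·y₂ = x₃} = (|D₁|·|D₂|/|G|) · Σ_{i ∈ I, V_i has a nonzero K-invariant vector} (dim V_i)·ω_i(x₁)·ω_i(x₂)·conj(ω_i(x₃)), where conj denotes complex conjugation. (The left-hand side is the structure coefficient of the double coset of x₃ in the product of the double-coset sums of D₁ and D₂ in ℂ[K\G/K].) -/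
open CategoryTheory
open scoped Classical

/-- The sum, in the group algebra `ℂ[G]`, of the elements of the double coset `KxK`. -/
noncomputable def doubleCosetSum {G : Type} [Group G] [Fintype G] (K : Subgroup G) (x : G) :
    MonoidAlgebra ℂ G :=
  ∑ g ∈ Finset.univ.filter (fun g : G => ∃ k₁ ∈ K, ∃ k₂ ∈ K, g = k₁ * x * k₂),
    MonoidAlgebra.single g (1 : ℂ)

/-- The zonal spherical function associated to an irreducible representation `W`:
`ω(x) = (1/|K|) ∑_{k ∈ K} χ_W (x⁻¹ k)`. -/
noncomputable def zonalSpherical {G : Type} [Group G] [Fintype G] (K : Subgroup G)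
    (W : FDRep ℂ G) (x : G) : ℂ :=
  letI : Fintype K := Fintype.ofFinite K
  (Nat.card K : ℂ)⁻¹ * ∑ k : K, W.character (x⁻¹ * (k : G))

open scoped ComplexOrder in
theorem zz_conj {G : Type} [Group G] [Fintype G] {V : Type} [AddCommGroup V] [Module ℂ V]
    [FiniteDimensional ℂ V] (ρ : Representation ℂ G V) (g : G) :
    (starRingEnd ℂ) (LinearMap.trace ℂ V (ρ g)) = LinearMap.trace ℂ V (ρ g⁻¹) := by
  let b := Module.finBasis ℂ V
  let M : G → Matrix (Fin (Module.finrank ℂ V)) (Fin (Module.finrank ℂ V)) ℂ :=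
    fun g => LinearMap.toMatrix b b (ρ g)
  have hmul : ∀ g h, M (g * h) = M g * M h := by
    intro g h
    simp only [M, map_mul, LinearMap.toMatrix_mul]
  have hone : M 1 = 1 := by simp only [M, map_one, LinearMap.toMatrix_one]
  have htr : ∀ g, LinearMap.trace ℂ V (ρ g) = (M g).trace := by
    intro g; exact LinearMap.trace_eq_matrix_trace ℂ b (ρ g)
  let H : Matrix (Fin (Module.finrank ℂ V)) (Fin (Module.finrank ℂ V)) ℂ :=
    ∑ h : G, (M h).conjTranspose * M h
  have hH : H.PosDef := by
    have : H = (M 1).conjTranspose * M 1 + ∑ h ∈ Finset.univ.erase (1 : G), (M h).conjTranspose * M h :=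
      (Finset.add_sum_erase _ _ (Finset.mem_univ _)).symm
    rw [this, hone]
    refine Matrix.PosDef.add_posSemidef (by simpa using Matrix.PosDef.one) ?_
    exact Matrix.posSemidef_sum _ (fun i _ => Matrix.posSemidef_conjTranspose_mul_self _)
  have hinv : (M g).conjTranspose * H * M g = H := by
    simp only [H, Finset.mul_sum, Finset.sum_mul]
    refine Fintype.sum_equiv (Equiv.mulRight g) _ _ ?_
    intro h
    simp [hmul, Matrix.conjTranspose_mul, Matrix.mul_assoc]
  have hgi : M g * M g⁻¹ = 1 := by rw [← hmul, mul_inv_cancel, hone]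
  have hu : IsUnit H.det := hH.isUnit.map Matrix.detMonoidHom
  have h2 : (M g).conjTranspose = H * M g⁻¹ * H⁻¹ := by
    calc (M g).conjTranspose = (M g).conjTranspose * H * (M g * M g⁻¹) * H⁻¹ := by
          rw [hgi, mul_one, Matrix.mul_assoc, Matrix.mul_nonsing_inv _ hu, mul_one]
      _ = ((M g).conjTranspose * H * M g) * M g⁻¹ * H⁻¹ := by simp only [Matrix.mul_assoc]
      _ = _ := by rw [hinv]
  rw [htr, htr, starRingEnd_apply, ← Matrix.trace_conjTranspose, h2, Matrix.trace_mul_comm,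
    ← Matrix.mul_assoc, Matrix.nonsing_inv_mul _ hu, one_mul]

theorem zz_irr {G : Type} [Group G] [Fintype G] (W : FDRep ℂ G) [Simple W] :
    Representation.IsIrreducible (V := W) W.ρ := by
  have hnt : Nontrivial W := by
    by_contra h
    rw [not_nontrivial_iff_subsingleton] at h
    apply id_nonzero W
    ext x
    exact Subsingleton.elim (α := W) _ _
  have : Nontrivial (Subrepresentation (W := W) W.ρ) := by
    refine ⟨⊥, ⊤, fun h => ?_⟩
    have := congrArg Subrepresentation.toSubmodule h
    exact bot_ne_top (α := Submodule ℂ W) this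
  refine ⟨fun S => ?_⟩
  let f : FDRep.of S.toRepresentation ⟶ W :=
    ⟨FGModuleCat.ofHom S.toSubmodule.subtype, fun g => by ext x; rfl⟩
  have : Mono f := ConcreteCategory.mono_of_injective f (by
    intro a b h; exact Subtype.ext h)
  by_cases hf : f = 0
  · left
    have : S.toSubmodule = ⊥ := by
      rw [eq_bot_iff]
      intro x hx
      have := congrArg (fun (t : FDRep.of S.toRepresentation ⟶ W) => t.hom.hom.hom ⟨x, hx⟩) hf
      exact this
    exact Subrepresentation.toSubmodule_injective this
  · right
    have := isIso_of_mono_of_nonzero hf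
    have : S.toSubmodule = ⊤ := by
      rw [eq_top_iff]
      intro x _
      have h := (FDRep.isoToLinearEquiv (asIso f)).surjective x
      obtain ⟨y, hy⟩ := h
      rw [← hy]
      exact y.2
    exact Subrepresentation.toSubmodule_injective this

theorem zz_simple {G : Type} [Group G] [Fintype G] {V : Type} [AddCommGroup V] [Module ℂ V]
    [FiniteDimensional ℂ V] (ρ : Representation ℂ G V) [ρ.IsIrreducible] :
    Simple (FDRep.of ρ) := by
  rw [FDRep.simple_iff_end_is_rank_one]
  rw [← LinearEquiv.finrank_eq
    (Representation.linHom.invariantsEquivFDRepHom (FDRep.of ρ) (FDRep.of ρ))]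
  rw [← Representation.IsIrreducible.finrank_intertwiningMap_self ρ]
  exact LinearEquiv.finrank_eq (Representation.invariantsEquivIntertwiningMap ρ ρ)

theorem zz_annih00 {G : Type} [Group G] [Fintype G] (z : MonoidAlgebra ℂ G)
    (hz : ∀ W : FDRep ℂ G, Simple W → Representation.asAlgebraHom (V := W) W.ρ z = 0)
    (M : Type) [AddCommGroup M] [Module ℂ M] [FiniteDimensional ℂ M]
    (ρ : Representation ℂ G M) (hs : ρ.IsIrreducible) (m : M) : ρ.asAlgebraHom z m = 0 := by
  have h : ρ.asAlgebraHom z = 0 := hz (FDRep.of ρ) (zz_simple ρ)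
  rw [h]; rfl

theorem zz_annih0 {G : Type} [Group G] [Fintype G] (z : MonoidAlgebra ℂ G)
    (hz : ∀ W : FDRep ℂ G, Simple W → Representation.asAlgebraHom (V := W) W.ρ z = 0)
    (M : Type) [AddCommGroup M] [Module (MonoidAlgebra ℂ G) M]
    [Module.Finite (MonoidAlgebra ℂ G) M]
    (hs : IsSimpleModule (MonoidAlgebra ℂ G) M) (m : M) : z • m = 0 := by
  rw [Representation.isSimpleModule_iff_irreducible_ofModule (k := ℂ) (G := G)] at hs
  have i3 : Module.Finite ℂ (MonoidAlgebra ℂ G) := inferInstance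
  let c : Module ℂ M := Module.compHom M (algebraMap ℂ (MonoidAlgebra ℂ G))
  have i4 : IsScalarTower ℂ (MonoidAlgebra ℂ G) M := IsScalarTower.of_algebraMap_smul
    (fun _ _ => rfl)
  have i2 : FiniteDimensional ℂ M :=
    Module.Finite.trans (MonoidAlgebra ℂ G) M
  have h0 := @zz_annih00 G _ _ z hz (RestrictScalars ℂ (MonoidAlgebra ℂ G) M)
    (inferInstanceAs (AddCommGroup M)) c i2 (Representation.ofModule (k := ℂ) (G := G) M) hs m
  have h1 := Representation.ofModule_asAlgebraHom_apply_apply (k := ℂ) (G := G)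
    (M := M) z m
  exact (h0.symm.trans h1).symm

theorem zz_annih {G : Type} [Group G] [Fintype G] (z : MonoidAlgebra ℂ G)
    (hz : ∀ W : FDRep ℂ G, Simple W → Representation.asAlgebraHom (V := W) W.ρ z = 0) : z = 0 := by
  have : IsSemisimpleRing (MonoidAlgebra ℂ G) := inferInstance
  have h : z ∈ Module.jacobson (MonoidAlgebra ℂ G) (MonoidAlgebra ℂ G) := by
    rw [Module.jacobson, Submodule.mem_sInf]
    intro m hm
    have hs : IsSimpleModule (MonoidAlgebra ℂ G) (MonoidAlgebra ℂ G ⧸ m) :=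
      isSimpleModule_iff_isCoatom.mpr hm
    have h4 : (Submodule.Quotient.mk (p := m) z) = 0 := by
      have := zz_annih0 z hz _ hs (Submodule.Quotient.mk (p := m) 1)
      rw [← Submodule.Quotient.mk_smul] at this
      simpa using this
    exact (Submodule.Quotient.mk_eq_zero m).mp h4
  rw [IsSemisimpleModule.jacobson_eq_bot] at h
  simpa using h

theorem zz_schur {G : Type} [Group G] [Fintype G] (W : FDRep ℂ G) [Simple W] (φ : G → ℂ)
    (hφ : ∀ g h, φ (h * g * h⁻¹) = φ g) (h0 : ∑ g, φ g * W.character g = 0) :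
    ∑ g, φ g • W.ρ g = 0 := by
  have hirr := zz_irr W
  let T : Representation.IntertwiningMap (V := W) (W := W) W.ρ W.ρ :=
    { toLinearMap := ∑ g, φ g • W.ρ g
      isIntertwining' := by
        intro h
        change (∑ g, φ g • W.ρ g) * W.ρ h = W.ρ h * (∑ g, φ g • W.ρ g)
        rw [Finset.sum_mul, Finset.mul_sum]
        refine Fintype.sum_equiv (MulAut.conj h⁻¹).toEquiv _ _ ?_
        intro g
        have := hφ g h⁻¹
        rw [inv_inv, mul_assoc] at this
        simp [this, ← map_mul, mul_assoc] }
  obtain ⟨c, hc⟩ := (Representation.IsIrreducible.algebraMap_intertwiningMap_bijective_of_isAlgClosed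
    (ρ := W.ρ)).2 T
  have hc' : c • (1 : W →ₗ[ℂ] W) = ∑ g, φ g • W.ρ g := by
    have := congrArg Representation.IntertwiningMap.toLinearMap hc
    exact this
  have ht := congrArg (LinearMap.trace ℂ W) hc'
  rw [map_sum] at ht
  simp only [map_smul, smul_eq_mul, LinearMap.trace_one] at ht
  have h0' : ∑ g, φ g * LinearMap.trace ℂ W (W.ρ g) = 0 := h0
  rw [h0'] at ht
  rcases mul_eq_zero.mp ht with h | h
  · rw [← hc', h, zero_smul]
  · have : Module.finrank ℂ W = 0 := by exact_mod_cast h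
    have := Module.finrank_zero_iff.mp this
    ext x
    exact Subsingleton.elim _ _

theorem zz_regular {G : Type} [Group G] [Fintype G] {I : Type} [Fintype I] (V : I → FDRep ℂ G)
    (hsimple : ∀ i, Simple (V i))
    (hpairwise : ∀ i j : I, i ≠ j → IsEmpty (V i ≅ V j))
    (hcomplete : ∀ W : FDRep ℂ G, Simple W → ∃ i : I, Nonempty (W ≅ V i)) (g : G) :
    ∑ i, (Module.finrank ℂ (V i) : ℂ) * (V i).character g =
      if g = 1 then (Fintype.card G : ℂ) else 0 := by
  let φ : G → ℂ := fun g => (∑ i, (Module.finrank ℂ (V i) : ℂ) * (V i).character g⁻¹) -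
      if g = 1 then (Fintype.card G : ℂ) else 0
  have hG : (Nat.card G : ℂ) ≠ 0 := by simp
  let := invertibleOfNonzero hG
  have hφ : ∀ g h, φ (h * g * h⁻¹) = φ g := by
    intro g h
    have : ∀ i, (V i).character (h * g * h⁻¹)⁻¹ = (V i).character g⁻¹ := by
      intro i
      rw [← FDRep.char_conj (V i) g⁻¹ h]; congr 1; group
    simp only [φ, this, conj_eq_one_iff]
  have hz : (∑ g, MonoidAlgebra.single g (φ g) : MonoidAlgebra ℂ G) = 0 := by
    apply zz_annih
    intro W hW
    rw [map_sum]
    simp only [Representation.asAlgebraHom_single]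
    apply zz_schur W φ hφ
    obtain ⟨j, ⟨e⟩⟩ := hcomplete W hW
    rw [FDRep.char_iso e]
    have hj := hsimple j
    have horth : ∀ i, ∑ g : G, (V j).character g * (V i).character g⁻¹ =
        if i = j then (Nat.card G : ℂ) else 0 := by
      intro i
      have hi := hsimple i
      have := FDRep.char_orthonormal (V j) (V i)
      rw [inv_mul_eq_iff_eq_mul₀ hG] at this
      rw [this]
      by_cases hij : i = j
      · subst hij
        simp [Nonempty.intro (Iso.refl (V i))]
      · have := hpairwise j i (Ne.symm hij)
        simp [hij, this]
    simp only [φ, sub_mul, Finset.sum_sub_distrib, Finset.sum_mul]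
    rw [Finset.sum_comm]
    have : ∀ i, ∑ g : G, (Module.finrank ℂ (V i) : ℂ) * (V i).character g⁻¹ * (V j).character g =
        (Module.finrank ℂ (V i) : ℂ) * if i = j then (Nat.card G : ℂ) else 0 := by
      intro i
      rw [← horth, Finset.mul_sum]
      exact Finset.sum_congr rfl fun _ _ => by ring
    simp only [this]
    simp
    ring
  have h1 : φ g⁻¹ = 0 := by
    have := congrArg (fun t : MonoidAlgebra ℂ G => t.coeff g⁻¹) hz
    simpa [Finsupp.finsetSum_apply, Finsupp.single_apply] using this
  simpa [φ, sub_eq_zero] using h1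

noncomputable def zzE {G : Type} [Group G] [Fintype G] (K : Subgroup G) : MonoidAlgebra ℂ G :=
  (Nat.card K : ℂ)⁻¹ • ∑ k : K, MonoidAlgebra.single (k : G) (1 : ℂ)

theorem zzE_left {G : Type} [Group G] [Fintype G] (K : Subgroup G) (k : G) (hk : k ∈ K) :
    MonoidAlgebra.single k (1 : ℂ) * zzE K = zzE K := by
  rw [zzE, mul_smul_comm, Finset.mul_sum]
  congr 1
  refine Fintype.sum_equiv (Equiv.mulLeft (⟨k, hk⟩ : K)) _ _ ?_
  intro h
  simp [MonoidAlgebra.single_mul_single]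

theorem zzE_right {G : Type} [Group G] [Fintype G] (K : Subgroup G) (k : G) (hk : k ∈ K) :
    zzE K * MonoidAlgebra.single k (1 : ℂ) = zzE K := by
  rw [zzE, smul_mul_assoc, Finset.sum_mul]
  congr 1
  refine Fintype.sum_equiv (Equiv.mulRight (⟨k, hk⟩ : K)) _ _ ?_
  intro h
  simp [MonoidAlgebra.single_mul_single]

theorem zzE_mul {G : Type} [Group G] [Fintype G] (K : Subgroup G) (a : MonoidAlgebra ℂ G)
    (ha : ∀ k ∈ K, MonoidAlgebra.single k (1 : ℂ) * a = a) : zzE K * a = a := by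
  rw [zzE, smul_mul_assoc, Finset.sum_mul]
  rw [Finset.sum_congr rfl (fun k _ => ha k.1 k.2)]
  rw [Finset.sum_const, Finset.card_univ, ← Nat.card_eq_fintype_card, ← Nat.cast_smul_eq_nsmul ℂ, smul_smul,
    inv_mul_cancel₀ (by exact_mod_cast Nat.card_pos.ne'), one_smul]

theorem zz_mulE {G : Type} [Group G] [Fintype G] (K : Subgroup G) (a : MonoidAlgebra ℂ G)
    (ha : ∀ k ∈ K, a * MonoidAlgebra.single k (1 : ℂ) = a) : a * zzE K = a := by
  rw [zzE, mul_smul_comm, Finset.mul_sum]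
  rw [Finset.sum_congr rfl (fun k _ => ha k.1 k.2)]
  rw [Finset.sum_const, Finset.card_univ, ← Nat.card_eq_fintype_card, ← Nat.cast_smul_eq_nsmul ℂ, smul_smul,
    inv_mul_cancel₀ (by exact_mod_cast Nat.card_pos.ne'), one_smul]

theorem zzE_idem {G : Type} [Group G] [Fintype G] (K : Subgroup G) : zzE K * zzE K = zzE K :=
  zzE_mul K _ (zzE_left K)

theorem zz_dcs {G : Type} [Group G] [Fintype G] (K : Subgroup G) (x : G) :
    doubleCosetSum K x = (Nat.card {g : G // ∃ k₁ ∈ K, ∃ k₂ ∈ K, g = k₁ * x * k₂} : ℂ) •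
      (zzE K * MonoidAlgebra.single x 1 * zzE K) := by
  have h1 : zzE K * doubleCosetSum K x = doubleCosetSum K x := by
    apply zzE_mul
    intro k hk
    rw [doubleCosetSum, Finset.mul_sum]
    refine Finset.sum_equiv (Equiv.mulLeft k) ?_ ?_
    · intro g
      simp only [Finset.mem_filter, Finset.mem_univ, true_and, Equiv.coe_mulLeft]
      constructor
      · rintro ⟨a, ha, b, hb, rfl⟩
        exact ⟨k * a, K.mul_mem hk ha, b, hb, by group⟩
      · rintro ⟨a, ha, b, hb, h⟩
        exact ⟨k⁻¹ * a, K.mul_mem (K.inv_mem hk) ha, b, hb, by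
          rw [eq_comm, mul_assoc, mul_assoc, ← mul_assoc a, ← h]; group⟩
    · intro g _
      simp [MonoidAlgebra.single_mul_single]
  have h2 : doubleCosetSum K x * zzE K = doubleCosetSum K x := by
    apply zz_mulE
    intro k hk
    rw [doubleCosetSum, Finset.sum_mul]
    refine Finset.sum_equiv (Equiv.mulRight k) ?_ ?_
    · intro g
      simp only [Finset.mem_filter, Finset.mem_univ, true_and, Equiv.coe_mulRight]
      constructor
      · rintro ⟨a, ha, b, hb, rfl⟩
        exact ⟨a, ha, b * k, K.mul_mem hb hk, by group⟩
      · rintro ⟨a, ha, b, hb, h⟩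
        exact ⟨a, ha, b * k⁻¹, K.mul_mem hb (K.inv_mem hk), by
          rw [← mul_assoc, ← h]; group⟩
    · intro g _
      simp [MonoidAlgebra.single_mul_single]
  rw [← h2, ← h1, doubleCosetSum, Finset.mul_sum, Finset.sum_mul]
  rw [Finset.sum_congr rfl (g := fun _ => zzE K * MonoidAlgebra.single x 1 * zzE K)]
  · rw [Finset.sum_const, ← Nat.cast_smul_eq_nsmul ℂ, Nat.card_eq_fintype_card,
      Fintype.card_subtype]
  · intro g hg
    simp only [Finset.mem_filter, Finset.mem_univ, true_and] at hg
    obtain ⟨a, ha, b, hb, rfl⟩ := hg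
    have : MonoidAlgebra.single (a * x * b) (1 : ℂ) = MonoidAlgebra.single a 1 *
      MonoidAlgebra.single x 1 * MonoidAlgebra.single b 1 := by
      simp [MonoidAlgebra.single_mul_single]
    rw [this]
    calc zzE K * (MonoidAlgebra.single a 1 * MonoidAlgebra.single x 1 * MonoidAlgebra.single b 1)
          * zzE K = (zzE K * MonoidAlgebra.single a 1) * MonoidAlgebra.single x 1 *
            (MonoidAlgebra.single b 1 * zzE K) := by simp only [mul_assoc]
      _ = _ := by rw [zzE_left K b hb, zzE_right K a ha]

theorem zz_card_ne {G : Type} [Group G] [Fintype G] (K : Subgroup G) (x : G) :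
    (Nat.card {g : G // ∃ k₁ ∈ K, ∃ k₂ ∈ K, g = k₁ * x * k₂} : ℂ) ≠ 0 := by
  have : Nonempty {g : G // ∃ k₁ ∈ K, ∃ k₂ ∈ K, g = k₁ * x * k₂} :=
    ⟨⟨x, 1, K.one_mem, 1, K.one_mem, by simp⟩⟩
  exact_mod_cast Nat.card_pos.ne'

theorem zz_comm {G : Type} [Group G] [Fintype G] (K : Subgroup G)
    (hGelfand : ∀ x y : G,
      doubleCosetSum K x * doubleCosetSum K y = doubleCosetSum K y * doubleCosetSum K x)
    (a b : MonoidAlgebra ℂ G) :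
    (zzE K * a * zzE K) * (zzE K * b * zzE K) = (zzE K * b * zzE K) * (zzE K * a * zzE K) := by
  have key : ∀ x y : G, (zzE K * MonoidAlgebra.single x 1 * zzE K) * (zzE K * MonoidAlgebra.single y 1 * zzE K) =
      (zzE K * MonoidAlgebra.single y 1 * zzE K) * (zzE K * MonoidAlgebra.single x 1 * zzE K) := by
    intro x y
    have := hGelfand x y
    rw [zz_dcs, zz_dcs, smul_mul_smul_comm, smul_mul_smul_comm, mul_comm (Nat.cast _)] at this
    exact smul_right_injective _ (mul_ne_zero (zz_card_ne K y) (zz_card_ne K x)) this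
  have hs : ∀ (x : G) (r : ℂ), MonoidAlgebra.single x r = r • MonoidAlgebra.single x (1 : ℂ) := by
    intro x r; simp
  induction a using MonoidAlgebra.induction_linear with
  | zero => simp
  | add a a' h h' => simp only [mul_add, add_mul, h, h']
  | single x r =>
    induction b using MonoidAlgebra.induction_linear with
    | zero => simp
    | add a a' h h' => simp only [mul_add, add_mul, h, h']
    | single y s =>
      rw [hs x r, hs y s]
      simp only [mul_smul_comm, smul_mul_assoc, key x y, smul_comm r s]

theorem zz_rank {G : Type} [Group G] [Fintype G] (K : Subgroup G)
    (hGelfand : ∀ x y : G,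
      doubleCosetSum K x * doubleCosetSum K y = doubleCosetSum K y * doubleCosetSum K x)
    {V : Type} [AddCommGroup V] [Module ℂ V] [FiniteDimensional ℂ V]
    (ρ : Representation ℂ G V) (hirr : ρ.IsIrreducible) (v : V) (hv : v ≠ 0)
    (hKv : ∀ k ∈ K, ρ k v = v) :
    LinearMap.trace ℂ V (ρ.asAlgebraHom (zzE K)) = 1 ∧ ∀ a, ∃ c : ℂ,
      ρ.asAlgebraHom (zzE K * a * zzE K) = c • ρ.asAlgebraHom (zzE K) := by
  have cyc : ∀ u w : V, u ≠ 0 → ∃ a, ρ.asAlgebraHom a u = w := by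
    intro u w hu
    let S : Subrepresentation ρ :=
      ⟨LinearMap.range ((LinearMap.applyₗ u) ∘ₗ ρ.asAlgebraHom.toLinearMap), by
        rintro g _ ⟨a, rfl⟩
        refine ⟨MonoidAlgebra.single g 1 * a, ?_⟩
        simp [Representation.asAlgebraHom_single]⟩
    have hS : S ≠ ⊥ := by
      intro h
      have h1 : u ∈ S.toSubmodule := ⟨1, by simp⟩
      rw [h] at h1
      exact hu h1
    have hT : S = ⊤ := (eq_bot_or_eq_top S).resolve_left hS
    have h1 : w ∈ S.toSubmodule := by
      rw [hT]; exact Submodule.mem_top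
    obtain ⟨a, ha⟩ := h1
    exact ⟨a, ha⟩
  have hPv : ρ.asAlgebraHom (zzE K) v = v := by
    simp only [zzE, map_smul, map_sum, Representation.asAlgebraHom_single, one_smul,
      LinearMap.smul_apply, LinearMap.sum_apply]
    rw [Finset.sum_congr rfl (fun k _ => hKv k.1 k.2)]
    rw [Finset.sum_const, Finset.card_univ, ← Nat.card_eq_fintype_card, ← Nat.cast_smul_eq_nsmul ℂ, smul_smul,
      inv_mul_cancel₀ (by exact_mod_cast Nat.card_pos.ne'), one_smul]
  have hc := zz_comm K hGelfand
  have hee := zzE_idem K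
  generalize zzE K = e at *
  set L := ρ.asAlgebraHom with hL
  have hPP : ∀ w, L e (L e w) = L e w := by
    intro w
    rw [← Module.End.mul_apply, ← map_mul, hee]
  have scal : ∀ a, ∃ c : ℂ, L (e * a * e) = c • L e := by
    intro a
    let U := LinearMap.range (L e)
    have : Nontrivial U := ⟨⟨⟨v, v, hPv⟩, 0, fun h => hv (congrArg Subtype.val h)⟩⟩
    have hU : ∀ w ∈ U, L (e * a * e) w ∈ U := by
      intro w _
      refine ⟨L (a * e) w, ?_⟩
      rw [← Module.End.mul_apply, ← map_mul, mul_assoc]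
    obtain ⟨μ, hμ⟩ := Module.End.exists_eigenvalue ((L (e * a * e)).restrict hU)
    obtain ⟨u, hu⟩ := hμ.exists_hasEigenvector
    have h1 : L (e * a * e) u.1 = μ • u.1 := congrArg Subtype.val hu.apply_eq_smul
    have h2 : u.1 ≠ 0 := fun h => hu.2 (Subtype.ext h)
    have h3 : L e u.1 = u.1 := by
      obtain ⟨w, hw⟩ := u.2
      rw [← hw, hPP]
    refine ⟨μ, ?_⟩
    ext w
    obtain ⟨b, rfl⟩ := cyc u.1 w h2
    have h4 : L e (L b u.1) = L (e * b * e) u.1 := by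
      simp only [map_mul, Module.End.mul_apply, h3]
    have h6 : L (e * a * e) (L b u.1) = L (e * a * e) (L (e * b * e) u.1) := by
      rw [← h4]
      simp only [map_mul, Module.End.mul_apply, hPP]
    rw [h6, ← Module.End.mul_apply, ← map_mul, hc a b, map_mul, Module.End.mul_apply, h1,
      map_smul, LinearMap.smul_apply, h4]
  refine ⟨?_, scal⟩
  have hproj : LinearMap.IsProj (LinearMap.range (L e)) (L e) :=
    LinearMap.IsIdempotentElem.isProj_range _ (by rw [IsIdempotentElem, ← map_mul, hee])
  have hr : LinearMap.range (L e) = Submodule.span ℂ {v} := by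
    apply le_antisymm
    · rintro _ ⟨w, rfl⟩
      obtain ⟨b, rfl⟩ := cyc v w hv
      obtain ⟨c, hcc⟩ := scal b
      rw [Submodule.mem_span_singleton]
      refine ⟨c, ?_⟩
      have := congrArg (fun t => t v) hcc
      simp only [map_mul, Module.End.mul_apply, LinearMap.smul_apply, hPv] at this
      exact this.symm
    · rw [Submodule.span_singleton_le_iff_mem]
      exact ⟨v, hPv⟩
  rw [hproj.trace, hr, finrank_span_singleton hv, Nat.cast_one]

theorem zz_term {G : Type} [Group G] [Fintype G] (K : Subgroup G)
    (hGelfand : ∀ x y : G,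
      doubleCosetSum K x * doubleCosetSum K y = doubleCosetSum K y * doubleCosetSum K x)
    {V : Type} [AddCommGroup V] [Module ℂ V] [FiniteDimensional ℂ V]
    (ρ : Representation ℂ G V) (hirr : ρ.IsIrreducible) (a b c : MonoidAlgebra ℂ G) :
    LinearMap.trace ℂ V (ρ.asAlgebraHom (zzE K * a * zzE K * (zzE K * b * zzE K) * c)) =
      if ∃ v : V, v ≠ 0 ∧ ∀ k ∈ K, ρ k v = v then
        LinearMap.trace ℂ V (ρ.asAlgebraHom (a * zzE K)) *
        LinearMap.trace ℂ V (ρ.asAlgebraHom (b * zzE K)) *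
        LinearMap.trace ℂ V (ρ.asAlgebraHom (c * zzE K)) else 0 := by
  split_ifs with h
  · obtain ⟨v, hv, hKv⟩ := h
    obtain ⟨htr, hs⟩ := zz_rank K hGelfand ρ hirr v hv hKv
    have hee := zzE_idem K
    have key : ∀ a, ρ.asAlgebraHom (zzE K * a * zzE K) =
        LinearMap.trace ℂ V (ρ.asAlgebraHom (a * zzE K)) • ρ.asAlgebraHom (zzE K) := by
      intro a
      obtain ⟨c, hc⟩ := hs a
      have h1 := congrArg (LinearMap.trace ℂ V) hc
      rw [map_smul, htr, smul_eq_mul, mul_one] at h1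
      rw [hc, ← h1, mul_assoc, map_mul, LinearMap.trace_mul_comm, ← map_mul, mul_assoc, hee]
    rw [map_mul ρ.asAlgebraHom, map_mul ρ.asAlgebraHom, key, key, smul_mul_smul_comm,
      ← map_mul ρ.asAlgebraHom (zzE K) (zzE K), hee, smul_mul_assoc, map_smul,
      LinearMap.trace_mul_comm, ← map_mul ρ.asAlgebraHom, smul_eq_mul]
  · push Not at h
    have : ρ.asAlgebraHom (zzE K) = 0 := by
      ext w
      by_contra hw
      obtain ⟨k, hk, hne⟩ := h _ hw
      apply hne
      have : ρ k = ρ.asAlgebraHom (MonoidAlgebra.single k 1) := by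
        simp [Representation.asAlgebraHom_single]
      rw [this, ← Module.End.mul_apply, ← map_mul, zzE_left K k hk]
    simp [map_mul, this]

theorem zz_zonal0 {G : Type} [Group G] [Fintype G] (K : Subgroup G) (W : FDRep ℂ G) (x : G) :
    zonalSpherical K W x = (Nat.card K : ℂ)⁻¹ * ∑ k : K, W.character (x⁻¹ * (k : G)) := by
  unfold zonalSpherical
  congr!

theorem zz_zonal {G : Type} [Group G] [Fintype G] (K : Subgroup G) (W : FDRep ℂ G) (x : G) :
    zonalSpherical K W x = LinearMap.trace ℂ W (Representation.asAlgebraHom (V := W) W.ρ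
      (MonoidAlgebra.single x⁻¹ 1 * zzE K)) := by
  have h : MonoidAlgebra.single x⁻¹ 1 * zzE K =
      (Nat.card K : ℂ)⁻¹ • ∑ k : K, MonoidAlgebra.single (x⁻¹ * (k : G)) (1 : ℂ) := by
    rw [zzE, mul_smul_comm, Finset.mul_sum]
    simp only [MonoidAlgebra.single_mul_single, mul_one]
  rw [zz_zonal0, h, map_smul, map_smul, map_sum, map_sum, smul_eq_mul]
  simp only [Representation.asAlgebraHom_single, one_smul]
  rfl

theorem zz_zonal_conj {G : Type} [Group G] [Fintype G] (K : Subgroup G) (W : FDRep ℂ G) (x : G) :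
    (starRingEnd ℂ) (zonalSpherical K W x) = zonalSpherical K W x⁻¹ := by
  rw [zz_zonal0, zz_zonal0, map_mul, map_inv₀, map_sum, map_natCast]
  congr 1
  refine Fintype.sum_equiv (Equiv.inv K) _ _ ?_
  intro k
  have : (starRingEnd ℂ) (W.character (x⁻¹ * k)) = W.character (x⁻¹ * k)⁻¹ :=
    zz_conj (V := W) W.ρ _
  rw [this, mul_inv_rev, inv_inv, FDRep.char_mul_comm]
  simp

theorem zz_count {G : Type} [Group G] [Fintype G] (K : Subgroup G) (x₁ x₂ x₃ : G) :
    (Nat.card {p : G × G //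
        (∃ k₁ ∈ K, ∃ k₂ ∈ K, p.1 = k₁ * x₁ * k₂) ∧
        (∃ k₁ ∈ K, ∃ k₂ ∈ K, p.2 = k₁ * x₂ * k₂) ∧ p.1 * p.2 = x₃} : ℂ) =
    (doubleCosetSum K x₁ * doubleCosetSum K x₂).coeff x₃ := by
  rw [doubleCosetSum, doubleCosetSum, Finset.sum_mul_sum, ← Finset.sum_product',
    MonoidAlgebra.coeff_sum, Finsupp.finsetSum_apply]
  simp only [MonoidAlgebra.single_mul_single, MonoidAlgebra.coeff_single, Finsupp.single_apply,
    mul_one]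
  rw [Finset.sum_boole, Nat.card_eq_fintype_card, Fintype.card_subtype]
  congr 2
  ext p
  simp [and_assoc]

theorem zz_coeff {G : Type} [Group G] [Fintype G] {I : Type} [Fintype I] (V : I → FDRep ℂ G)
    (hsimple : ∀ i, Simple (V i))
    (hpairwise : ∀ i j : I, i ≠ j → IsEmpty (V i ≅ V j))
    (hcomplete : ∀ W : FDRep ℂ G, Simple W → ∃ i : I, Nonempty (W ≅ V i)) (g : G)
    (a : MonoidAlgebra ℂ G) :
    ∑ i, (Module.finrank ℂ (V i) : ℂ) * LinearMap.trace ℂ (V i)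
      (Representation.asAlgebraHom (V := V i) (V i).ρ (a * MonoidAlgebra.single g⁻¹ 1)) =
      (Fintype.card G : ℂ) * a.coeff g := by
  induction a using MonoidAlgebra.induction_linear with
  | zero => simp
  | add a b h h' =>
    simp only [add_mul, map_add, mul_add, Finset.sum_add_distrib, h, h', MonoidAlgebra.coeff_add,
      Finsupp.add_apply]
  | single x r =>
    have h := zz_regular V hsimple hpairwise hcomplete (x * g⁻¹)
    simp only [MonoidAlgebra.single_mul_single, Representation.asAlgebraHom_single, mul_one,
      map_smul, smul_eq_mul, MonoidAlgebra.coeff_single, Finsupp.single_apply]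
    simp only [FDRep.character, mul_inv_eq_one] at h
    simp only [mul_left_comm _ r, ← Finset.mul_sum]
    rw [h]
    split_ifs <;> ring

/-- Frobenius-type formula for the structure coefficients of the double-coset algebra of a
Gelfand pair `(G, K)`, in terms of the zonal spherical functions. -/
theorem stmt1 {G : Type} [Group G] [Fintype G] (K : Subgroup G)
    (hGelfand : ∀ x y : G,
      doubleCosetSum K x * doubleCosetSum K y = doubleCosetSum K y * doubleCosetSum K x)
    {I : Type} [Fintype I] (V : I → FDRep ℂ G)
    (hsimple : ∀ i, Simple (V i))
    (hpairwise : ∀ i j : I, i ≠ j → IsEmpty (V i ≅ V j))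
    (hcomplete : ∀ W : FDRep ℂ G, Simple W → ∃ i : I, Nonempty (W ≅ V i))
    (x₁ x₂ x₃ : G) :
    (Nat.card {p : G × G //
        (∃ k₁ ∈ K, ∃ k₂ ∈ K, p.1 = k₁ * x₁ * k₂) ∧
        (∃ k₁ ∈ K, ∃ k₂ ∈ K, p.2 = k₁ * x₂ * k₂) ∧ p.1 * p.2 = x₃} : ℂ) =
      (Nat.card {g : G // ∃ k₁ ∈ K, ∃ k₂ ∈ K, g = k₁ * x₁ * k₂} : ℂ) *
          (Nat.card {g : G // ∃ k₁ ∈ K, ∃ k₂ ∈ K, g = k₁ * x₂ * k₂} : ℂ) /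
          (Fintype.card G : ℂ) *
        ∑ i : I,
          (if ∃ v : V i, v ≠ 0 ∧ ∀ k ∈ K, ((V i).ρ k) v = v then
            (Module.finrank ℂ (V i) : ℂ) * zonalSpherical K (V i) x₁ *
              zonalSpherical K (V i) x₂ * (starRingEnd ℂ) (zonalSpherical K (V i) x₃)
          else 0) := by
  have hG : (Fintype.card G : ℂ) ≠ 0 := by simp
  have h := zz_coeff V hsimple hpairwise hcomplete x₃ (doubleCosetSum K x₁ * doubleCosetSum K x₂)
  rw [← zz_count, zz_dcs, zz_dcs, smul_mul_smul_comm] at h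
  simp only [smul_mul_assoc, map_smul, smul_eq_mul] at h
  have hirr : ∀ i, Representation.IsIrreducible (V := V i) (V i).ρ := fun i =>
    have := hsimple i
    zz_irr (V i)
  simp only [fun i => zz_term K hGelfand (V i).ρ (hirr i)] at h
  have h' := congrArg (starRingEnd ℂ) h
  simp only [map_mul (starRingEnd ℂ), map_natCast, map_sum] at h'
  rw [eq_comm, div_mul_eq_mul_div, div_eq_iff hG, mul_comm _ (Fintype.card G : ℂ), ← h',
    Finset.mul_sum]
  refine Finset.sum_congr rfl fun i _ => ?_
  have hz : ∀ x, LinearMap.trace ℂ (V i) (Representation.asAlgebraHom (V := V i) (V i).ρ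
      (MonoidAlgebra.single x 1 * zzE K)) = zonalSpherical K (V i) x⁻¹ := by
    intro x; rw [zz_zonal, inv_inv]
  split_ifs with hv
  · simp only [hz, map_mul (starRingEnd ℂ), zz_zonal_conj, inv_inv]
    ring
  · simp
end

section
/- Let G be a finite group and K a subgroup such that (G,K) is a Gelfand pair, and let (V_i)_{i∈I} be a complete family of irreducible representations of G. Then the number of indices i ∈ I such that V_i has a nonzero K-invariant vector equals the number of double cosets of K in G, i.e. the cardinality of the set {KxK : x ∈ G}. -/
open CategoryTheory
open scoped Classical

lemma gp_transitive {G : Type} [Group G] (V : FDRep ℂ G) [Simple V] (v w : V) (hv : v ≠ 0) :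
    ∃ a : MonoidAlgebra ℂ G, Representation.asAlgebraHom V.ρ a v = w := by
  let N : Submodule ℂ V :=
    LinearMap.range ((LinearMap.applyₗ v).comp (Representation.asAlgebraHom V.ρ).toLinearMap)
  have hN : ∀ g : G, ∀ x ∈ N, V.ρ g x ∈ N := by
    rintro g _ ⟨a, rfl⟩
    refine ⟨MonoidAlgebra.single g 1 * a, ?_⟩
    simp
  let S : Subrepresentation (V.ρ : Representation ℂ G V) := ⟨N, fun g x hx => hN g x hx⟩
  let W : FDRep ℂ G := FDRep.of S.toRepresentation
  let f : W ⟶ V := ⟨FGModuleCat.ofHom N.subtype, fun g => by ext x; rfl⟩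
  have hvN : v ∈ N := ⟨1, by simp⟩
  have hinj : Function.Injective f.hom := Subtype.val_injective
  have hmono : Mono f := by
    have : Mono ((forget (FDRep ℂ G)).map f) := (mono_iff_injective _).2 hinj
    exact (forget (FDRep ℂ G)).mono_of_mono_map this
  have hne : f ≠ 0 := by
    intro h
    have h2 : f.hom (⟨v, hvN⟩ : N) = 0 := by rw [h]; rfl
    exact hv h2
  have hiso : IsIso f := isIso_of_mono_of_nonzero hne
  have h3 := (FDRep.isoToLinearEquiv (asIso f)).surjective w
  obtain ⟨⟨_, a, rfl⟩, hx⟩ := h3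
  exact ⟨a, hx⟩

lemma gp_scalar {G : Type} [Group G] (V : FDRep ℂ G) [Simple V] (T : Module.End ℂ V)
    (hT : ∀ g, T * V.ρ g = V.ρ g * T) : ∃ μ : ℂ, T = μ • (1 : Module.End ℂ V) := by
  have hT' : ∀ a, T * Representation.asAlgebraHom V.ρ a = Representation.asAlgebraHom V.ρ a * T := by
    intro a
    induction a using MonoidAlgebra.induction_linear with
    | zero => simp
    | add x y hx hy => simp [mul_add, add_mul, hx, hy]
    | single g r => 
      rw [Representation.asAlgebraHom_single, mul_smul_comm, hT, smul_mul_assoc]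
  by_cases hn : Nontrivial V
  · obtain ⟨μ, hμ⟩ := Module.End.exists_eigenvalue T
    obtain ⟨v, hv⟩ := hμ.exists_hasEigenvector
    refine ⟨μ, LinearMap.ext fun w => ?_⟩
    obtain ⟨a, rfl⟩ := gp_transitive V v w hv.2
    have := LinearMap.congr_fun (hT' a) v
    simp only [Module.End.mul_apply, hv.apply_eq_smul] at this
    simpa using this
  · have : Subsingleton V := not_nontrivial_iff_subsingleton.1 hn
    exact ⟨0, LinearMap.ext fun w => Subsingleton.elim _ _⟩

lemma gp_proj {G : Type} [Group G] [Fintype G] {I : Type} (V : I → FDRep ℂ G)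
    (hsimple : ∀ i, Simple (V i))
    (hpairwise : ∀ i j : I, i ≠ j → IsEmpty (V i ≅ V j)) (i : I) :
    ∃ a : MonoidAlgebra ℂ G, ∀ j (v : V j), Representation.asAlgebraHom (V j).ρ a v
      = if j = i then v else 0 := by
  let p : MonoidAlgebra ℂ G := ∑ g : G, MonoidAlgebra.single g ((V i).character g⁻¹)
  have hp : ∀ j, Representation.asAlgebraHom (V j).ρ p = ∑ g : G, (V i).character g⁻¹ • (V j).ρ g := by
    intro j
    simp only [p, map_sum, Representation.asAlgebraHom_single]
  have hs : ∀ j, ∃ μ : ℂ, Representation.asAlgebraHom (V j).ρ p = μ • (1 : Module.End ℂ (V j)) := by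
    intro j
    apply gp_scalar
    intro h
    rw [hp, Finset.sum_mul, Finset.mul_sum]
    refine Fintype.sum_equiv (MulAut.conj h⁻¹).toEquiv _ _ fun g => ?_
    simp only [MulEquiv.toEquiv_eq_coe, EquivLike.coe_coe, MulAut.conj_apply, smul_mul_assoc, mul_smul_comm,
      ← map_mul]
    have := (V i).char_conj g⁻¹ h⁻¹
    simp only [mul_inv_rev, inv_inv, mul_assoc] at this ⊢
    rw [this]; simp
  choose μ hμ using hs
  have : Invertible (Nat.card G : ℂ) := invertibleOfNonzero (by simp)
  have htr : ∀ j, μ j * Module.finrank ℂ (V j) = ∑ g : G, (V j).character g * (V i).character g⁻¹ := by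
    intro j
    have := congrArg (LinearMap.trace ℂ (V j)) ((hμ j).symm.trans (hp j))
    simp only [map_smul, map_sum, LinearMap.trace_one, smul_eq_mul] at this
    rw [this]
    exact Finset.sum_congr rfl fun g _ => mul_comm _ _
  have hne : ∀ j, j ≠ i → μ j = 0 := by
    intro j hj
    have h1 := FDRep.char_orthonormal (V j) (V i)
    have := hpairwise j i hj
    rw [if_neg (by simpa using this), ← htr] at h1
    have h0 : Module.finrank ℂ (V j) ≠ 0 := by
      intro h0
      have : Subsingleton (V j) := Module.finrank_zero_iff.1 h0
      apply Simple.not_isZero (V j)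
      rw [Limits.IsZero.iff_id_eq_zero]
      ext x
      exact Subsingleton.elim (α := V j) _ _
    simpa [h0] using h1
  have heq : μ i ≠ 0 := by
    intro h0
    have h1 := FDRep.char_orthonormal (V i) (V i)
    rw [if_pos ⟨Iso.refl _⟩, ← htr, h0] at h1
    simp at h1
  refine ⟨(μ i)⁻¹ • p, fun j v => ?_⟩
  rw [map_smul, hμ]
  split_ifs with h
  · subst h; simp [heq]
  · simp [hne j h]


lemma gp_irr_zero {G : Type} [Group G] [Fintype G] {I : Type} (V : I → FDRep ℂ G)
    (hcomplete : ∀ W : FDRep ℂ G, Simple W → ∃ i : I, Nonempty (W ≅ V i))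
    (a : MonoidAlgebra ℂ G) (ha : ∀ i, Representation.asAlgebraHom (V i).ρ a = 0)
    {W : Type} [AddCommGroup W] [Module ℂ W] [Module.Finite ℂ W] (σ : Representation ℂ G W)
    (hirr : σ.IsIrreducible) (x : W) : σ.asAlgebraHom a x = 0 := by
  have : Invertible (Nat.card G : ℂ) := invertibleOfNonzero (by simp)
  have hsimp : Simple (FDRep.of σ) := by
    rw [FDRep.simple_iff_char_is_norm_one]
    have h := Representation.char_orthonormal σ σ
    rw [if_pos ⟨Representation.Equiv.refl _⟩] at h
    have h2 : (Nat.card G : ℂ) ≠ 0 := by simp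
    rw [inv_mul_eq_iff_eq_mul₀ h2, mul_one] at h
    exact h
  obtain ⟨i, ⟨φ⟩⟩ := hcomplete _ hsimp
  have hconj : ∀ b (y : W), FDRep.isoToLinearEquiv φ (σ.asAlgebraHom b y) =
      Representation.asAlgebraHom (V i).ρ b (FDRep.isoToLinearEquiv φ y) := by
    intro b
    induction b using MonoidAlgebra.induction_linear with
    | zero => intro y; simp
    | add x y hx hy =>
      intro z
      rw [map_add, map_add, LinearMap.add_apply, LinearMap.add_apply, ← hx, ← hy]
      exact map_add _ _ _
    | single g r =>
      intro y
      rw [Representation.asAlgebraHom_single, Representation.asAlgebraHom_single, FDRep.Iso.conj_ρ φ,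
        LinearMap.smul_apply, LinearMap.smul_apply, LinearEquiv.conj_apply_apply,
        LinearEquiv.symm_apply_apply]
      exact map_smul (FDRep.isoToLinearEquiv φ) _ _
  have h1 := hconj a x
  rw [ha, LinearMap.zero_apply] at h1
  exact (LinearEquiv.map_eq_zero_iff _).1 h1

lemma gp_simple_zero {G : Type} [Group G] [Fintype G] {I : Type} (V : I → FDRep ℂ G)
    (hcomplete : ∀ W : FDRep ℂ G, Simple W → ∃ i : I, Nonempty (W ≅ V i))
    (a : MonoidAlgebra ℂ G) (ha : ∀ i, Representation.asAlgebraHom (V i).ρ a = 0)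
    {M : Type} [AddCommGroup M] [Module (MonoidAlgebra ℂ G) M] [Module ℂ M]
    [IsScalarTower ℂ (MonoidAlgebra ℂ G) M]
    (hM : IsSimpleModule (MonoidAlgebra ℂ G) M) (x : M) : a • x = 0 := by
  have : Module.Finite ℂ M := Module.Finite.trans (MonoidAlgebra ℂ G) _
  let σ : Representation ℂ G M := Representation.ofModule' M
  have hσ : ∀ (b : MonoidAlgebra ℂ G) (y : M), σ.asAlgebraHom b y = b • y := by
    intro b y
    have : σ.asAlgebraHom = Algebra.lsmul ℂ ℂ M := by
      exact Equiv.apply_symm_apply (MonoidAlgebra.lift ℂ (M →ₗ[ℂ] M) G) _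
    rw [this]; rfl
  let e : σ.asModule ≃ₗ[MonoidAlgebra ℂ G] M :=
    { σ.asModuleEquiv.toAddEquiv with
      map_smul' := fun b y => hσ b (σ.asModuleEquiv y) }
  have hirr : σ.IsIrreducible := by
    rw [Representation.irreducible_iff_isSimpleModule_asModule]
    exact IsSimpleModule.congr e
  rw [← hσ]
  exact gp_irr_zero V hcomplete a ha σ hirr x

lemma gp_faithful {G : Type} [Group G] [Fintype G] {I : Type} (V : I → FDRep ℂ G)
    (hcomplete : ∀ W : FDRep ℂ G, Simple W → ∃ i : I, Nonempty (W ≅ V i))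
    (a : MonoidAlgebra ℂ G) (ha : ∀ i, Representation.asAlgebraHom (V i).ρ a = 0) : a = 0 := by
  have : NeZero (Nat.card G : ℂ) := ⟨by simp⟩
  have hann := IsSemisimpleModule.sSup_simples_eq_top (MonoidAlgebra ℂ G) (MonoidAlgebra ℂ G)
  have h1 : (1 : MonoidAlgebra ℂ G) ∈ (⊤ : Submodule (MonoidAlgebra ℂ G) (MonoidAlgebra ℂ G)) :=
    trivial
  rw [← hann, sSup_eq_iSup', ] at h1
  suffices a * 1 = 0 by simpa using this
  refine Submodule.iSup_induction _ (motive := fun x => a * x = 0) h1 ?_ (mul_zero _) ?_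
  · rintro ⟨m, hm⟩ x hx
    have := gp_simple_zero V hcomplete a ha hm ⟨x, hx⟩
    simpa using congrArg Subtype.val this
  · intro x y hx hy
    rw [mul_add, hx, hy, add_zero]

/-- The set of double cosets. -/
abbrev GPD {G : Type} [Group G] (K : Subgroup G) : Type :=
  {s : Set G // ∃ x : G, s = {g : G | ∃ k₁ ∈ K, ∃ k₂ ∈ K, g = k₁ * x * k₂}}

/-- The double coset of `x`. -/
def gpQ {G : Type} [Group G] (K : Subgroup G) (x : G) : GPD K :=
  ⟨{g : G | ∃ k₁ ∈ K, ∃ k₂ ∈ K, g = k₁ * x * k₂}, x, rfl⟩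

lemma gpQ_surj {G : Type} [Group G] (K : Subgroup G) (d : GPD K) : ∃ x, gpQ K x = d := by
  obtain ⟨s, x, rfl⟩ := d
  exact ⟨x, rfl⟩

lemma gpQ_eq {G : Type} [Group G] (K : Subgroup G) (x y : G) :
    gpQ K x = gpQ K y ↔ ∃ k₁ ∈ K, ∃ k₂ ∈ K, x = k₁ * y * k₂ := by
  constructor
  · intro h
    have h1 : x ∈ (gpQ K x).1 := ⟨1, K.one_mem, 1, K.one_mem, by simp⟩
    rw [h] at h1
    exact h1
  · rintro ⟨a, ha, b, hb, rfl⟩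
    apply Subtype.ext
    ext g
    constructor
    · rintro ⟨c, hc, d, hd, rfl⟩
      exact ⟨c * a, K.mul_mem hc ha, b * d, K.mul_mem hb hd, by group⟩
    · rintro ⟨c, hc, d, hd, rfl⟩
      exact ⟨c * a⁻¹, K.mul_mem hc (K.inv_mem ha), b⁻¹ * d, K.mul_mem (K.inv_mem hb) hd, by group⟩

/-- Functions on double cosets as elements of the group algebra. -/
noncomputable def gpL {G : Type} [Group G] [Fintype G] (K : Subgroup G) :
    (GPD K → ℂ) →ₗ[ℂ] MonoidAlgebra ℂ G where
  toFun c := ∑ g : G, MonoidAlgebra.single g (c (gpQ K g))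
  map_add' c d := by simp [Finset.sum_add_distrib]
  map_smul' r c := by simp [Finset.smul_sum]

lemma gpL_coeff {G : Type} [Group G] [Fintype G] (K : Subgroup G) (c : GPD K → ℂ) (g : G) :
    (gpL K c).coeff g = c (gpQ K g) := by
  simp [gpL, MonoidAlgebra.coeff_sum, Finsupp.finsetSum_apply, Finsupp.single_apply]

lemma gp_dcs_coeff {G : Type} [Group G] [Fintype G] (K : Subgroup G) (x g : G) :
    (doubleCosetSum K x).coeff g = if gpQ K g = gpQ K x then 1 else 0 := by
  simp only [doubleCosetSum, MonoidAlgebra.coeff_sum, Finsupp.finsetSum_apply,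
    MonoidAlgebra.coeff_single, Finsupp.single_apply, gpQ_eq]
  simp

lemma gpL_eq {G : Type} [Group G] [Fintype G] (K : Subgroup G) (c : GPD K → ℂ) :
    gpL K c = ∑ d : GPD K, c d • doubleCosetSum K (gpQ_surj K d).choose := by
  apply MonoidAlgebra.coeff_injective
  ext g
  rw [gpL_coeff]
  simp only [MonoidAlgebra.coeff_sum, Finsupp.finsetSum_apply, MonoidAlgebra.coeff_smul,
    Finsupp.smul_apply, gp_dcs_coeff, (gpQ_surj K _).choose_spec]
  simp

lemma gpL_comm {G : Type} [Group G] [Fintype G] (K : Subgroup G)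
    (hGelfand : ∀ x y : G,
      doubleCosetSum K x * doubleCosetSum K y = doubleCosetSum K y * doubleCosetSum K x)
    (c d : GPD K → ℂ) : gpL K c * gpL K d = gpL K d * gpL K c := by
  rw [gpL_eq, gpL_eq]
  refine Commute.sum_left _ _ _ fun i _ => Commute.sum_right _ _ _ fun j _ => ?_
  exact ((show Commute _ _ from hGelfand _ _).smul_left _).smul_right _

lemma gpL_surj {G : Type} [Group G] [Fintype G] (K : Subgroup G) (f : MonoidAlgebra ℂ G)
    (h1 : ∀ k ∈ K, MonoidAlgebra.single k 1 * f = f)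
    (h2 : ∀ k ∈ K, f * MonoidAlgebra.single k 1 = f) : ∃ c, gpL K c = f := by
  refine ⟨fun d => f.coeff (gpQ_surj K d).choose, ?_⟩
  apply MonoidAlgebra.coeff_injective
  ext g
  rw [gpL_coeff]
  obtain ⟨a, ha, b, hb, h⟩ := (gpQ_eq K _ _).1 (gpQ_surj K (gpQ K g)).choose_spec
  rw [h]
  conv_lhs => rw [← h1 a ha, ← h2 b hb]
  simp [mul_assoc]

lemma gpL_left {G : Type} [Group G] [Fintype G] (K : Subgroup G) (c : GPD K → ℂ) (k : G)
    (hk : k ∈ K) : MonoidAlgebra.single k 1 * gpL K c = gpL K c := by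
  apply MonoidAlgebra.coeff_injective
  ext g
  have := (gpQ_eq K (k⁻¹ * g) g).2 ⟨k⁻¹, K.inv_mem hk, 1, K.one_mem, by simp⟩
  simp [gpL_coeff, this]

lemma gpL_right {G : Type} [Group G] [Fintype G] (K : Subgroup G) (c : GPD K → ℂ) (k : G)
    (hk : k ∈ K) : gpL K c * MonoidAlgebra.single k 1 = gpL K c := by
  apply MonoidAlgebra.coeff_injective
  ext g
  have := (gpQ_eq K (g * k⁻¹) g).2 ⟨1, K.one_mem, k⁻¹, K.inv_mem hk, by simp⟩
  simp [gpL_coeff, this]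

/-- The averaging idempotent. -/
noncomputable def gpE {G : Type} [Group G] [Fintype G] (K : Subgroup G) : MonoidAlgebra ℂ G :=
  (Fintype.card K : ℂ)⁻¹ • ∑ k : K, MonoidAlgebra.single (k : G) 1

lemma gpE_left {G : Type} [Group G] [Fintype G] (K : Subgroup G) (k : G)
    (hk : k ∈ K) : MonoidAlgebra.single k 1 * gpE K = gpE K := by
  rw [gpE, mul_smul_comm, Finset.mul_sum]
  congr 1
  exact Fintype.sum_equiv (Equiv.mulLeft ⟨k, hk⟩) _ _ fun x => by simp

lemma gpE_right {G : Type} [Group G] [Fintype G] (K : Subgroup G) (k : G)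
    (hk : k ∈ K) : gpE K * MonoidAlgebra.single k 1 = gpE K := by
  rw [gpE, smul_mul_assoc, Finset.sum_mul]
  congr 1
  exact Fintype.sum_equiv (Equiv.mulRight ⟨k, hk⟩) _ _ fun x => by simp

lemma gpL_E {G : Type} [Group G] [Fintype G] (K : Subgroup G) (c : GPD K → ℂ) :
    gpL K c * gpE K = gpL K c := by
  rw [gpE, mul_smul_comm, Finset.mul_sum, Finset.sum_congr rfl fun (k : K) _ => gpL_right K c k k.2]
  rw [Finset.sum_const, Finset.card_univ, ← Nat.cast_smul_eq_nsmul ℂ, smul_smul,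
    inv_mul_cancel₀ (by simp), one_smul]

lemma gpE_fix {G : Type} [Group G] [Fintype G] (K : Subgroup G) (V : FDRep ℂ G) (v : V)
    (hv : ∀ k ∈ K, V.ρ k v = v) : Representation.asAlgebraHom V.ρ (gpE K) v = v := by
  rw [gpE, map_smul, map_sum, LinearMap.smul_apply, LinearMap.sum_apply]
  rw [Finset.sum_congr rfl (g := fun _ => v) fun k _ => by simpa using hv k k.2]
  rw [Finset.sum_const, Finset.card_univ, ← Nat.cast_smul_eq_nsmul ℂ, smul_smul,
    inv_mul_cancel₀ (by simp), one_smul]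

lemma gp_inv {G : Type} [Group G] (V : FDRep ℂ G) (a : MonoidAlgebra ℂ G) (v : V) (k : G)
    (h : MonoidAlgebra.single k 1 * a = a) :
    V.ρ k (Representation.asAlgebraHom V.ρ a v) = Representation.asAlgebraHom V.ρ a v := by
  conv_rhs => rw [← h]
  simp

lemma gp_EaE {G : Type} [Group G] [Fintype G] (K : Subgroup G) (a : MonoidAlgebra ℂ G) :
    ∃ c, gpL K c = gpE K * a * gpE K := by
  apply gpL_surj
  · intro k hk
    rw [← mul_assoc, ← mul_assoc, gpE_left K k hk]
  · intro k hk
    rw [mul_assoc, gpE_right K k hk]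

lemma gp_char {G : Type} [Group G] [Fintype G] (K : Subgroup G)
    (hGelfand : ∀ x y : G,
      doubleCosetSum K x * doubleCosetSum K y = doubleCosetSum K y * doubleCosetSum K x)
    (V : FDRep ℂ G) [Simple V] (hV : ∃ v : V, v ≠ 0 ∧ ∀ k ∈ K, (V.ρ k) v = v) (c : GPD K → ℂ) :
    ∃ μ : ℂ, ∀ w : V, (∀ k ∈ K, (V.ρ k) w = w) →
      Representation.asAlgebraHom V.ρ (gpL K c) w = μ • w := by
  let F : Submodule ℂ V :=
    { carrier := {w | ∀ k ∈ K, (V.ρ k) w = w}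
      zero_mem' := fun k _ => map_zero _
      add_mem' := fun {x y} hx hy k hk => by rw [map_add, hx k hk, hy k hk]
      smul_mem' := fun r x hx k hk => by rw [map_smul, hx k hk] }
  obtain ⟨v, hv, hvK⟩ := hV
  have : Nontrivial F := ⟨⟨⟨v, hvK⟩, 0, fun h => hv (congrArg Subtype.val h)⟩⟩
  let T : Module.End ℂ F := (Representation.asAlgebraHom V.ρ (gpL K c)).restrict
    (p := F) (q := F) fun w _ k hk => gp_inv V _ w k (gpL_left K c k hk)
  obtain ⟨μ, hμ⟩ := Module.End.exists_eigenvalue T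
  obtain ⟨⟨x, hxK⟩, hx⟩ := hμ.exists_hasEigenvector
  have hx1 : Representation.asAlgebraHom V.ρ (gpL K c) x = μ • x :=
    congrArg Subtype.val hx.apply_eq_smul
  have hx0 : x ≠ 0 := fun h => hx.2 (Subtype.ext h)
  refine ⟨μ, fun w hw => ?_⟩
  obtain ⟨a, ha⟩ := gp_transitive V x w hx0
  obtain ⟨d, hd⟩ := gp_EaE K a
  have hdx : Representation.asAlgebraHom V.ρ (gpL K d) x = w := by
    rw [hd, map_mul, map_mul, Module.End.mul_apply, Module.End.mul_apply, gpE_fix K V x hxK, ha,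
      gpE_fix K V w hw]
  rw [← hdx, ← Module.End.mul_apply, ← map_mul, gpL_comm K hGelfand, map_mul, Module.End.mul_apply,
    hx1, map_smul]

/-- For a Gelfand pair `(G, K)`, the number of irreducible representations having a nonzero
`K`-invariant vector equals the number of double cosets of `K` in `G`. -/
theorem stmt2 {G : Type} [Group G] [Fintype G] (K : Subgroup G)
    (hGelfand : ∀ x y : G,
      doubleCosetSum K x * doubleCosetSum K y = doubleCosetSum K y * doubleCosetSum K x)
    {I : Type} [Fintype I] (V : I → FDRep ℂ G)
    (hsimple : ∀ i, Simple (V i))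
    (hpairwise : ∀ i j : I, i ≠ j → IsEmpty (V i ≅ V j))
    (hcomplete : ∀ W : FDRep ℂ G, Simple W → ∃ i : I, Nonempty (W ≅ V i)) :
    Nat.card {i : I // ∃ v : V i, v ≠ 0 ∧ ∀ k ∈ K, ((V i).ρ k) v = v} =
      Nat.card {s : Set G // ∃ x : G, s = {g : G | ∃ k₁ ∈ K, ∃ k₂ ∈ K, g = k₁ * x * k₂}} := by
  let S := {i : I // ∃ v : V i, v ≠ 0 ∧ ∀ k ∈ K, ((V i).ρ k) v = v}
  change Nat.card S = Nat.card (GPD K)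
  choose χ hχ using fun i : S => gp_char K hGelfand (V i.1) i.2
  have uniq : ∀ (i : S) (c) (μ : ℂ), (∀ w : V i.1, (∀ k ∈ K, ((V i.1).ρ k) w = w) →
      Representation.asAlgebraHom (V i.1).ρ (gpL K c) w = μ • w) → χ i c = μ := by
    intro i c μ h
    obtain ⟨v, hv, hvK⟩ := i.2
    have := (hχ i c v hvK).symm.trans (h v hvK)
    exact smul_left_injective ℂ hv this
  let Ψ : (GPD K → ℂ) →ₗ[ℂ] (S → ℂ) :=
    { toFun := fun c i => χ i c
      map_add' := fun c d => by
        ext i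
        refine uniq i _ _ fun w hw => ?_
        rw [map_add, map_add, LinearMap.add_apply, hχ i c w hw, hχ i d w hw, Pi.add_apply, add_smul]
      map_smul' := fun r c => by
        ext i
        refine uniq i _ _ fun w hw => ?_
        rw [map_smul, map_smul, LinearMap.smul_apply, hχ i c w hw, smul_smul]; rfl }
  have hinj : Function.Injective Ψ := by
    rw [injective_iff_map_eq_zero]
    intro c hc
    have h0 : gpL K c = 0 := by
      apply gp_faithful V hcomplete
      intro i
      ext w
      rw [← gpL_E, map_mul, Module.End.mul_apply]
      have hinv : ∀ k ∈ K, ((V i).ρ k) (Representation.asAlgebraHom (V i).ρ (gpE K) w) =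
          Representation.asAlgebraHom (V i).ρ (gpE K) w :=
        fun k hk => gp_inv _ _ _ _ (gpE_left K k hk)
      by_cases hw : Representation.asAlgebraHom (V i).ρ (gpE K) w = 0
      · rw [hw]; simp
      · have h1 := hχ ⟨i, _, hw, hinv⟩ c _ hinv
        have h2 : χ ⟨i, _, hw, hinv⟩ c = 0 := congrFun hc _
        rw [h1, h2]; simp
    ext d
    obtain ⟨x, rfl⟩ := gpQ_surj K d
    rw [← gpL_coeff K c x, h0]; rfl
  have hsurj : Function.Surjective Ψ := by
    rw [← LinearMap.range_eq_top, eq_top_iff, ← (Pi.basisFun ℂ S).span_eq, Submodule.span_le]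
    rintro _ ⟨i, rfl⟩
    obtain ⟨a, ha⟩ := gp_proj V hsimple hpairwise i.1
    obtain ⟨c, hc⟩ := gp_EaE K a
    refine ⟨c, ?_⟩
    ext j
    refine uniq j _ _ fun w hw => ?_
    rw [hc, map_mul, map_mul, Module.End.mul_apply, Module.End.mul_apply, gpE_fix K _ w hw, ha]
    by_cases h : j = i
    · subst h; simp [gpE_fix K _ w hw]
    · have h' : j.1 ≠ i.1 := fun e => h (Subtype.ext e)
      simp [h', h]
  have := (LinearEquiv.ofBijective Ψ ⟨hinj, hsurj⟩).finrank_eq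
  rw [Module.finrank_fintype_fun_eq_card, Module.finrank_fintype_fun_eq_card] at this
  rw [Nat.card_eq_fintype_card, Nat.card_eq_fintype_card, this]
end

section
/- Let n ≥ 2, let μ and ν be partitions of n, write m_t := m_t(μ), let T ⊂ S_n be the set of transpositions and C_μ the set of permutations of cycle type μ, and fix π ∈ S_n of cycle type ν. Then N := #{(τ,σ) ∈ T × C_μ : τ·σ = π} is given as follows: (i) N = k·(m_k+1)·(i−k)·(m_{i−k}+1) if ν arises from μ by deleting one part i and inserting two parts k and i−k with 1 ≤ k < i−k; (ii) N = k²·(m_k+1)·(m_k+2)/2 if ν arises from μ by deleting one part i = 2k and inserting two parts equal to k; (iii) N = (i+k)·(m_{i+k}+1) if ν arises from μ by deleting two distinct parts i and k and inserting one part i+k; (iv) N = i·(m_{2i}+1) if ν arises from μ by deleting two equal parts i, i and inserting one part 2i; (v) N = 0 in all other cases. (Here 'ν arises from μ by deleting/inserting parts' means equality of the corresponding multisets of parts; this describes the expansion of the product C_{(2,1^{n−2})}·C_μ of class sums in Z(ℂ[S_n]).) -/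
/-- A permutation of `n` has cycle type the partition `μ` of `n` precisely when its
Mathlib cycle type (which omits fixed points) consists of the parts of `μ` that are `≥ 2`. -/
def permHasCycleType {n : ℕ} (σ : Equiv.Perm (Fin n)) (μ : n.Partition) : Prop :=
  σ.cycleType = μ.parts.filter (fun p => 2 ≤ p)

namespace Stmt5
open Equiv Equiv.Perm Function

variable {n : ℕ}

/-- cycle length of the point x -/
noncomputable def L (σ : Perm (Fin n)) (x : Fin n) : ℕ := minimalPeriod σ x

def cls (σ : Perm (Fin n)) (x : Fin n) : Finset (Fin n) :=
  Finset.univ.filter (fun y => σ.SameCycle x y)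

lemma mem_cls {σ : Perm (Fin n)} {x y : Fin n} : y ∈ cls σ x ↔ σ.SameCycle x y := by
  simp [cls]

lemma mem_per (σ : Perm (Fin n)) (x : Fin n) : x ∈ periodicPts σ :=
  σ.injective.mem_periodicPts x

lemma L_pos (σ : Perm (Fin n)) (x : Fin n) : 0 < L σ x :=
  minimalPeriod_pos_of_mem_periodicPts (mem_per σ x)

lemma same_iff {σ : Perm (Fin n)} {x y : Fin n} :
    σ.SameCycle x y ↔ ∃ i < L σ x, σ^[i] x = y := by
  constructor
  · intro h
    obtain ⟨i, _, hi⟩ := h.exists_pow_eq'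
    refine ⟨i % L σ x, Nat.mod_lt _ (L_pos σ x), ?_⟩
    rw [L, iterate_mod_minimalPeriod_eq, iterate_eq_pow, hi]
  · rintro ⟨i, _, rfl⟩
    exact ⟨i, by simp [iterate_eq_pow]⟩

lemma same_iter (σ : Perm (Fin n)) (x : Fin n) (i : ℕ) : σ.SameCycle x (σ^[i] x) :=
  ⟨i, by simp [iterate_eq_pow]⟩

lemma cls_card (σ : Perm (Fin n)) (x : Fin n) : (cls σ x).card = L σ x := by
  have : cls σ x = (Finset.range (L σ x)).image (fun i => σ^[i] x) := by
    ext y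
    simp [mem_cls, same_iff]
  rw [this, Finset.card_image_of_injOn, Finset.card_range]
  intro i hi j hj h
  simp at hi hj
  exact iterate_injOn_Iio_minimalPeriod (f := σ) (x := x) hi hj h

lemma cls_eq {σ : Perm (Fin n)} {x y : Fin n} (h : σ.SameCycle x y) : cls σ x = cls σ y := by
  ext z
  simp only [mem_cls]
  exact ⟨fun k => h.symm.trans k, fun k => h.trans k⟩

lemma L_same {σ : Perm (Fin n)} {x y : Fin n} (h : σ.SameCycle x y) : L σ x = L σ y := by
  rw [← cls_card, ← cls_card, cls_eq h]

lemma iter_ne {σ : Perm (Fin n)} {x : Fin n} {i : ℕ} (h0 : 0 < i) (h : i < L σ x) :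
    σ^[i] x ≠ x := by
  intro h'
  exact not_isPeriodicPt_of_pos_of_lt_minimalPeriod h0.ne' h h'

/-- number of points on cycles of length k -/
noncomputable def P (σ : Perm (Fin n)) (k : ℕ) : ℕ := (Finset.univ.filter (fun x => L σ x = k)).card

def pt (σ : Perm (Fin n)) : Multiset ℕ := σ.partition.parts

lemma pt_pos (σ : Perm (Fin n)) {k : ℕ} (h : k ∈ pt σ) : 0 < k := σ.partition.parts_pos h

lemma L_eq_one {σ : Perm (Fin n)} {x : Fin n} : L σ x = 1 ↔ σ x = x :=
  minimalPeriod_eq_one_iff_isFixedPt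

lemma L_supp {σ : Perm (Fin n)} {x : Fin n} (h : σ x ≠ x) :
    (σ.cycleOf x).support.card = L σ x := by
  rw [← cls_card]
  congr 1
  ext y
  rw [mem_cls, mem_support_cycleOf_iff' h]

lemma P_eq (σ : Perm (Fin n)) (k : ℕ) : P σ k = k * (pt σ).count k := by
  unfold P pt
  rw [parts_partition, Multiset.count_add, Multiset.count_replicate]
  rcases Nat.lt_or_ge k 2 with hk | hk
  · have h0 : σ.cycleType.count k = 0 := by
      rw [Multiset.count_eq_zero]
      intro h
      have := two_le_of_mem_cycleType h
      omega
    rw [h0]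
    interval_cases k
    · have : ∀ x, L σ x ≠ 0 := fun x => (L_pos σ x).ne'
      simp [this]
    · simp only [L_eq_one]
      have : (Finset.univ.filter (fun x => σ x = x)) = σ.supportᶜ := by
        ext x; simp
      rw [this, Finset.card_compl]; simp
  · rw [if_neg (by omega), add_zero, cycleType_def, Multiset.count_map]
    have : (Finset.univ.filter (fun x => L σ x = k)) =
        (σ.cycleFactorsFinset.filter (fun c => k = c.support.card)).biUnion support := by
      ext x
      simp only [Finset.mem_filter, Finset.mem_univ, true_and, Finset.mem_biUnion]
      constructor
      · intro h
        have hx : σ x ≠ x := by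
          intro hx
          rw [← L_eq_one] at hx
          omega
        refine ⟨σ.cycleOf x, ⟨cycleOf_mem_cycleFactorsFinset_iff.2 (mem_support.2 hx), ?_⟩, ?_⟩
        · rw [L_supp hx, h]
        · rw [mem_support_cycleOf_iff' hx]
      · rintro ⟨c, ⟨hc, hk'⟩, hx⟩
        have e := cycle_is_cycleOf hx hc
        have hx' : σ x ≠ x := by
          have := mem_cycleFactorsFinset_support_le hc hx
          exact mem_support.1 this
        rw [← L_supp hx', ← e, hk']
    rw [this, Finset.card_biUnion]
    · rw [Finset.sum_congr rfl (g := fun _ => k)]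
      · rw [Finset.sum_const, smul_eq_mul, mul_comm]
        rfl
      · intro c hc
        simp at hc
        exact hc.2.symm
    · intro c hc d hd hcd
      simp at hc hd
      exact (cycleFactorsFinset_pairwise_disjoint σ hc.1 hd.1 hcd).disjoint_support

lemma type_iff (σ : Perm (Fin n)) (μ : n.Partition) :
    permHasCycleType σ μ ↔ pt σ = μ.parts := by
  unfold permHasCycleType pt
  constructor
  · intro h
    have h1 : μ.parts = μ.parts.filter (fun p => 2 ≤ p) + μ.parts.filter (fun p => ¬ 2 ≤ p) :=
      (Multiset.filter_add_not _ _).symm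
    have h2 : μ.parts.filter (fun p => ¬ 2 ≤ p) =
        Multiset.replicate (μ.parts.filter (fun p => ¬ 2 ≤ p)).card 1 := by
      rw [Multiset.eq_replicate]
      refine ⟨rfl, ?_⟩
      intro b hb
      rw [Multiset.mem_filter] at hb
      have := μ.parts_pos hb.1
      omega
    have h3 := μ.parts_sum
    have h4 := σ.partition.parts_sum
    rw [parts_partition, Multiset.sum_add, Fintype.card_fin] at h4
    rw [h1, h2, ← h, Multiset.sum_add] at h3
    simp only [Multiset.sum_replicate, smul_eq_mul, mul_one] at h3 h4
    rw [parts_partition, h1, h2, ← h, Fintype.card_fin]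
    congr 2
    omega
  · intro h
    rw [← h, parts_partition, Multiset.filter_add]
    rw [Multiset.filter_eq_self.2 (fun a ha => two_le_of_mem_cycleType ha)]
    rw [Multiset.filter_eq_nil.2, add_zero]
    intro a ha
    rw [Multiset.eq_of_mem_replicate ha]
    omega

lemma sw_iter {π : Perm (Fin n)} {a b : Fin n} {m : ℕ}
    (h : ∀ i, 0 < i → i < m → π^[i] a ≠ a ∧ π^[i] a ≠ b) :
    ∀ i < m, (swap a b * π)^[i] a = π^[i] a := by
  intro i
  induction i with
  | zero => simp
  | succ i ih =>
    intro hi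
    rw [iterate_succ_apply', ih (by omega)]
    have := h (i+1) (by omega) hi
    rw [iterate_succ_apply'] at this ⊢
    rw [Perm.mul_apply, swap_apply_of_ne_of_ne this.1 this.2]

lemma merge_sub {π : Perm (Fin n)} {a b : Fin n} (h : ¬ π.SameCycle a b) :
    (∀ x, π.SameCycle a x → (swap a b * π).SameCycle a x) ∧ (swap a b * π).SameCycle a b := by
  have key := sw_iter (π := π) (a := a) (b := b) (m := L π a) (by
    intro i h0 h1
    refine ⟨iter_ne h0 h1, ?_⟩
    intro h'
    exact h (h' ▸ same_iter π a i))
  constructor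
  · intro x hx
    obtain ⟨i, hi, rfl⟩ := same_iff.1 hx
    rw [← key i hi]
    exact same_iter _ _ _
  · have hp := L_pos π a
    have : (swap a b * π)^[L π a - 1 + 1] a = b := by
      rw [iterate_succ_apply', key _ (by omega), Perm.mul_apply, ← iterate_succ_apply' π,
        Nat.succ_eq_add_one, Nat.sub_add_cancel hp, L, iterate_minimalPeriod, swap_apply_left]
    nth_rewrite 2 [← this]
    exact same_iter _ _ _

lemma merge_cls {π : Perm (Fin n)} {a b : Fin n} (h : ¬ π.SameCycle a b) :
    cls (swap a b * π) a = cls π a ∪ cls π b := by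
  obtain ⟨h1, h2⟩ := merge_sub h
  obtain ⟨h3, _⟩ := merge_sub (fun h' => h h'.symm : ¬ π.SameCycle b a)
  rw [swap_comm] at h3
  ext x
  simp only [Finset.mem_union, mem_cls]
  constructor
  · intro hx
    obtain ⟨i, -, rfl⟩ := same_iff.1 hx
    clear hx
    induction i with
    | zero => left; exact SameCycle.refl _ _
    | succ i ih =>
      rw [iterate_succ_apply', Perm.mul_apply]
      set z := (⇑(swap a b * π))^[i] a
      rw [swap_apply_def]
      split_ifs with e1 e2
      · right; exact SameCycle.refl _ _
      · left; exact SameCycle.refl _ _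
      · simpa only [sameCycle_apply_right] using ih
  · rintro (hx | hx)
    · exact h1 x hx
    · exact h2.trans (h3 x hx)

lemma out_iter {π : Perm (Fin n)} {a b x : Fin n} (ha : ¬ π.SameCycle a x)
    (hb : ¬ π.SameCycle b x) (i : ℕ) : (swap a b * π)^[i] x = π^[i] x := by
  induction i with
  | zero => rfl
  | succ i ih =>
    rw [iterate_succ_apply', ih, iterate_succ_apply', Perm.mul_apply, ← iterate_succ_apply' π]
    apply swap_apply_of_ne_of_ne
    · intro h; exact ha (h ▸ (same_iter π x (i+1)).symm)
    · intro h; exact hb (h ▸ (same_iter π x (i+1)).symm)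

lemma out_L {π : Perm (Fin n)} {a b x : Fin n} (ha : ¬ π.SameCycle a x)
    (hb : ¬ π.SameCycle b x) : L (swap a b * π) x = L π x := by
  unfold L
  rw [minimalPeriod_eq_minimalPeriod_iff]
  intro i
  rw [IsPeriodicPt, IsPeriodicPt, IsFixedPt, IsFixedPt, out_iter ha hb]

lemma merge_P {π : Perm (Fin n)} {a b : Fin n} (h : ¬ π.SameCycle a b) (k : ℕ) :
    P (swap a b * π) k + ((if L π a = k then L π a else 0) + (if L π b = k then L π b else 0))
      = P π k + (if L π a + L π b = k then L π a + L π b else 0) := by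
  have hd : Disjoint (cls π a) (cls π b) := by
    rw [Finset.disjoint_left]
    intro x hx hy
    exact h ((mem_cls.1 hx).trans (mem_cls.1 hy).symm)
  have hL : L (swap a b * π) a = L π a + L π b := by
    rw [← cls_card, merge_cls h, Finset.card_union_of_disjoint hd, cls_card, cls_card]
  have key : ∀ σ : Perm (Fin n), P σ k =
      (∑ x ∈ (cls π a ∪ cls π b)ᶜ, if L σ x = k then 1 else 0) +
      ((∑ x ∈ cls π a, if L σ x = k then 1 else 0) +
       (∑ x ∈ cls π b, if L σ x = k then 1 else 0)) := by
    intro σ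
    rw [← Finset.sum_union hd, add_comm, Finset.sum_add_sum_compl, P, Finset.card_filter]
  rw [key, key]
  have e0 : (∑ x ∈ (cls π a ∪ cls π b)ᶜ, if L (swap a b * π) x = k then 1 else 0) =
      (∑ x ∈ (cls π a ∪ cls π b)ᶜ, if L π x = k then 1 else 0) := by
    apply Finset.sum_congr rfl
    intro x hx
    simp only [Finset.mem_compl, Finset.mem_union, mem_cls, not_or] at hx
    rw [out_L hx.1 hx.2]
  have e1 : ∀ c, (∑ x ∈ cls π c, if L π x = k then 1 else 0) = if L π c = k then L π c else 0 := by
    intro c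
    rw [Finset.sum_congr rfl (g := fun _ => if L π c = k then 1 else 0)]
    · rw [Finset.sum_const, cls_card]; simp
    · intro x hx
      rw [L_same (mem_cls.1 hx)]
  have e2 : ∀ c, (∀ x ∈ cls π c, x ∈ cls (swap a b * π) a) →
      (∑ x ∈ cls π c, if L (swap a b * π) x = k then 1 else 0) =
        if L π a + L π b = k then L π c else 0 := by
    intro c hc
    rw [Finset.sum_congr rfl (g := fun _ => if L π a + L π b = k then 1 else 0)]
    · rw [Finset.sum_const, cls_card]; simp
    · intro x hx
      rw [← L_same (mem_cls.1 (hc x hx)), hL]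
  rw [e0, e1, e1, e2 a, e2 b]
  · split_ifs <;> omega
  · intro x hx; rw [merge_cls h]; exact Finset.mem_union_right _ hx
  · intro x hx; rw [merge_cls h]; exact Finset.mem_union_left _ hx

lemma merge_pt {π : Perm (Fin n)} {a b : Fin n} (h : ¬ π.SameCycle a b) :
    pt (swap a b * π) + {L π a, L π b} = pt π + {L π a + L π b} := by
  ext k
  rcases Nat.eq_zero_or_pos k with rfl | hk
  · have hA := L_pos π a
    have hB := L_pos π b
    rw [Multiset.count_eq_zero.2, Multiset.count_eq_zero.2]
    · intro h'
      rw [Multiset.mem_add] at h'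
      rcases h' with h' | h'
      · exact absurd (pt_pos _ h') (by omega)
      · simp at h'; omega
    · intro h'
      rw [Multiset.mem_add] at h'
      rcases h' with h' | h'
      · exact absurd (pt_pos _ h') (by omega)
      · simp at h'; omega
  · have := merge_P h k
    rw [P_eq, P_eq] at this
    apply Nat.eq_of_mul_eq_mul_left hk
    rw [Multiset.count_add, Multiset.count_add, mul_add, mul_add,
      Multiset.insert_eq_cons, Multiset.count_cons, Multiset.count_singleton,
      Multiset.count_singleton]
    convert this using 2
    · split_ifs <;> grind
    · split_ifs <;> grind

lemma split_one {π : Perm (Fin n)} {a b : Fin n} {j : ℕ} (h0 : 0 < j) (hj : j < L π a)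
    (hb : π^[j] a = b) : L (swap a b * π) a = j ∧ ¬ (swap a b * π).SameCycle a b := by
  have key := sw_iter (π := π) (a := a) (b := b) (m := j) (by
    intro i hi hi'
    refine ⟨iter_ne hi (by omega), ?_⟩
    rw [← hb]
    intro h
    have := iterate_injOn_Iio_minimalPeriod (f := π) (x := a) (show i < L π a by omega) hj h
    omega)
  have hper : (swap a b * π)^[j] a = a := by
    obtain ⟨m, rfl⟩ : ∃ m, j = m + 1 := ⟨j - 1, by omega⟩
    rw [iterate_succ_apply', key _ (by omega), Perm.mul_apply, ← iterate_succ_apply' π,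
      Nat.succ_eq_add_one, hb, swap_apply_right]
  have hL : L (swap a b * π) a = j := by
    apply le_antisymm
    · exact IsPeriodicPt.minimalPeriod_le h0 hper
    · by_contra hlt
      push Not at hlt
      have h1 := key _ hlt
      rw [L, iterate_minimalPeriod] at h1
      exact iter_ne (L_pos (swap a b * π) a) (hlt.trans hj) h1.symm
  refine ⟨hL, ?_⟩
  intro h
  obtain ⟨i, hi, hi'⟩ := same_iff.1 h
  rw [hL] at hi
  rw [key i hi, ← hb] at hi'
  have := iterate_injOn_Iio_minimalPeriod (f := π) (x := a) (show i < L π a by omega) hj hi'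
  omega

lemma split_pt {π : Perm (Fin n)} {a b : Fin n} {j : ℕ} (h0 : 0 < j) (hj : j < L π a)
    (hb : π^[j] a = b) :
    pt (swap a b * π) + {L π a} = pt π + {j, L π a - j} := by
  obtain ⟨h1, h2⟩ := split_one h0 hj hb
  have hs : L π b = L π a := by rw [← hb]; exact (L_same (same_iter π a j)).symm
  have hb' : π^[L π a - j] b = a := by
    rw [← hb, ← iterate_add_apply, Nat.sub_add_cancel hj.le, L, iterate_minimalPeriod]
  obtain ⟨h3, h4⟩ := split_one (π := π) (a := b) (b := a) (j := L π a - j) (by omega) (by omega) hb'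
  rw [swap_comm] at h3
  have := merge_pt h2
  rw [swap_mul_self_mul, h1, h3, Nat.add_sub_cancel' hj.le] at this
  exact this.symm

end Stmt5

namespace Stmt5
open Equiv Equiv.Perm Function

variable {n : ℕ}

noncomputable def Q (π : Perm (Fin n)) (m : Multiset ℕ) : Finset (Fin n × Fin n) :=
  Finset.univ.filter (fun p => p.1 ≠ p.2 ∧ pt (swap p.1 p.2 * π) = m)

lemma swap_inj {a b x y : Fin n} (h : a ≠ b) (e : swap a b = swap x y) :
    (a = x ∧ b = y) ∨ (a = y ∧ b = x) := by
  have h1 : swap x y a = b := by rw [← e, swap_apply_left]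
  rw [swap_apply_def] at h1
  split_ifs at h1 with h2 h3
  · left; exact ⟨h2, h1.symm⟩
  · right; exact ⟨h3, h1.symm⟩
  · exact absurd h1 h

lemma two_N (π : Perm (Fin n)) (μ : n.Partition) :
    2 * Nat.card {p : Equiv.Perm (Fin n) × Equiv.Perm (Fin n) //
        p.1.IsSwap ∧ permHasCycleType p.2 μ ∧ p.1 * p.2 = π} = (Q π μ.parts).card := by
  classical
  set T : Finset (Perm (Fin n)) :=
    Finset.univ.filter (fun τ => τ.IsSwap ∧ pt (τ * π) = μ.parts) with hT
  have e : Nat.card {p : Equiv.Perm (Fin n) × Equiv.Perm (Fin n) //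
        p.1.IsSwap ∧ permHasCycleType p.2 μ ∧ p.1 * p.2 = π} = T.card := by
    rw [← Nat.card_eq_finsetCard T]
    have inv : ∀ τ : Perm (Fin n), τ.IsSwap → τ * τ = 1 := by
      rintro τ ⟨x, y, _, rfl⟩
      exact swap_mul_self x y
    refine Nat.card_congr ⟨fun p => ⟨p.1.1, ?_⟩, fun t => ⟨(t.1, t.1 * π), ?_⟩, ?_, ?_⟩
    · obtain ⟨⟨τ, σ⟩, h1, h2, h3⟩ := p
      simp only at h1 h2 h3
      simp only [hT, Finset.mem_filter, Finset.mem_univ, true_and]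
      refine ⟨h1, ?_⟩
      rw [← h3, ← mul_assoc, inv τ h1, one_mul]
      exact (type_iff _ _).1 h2
    · obtain ⟨τ, h⟩ := t
      simp only [hT, Finset.mem_filter, Finset.mem_univ, true_and] at h
      refine ⟨h.1, (type_iff _ _).2 h.2, ?_⟩
      simp only
      rw [← mul_assoc, inv τ h.1, one_mul]
    · rintro ⟨⟨τ, σ⟩, h1, h2, h3⟩
      simp only at h1 h2 h3
      simp only [Subtype.mk.injEq, Prod.mk.injEq, true_and]
      rw [← h3, ← mul_assoc, inv τ h1, one_mul]
    · rintro ⟨τ, h⟩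
      rfl
  rw [e, Finset.card_eq_sum_card_fiberwise (s := Q π μ.parts) (t := T)
    (f := fun p : Fin n × Fin n => Equiv.swap p.1 p.2)]
  · rw [Finset.sum_congr rfl (g := fun _ => 2), Finset.sum_const, smul_eq_mul, mul_comm]
    intro τ hτ
    simp only [hT, Finset.mem_filter, Finset.mem_univ, true_and] at hτ
    obtain ⟨⟨x, y, hxy, rfl⟩, h⟩ := hτ
    have : (Q π μ.parts).filter (fun p : Fin n × Fin n => Equiv.swap p.1 p.2 = Equiv.swap x y) = {(x, y), (y, x)} := by
      ext ⟨a, b⟩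
      simp only [Q, Finset.mem_filter, Finset.mem_univ, true_and, Finset.mem_insert,
        Finset.mem_singleton, Prod.mk.injEq]
      constructor
      · rintro ⟨⟨h1, h2⟩, h3⟩
        exact swap_inj h1 h3
      · rintro (⟨rfl, rfl⟩ | ⟨rfl, rfl⟩)
        · exact ⟨⟨hxy, h⟩, rfl⟩
        · rw [swap_comm]
          exact ⟨⟨hxy.symm, h⟩, rfl⟩
    rw [this, Finset.card_pair]
    simp [hxy]
  · intro p hp
    simp only [Q, Finset.coe_filter, Finset.mem_univ, true_and, Set.mem_ofPred_eq] at hp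
    simp only [hT, Finset.coe_filter, Finset.mem_univ, true_and, Set.mem_ofPred_eq]
    exact ⟨⟨_, _, hp.1, rfl⟩, hp.2⟩

lemma ms_merge {A : Multiset ℕ} {x y k l : ℕ} (hx : 0 < x) (hy : 0 < y) (hk : 0 < k) (hl : 0 < l) :
    (∀ B, A + {x, y} = B + {x + y} → A + {k, l} = B + {k + l} →
      (x = k ∧ y = l) ∨ (x = l ∧ y = k)) := by
  intro B h1 h2
  have h3 : ({x, y} + {k + l} : Multiset ℕ) = {k, l} + {x + y} := by
    have : (A + B) + ({x, y} + {k + l} : Multiset ℕ) = (A + B) + ({k, l} + {x + y}) := by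
      calc (A + B) + ({x, y} + {k + l} : Multiset ℕ) = (A + {x, y}) + (B + {k + l}) := by abel
        _ = (B + {x + y}) + (A + {k, l}) := by rw [h1, h2]
        _ = _ := by abel
    exact add_left_cancel this
  have h4 : x + y = k + l := by
    have : x + y ∈ ({x, y} + {k + l} : Multiset ℕ) := by rw [h3]; simp
    simp at this
    omega
  have h5 : x ∈ ({k, l} + {x + y} : Multiset ℕ) := by rw [← h3]; simp
  simp at h5
  omega

lemma ms_card {A B : Multiset ℕ} {x y z k l m : ℕ} (h1 : A + {x, y} = B + {z})
    (h2 : A + {m} = B + {k, l}) : False := by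
  have e1 := congrArg Multiset.card h1
  have e2 := congrArg Multiset.card h2
  simp at e1 e2
  omega

lemma same_split {π : Perm (Fin n)} {a b : Fin n} (hab : a ≠ b) (h : π.SameCycle a b) :
    ∃ j, 0 < j ∧ j < L π a ∧ π^[j] a = b := by
  obtain ⟨j, hj, e⟩ := same_iff.1 h
  refine ⟨j, ?_, hj, e⟩
  rcases Nat.eq_zero_or_pos j with rfl | h
  · exact absurd e hab
  · exact h

lemma Q_merge {π : Perm (Fin n)} {m : Multiset ℕ} {k l : ℕ} (hk : 0 < k) (hl : 0 < l)
    (h : m + {k, l} = pt π + {k + l}) (a b : Fin n) :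
    (a, b) ∈ Q π m ↔ ¬ π.SameCycle a b ∧
      ((L π a = k ∧ L π b = l) ∨ (L π a = l ∧ L π b = k)) := by
  simp only [Q, Finset.mem_filter, Finset.mem_univ, true_and]
  constructor
  · rintro ⟨hab, rfl⟩
    by_cases hs : π.SameCycle a b
    · obtain ⟨j, h0, hj, e⟩ := same_split hab hs
      exact (ms_card h (split_pt h0 hj e)).elim
    · exact ⟨hs, ms_merge (L_pos π a) (L_pos π b) hk hl _ (merge_pt hs) h⟩
  · rintro ⟨hs, h2⟩
    refine ⟨fun e => hs (e ▸ SameCycle.refl _ _), ?_⟩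
    have h3 := merge_pt hs
    have e1 : ({L π a, L π b} : Multiset ℕ) = {k, l} ∧ L π a + L π b = k + l := by
      rcases h2 with ⟨e, f⟩ | ⟨e, f⟩
      · simp [e, f]
      · rw [e, f]; exact ⟨Multiset.pair_comm _ _, add_comm _ _⟩
    rw [e1.1, e1.2, ← h] at h3
    exact add_right_cancel h3

lemma Q_split {π : Perm (Fin n)} {m : Multiset ℕ} {k l : ℕ} (hk : 0 < k) (hl : 0 < l)
    (h : m + {k + l} = pt π + {k, l}) (a b : Fin n) :
    (a, b) ∈ Q π m ↔ L π a = k + l ∧ (π^[k] a = b ∨ π^[l] a = b) := by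
  simp only [Q, Finset.mem_filter, Finset.mem_univ, true_and]
  constructor
  · rintro ⟨hab, rfl⟩
    by_cases hs : π.SameCycle a b
    · obtain ⟨j, h0, hj, e⟩ := same_split hab hs
      have h3 := split_pt h0 hj e
      have h4 := ms_merge (x := j) (y := L π a - j) (k := k) (l := l) (A := pt π) h0 (by omega)
        hk hl (pt (swap a b * π)) (by rw [Nat.add_sub_cancel' hj.le]; exact h3.symm) h.symm
      rcases h4 with h4 | h4
      · exact ⟨by omega, Or.inl (h4.1 ▸ e)⟩
      · exact ⟨by omega, Or.inr (h4.1 ▸ e)⟩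
    · exact (ms_card (merge_pt hs) h).elim
  · rintro ⟨h1, h2⟩
    have : ∃ j, (j = k ∨ j = l) ∧ π^[j] a = b := by
      rcases h2 with h2 | h2
      · exact ⟨k, Or.inl rfl, h2⟩
      · exact ⟨l, Or.inr rfl, h2⟩
    obtain ⟨j, hj, e⟩ := this
    have h0 : 0 < j := by omega
    have hj' : j < L π a := by omega
    refine ⟨fun h => iter_ne h0 hj' (e.trans h.symm), ?_⟩
    have h3 := split_pt h0 hj' e
    have e1 : ({j, L π a - j} : Multiset ℕ) = {k, l} := by
      rcases hj with rfl | rfl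
      · rw [h1, Nat.add_sub_cancel_left]
      · rw [h1, Nat.add_sub_cancel, Multiset.pair_comm]
    rw [e1, h1, ← h] at h3
    exact add_right_cancel h3

lemma card_merge_ne {π : Perm (Fin n)} {m : Multiset ℕ} {k l : ℕ} (hk : 0 < k) (hl : 0 < l)
    (hkl : k ≠ l) (h : m + {k, l} = pt π + {k + l}) : (Q π m).card = 2 * (P π k * P π l) := by
  have : Q π m = (Finset.univ.filter (fun x => L π x = k)) ×ˢ
      (Finset.univ.filter (fun x => L π x = l)) ∪ (Finset.univ.filter (fun x => L π x = l)) ×ˢ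
      (Finset.univ.filter (fun x => L π x = k)) := by
    ext ⟨a, b⟩
    rw [Q_merge hk hl h]
    simp only [Finset.mem_union, Finset.mem_product, Finset.mem_filter, Finset.mem_univ, true_and]
    constructor
    · exact fun h => h.2
    · intro h
      refine ⟨fun hs => ?_, h⟩
      have := L_same hs
      omega
  rw [this, Finset.card_union_of_disjoint, Finset.card_product, Finset.card_product]
  · simp only [P]; ring
  · rw [Finset.disjoint_left]
    rintro ⟨a, b⟩ h1 h2
    simp at h1 h2
    omega

lemma card_merge_eq {π : Perm (Fin n)} {m : Multiset ℕ} {k : ℕ} (hk : 0 < k)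
    (h : m + {k, k} = pt π + {k + k}) : (Q π m).card = P π k * (P π k - k) := by
  have : Q π m = ((Finset.univ.filter (fun x => L π x = k)).sigma (fun a =>
      (Finset.univ.filter (fun x => L π x = k)) \ cls π a)).map
        (Equiv.sigmaEquivProd _ _).toEmbedding := by
    ext ⟨a, b⟩
    rw [Q_merge hk hk h]
    simp [mem_cls]
    tauto
  rw [this, Finset.card_map, Finset.card_sigma, Finset.sum_congr rfl (g := fun _ => P π k - k)]
  · rw [Finset.sum_const, smul_eq_mul, P]
  · intro a ha
    simp at ha
    rw [Finset.card_sdiff_of_subset, cls_card, ha, P]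
    intro x hx
    simp [← L_same (mem_cls.1 hx), ha]

lemma card_split {π : Perm (Fin n)} (m k : ℕ) :
   ((Finset.univ.filter (fun x => L π x = m)).image (fun a => (a, π^[k] a))).card = P π m := by
  rw [Finset.card_image_of_injective, P]
  intro a b h
  simp at h
  exact h.1

lemma card_split_ne {π : Perm (Fin n)} {m : Multiset ℕ} {k l : ℕ} (hk : 0 < k) (hl : 0 < l)
    (hkl : k ≠ l) (h : m + {k + l} = pt π + {k, l}) : (Q π m).card = 2 * P π (k + l) := by
  have : Q π m = ((Finset.univ.filter (fun x => L π x = k + l)).image (fun a => (a, π^[k] a))) ∪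
    ((Finset.univ.filter (fun x => L π x = k + l)).image (fun a => (a, π^[l] a))) := by
    ext ⟨a, b⟩
    rw [Q_split hk hl h]
    simp
    tauto
  rw [this, Finset.card_union_of_disjoint, card_split, card_split]
  · ring
  · rw [Finset.disjoint_left]
    rintro ⟨a, b⟩ h1 h2
    simp at h1 h2
    have h3 := h1.2.trans h2.2.symm
    have := iterate_injOn_Iio_minimalPeriod (f := π) (x := a) (show k < L π a by omega)
      (show l < L π a by omega) h3
    exact hkl this

lemma card_split_eq {π : Perm (Fin n)} {m : Multiset ℕ} {k : ℕ} (hk : 0 < k)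
    (h : m + {k + k} = pt π + {k, k}) : (Q π m).card = P π (k + k) := by
  have : Q π m = ((Finset.univ.filter (fun x => L π x = k + k)).image (fun a => (a, π^[k] a))) := by
    ext ⟨a, b⟩
    rw [Q_split hk hk h]
    simp
  rw [this, card_split]

end Stmt5

/-- Expansion of the product `C_{(2,1^{n-2})} · C_μ` of class sums in `Z(ℂ[S_n])`:
the number `N` of ways to write a fixed permutation `π` of cycle type `ν` as a product of a
transposition and a permutation of cycle type `μ`. -/
theorem stmt5 {n : ℕ} (hn : 2 ≤ n) (μ ν : n.Partition) (π : Equiv.Perm (Fin n))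
    (hπ : permHasCycleType π ν)
    (N : ℕ)
    (hN : N = Nat.card {p : Equiv.Perm (Fin n) × Equiv.Perm (Fin n) //
        p.1.IsSwap ∧ permHasCycleType p.2 μ ∧ p.1 * p.2 = π}) :
    (∀ i k : ℕ, i ∈ μ.parts → 1 ≤ k → k < i - k →
        ν.parts = k ::ₘ (i - k) ::ₘ μ.parts.erase i →
        N = k * (μ.parts.count k + 1) * (i - k) * (μ.parts.count (i - k) + 1)) ∧
    (∀ k : ℕ, 1 ≤ k → 2 * k ∈ μ.parts →
        ν.parts = k ::ₘ k ::ₘ μ.parts.erase (2 * k) →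
        N = k ^ 2 * (μ.parts.count k + 1) * (μ.parts.count k + 2) / 2) ∧
    (∀ i k : ℕ, i ∈ μ.parts → k ∈ μ.parts → i ≠ k →
        ν.parts = (i + k) ::ₘ ((μ.parts.erase i).erase k) →
        N = (i + k) * (μ.parts.count (i + k) + 1)) ∧
    (∀ i : ℕ, 2 ≤ μ.parts.count i →
        ν.parts = (2 * i) ::ₘ ((μ.parts.erase i).erase i) →
        N = i * (μ.parts.count (2 * i) + 1)) ∧
    ((¬ ∃ i k : ℕ, i ∈ μ.parts ∧ 1 ≤ k ∧ k < i - k ∧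
          ν.parts = k ::ₘ (i - k) ::ₘ μ.parts.erase i) →
     (¬ ∃ k : ℕ, 1 ≤ k ∧ 2 * k ∈ μ.parts ∧
          ν.parts = k ::ₘ k ::ₘ μ.parts.erase (2 * k)) →
     (¬ ∃ i k : ℕ, i ∈ μ.parts ∧ k ∈ μ.parts ∧ i ≠ k ∧
          ν.parts = (i + k) ::ₘ ((μ.parts.erase i).erase k)) →
     (¬ ∃ i : ℕ, 2 ≤ μ.parts.count i ∧
          ν.parts = (2 * i) ::ₘ ((μ.parts.erase i).erase i)) →
     N = 0) := by
  have hν : Stmt5.pt π = ν.parts := (Stmt5.type_iff _ _).1 hπ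
  have h2 := Stmt5.two_N π μ
  rw [← hN] at h2
  have aux1 : ∀ i k l : ℕ, i ∈ μ.parts → ν.parts = k ::ₘ l ::ₘ μ.parts.erase i →
      μ.parts + {k, l} = ν.parts + {i} := by
    intro i k l hi h
    rw [h]
    nth_rewrite 1 [← Multiset.cons_erase hi]
    simp only [← Multiset.singleton_add, Multiset.insert_eq_cons]
    abel
  have aux2 : ∀ i k j : ℕ, i ∈ μ.parts → k ∈ μ.parts.erase i →
      ν.parts = j ::ₘ (μ.parts.erase i).erase k →
      μ.parts + {j} = ν.parts + {i, k} := by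
    intro i k j hi hk h
    rw [h]
    nth_rewrite 1 [← Multiset.cons_erase hi, ← Multiset.cons_erase hk]
    simp only [← Multiset.singleton_add, Multiset.insert_eq_cons]
    abel
  refine ⟨?_, ?_, ?_, ?_, ?_⟩
  · intro i k hi hk hki h
    have h3 := aux1 _ _ _ hi h
    rw [← hν, show i = k + (i - k) by omega, Nat.add_sub_cancel_left] at h3
    rw [Stmt5.card_merge_ne (by omega) (by omega) (by omega) h3, Stmt5.P_eq, Stmt5.P_eq, hν, h] at h2
    rw [Multiset.count_cons_self, Multiset.count_cons_of_ne (by omega),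
      Multiset.count_cons_of_ne (by omega), Multiset.count_cons_self,
      Multiset.count_erase_of_ne (by omega), Multiset.count_erase_of_ne (by omega)] at h2
    rw [Nat.eq_of_mul_eq_mul_left (by norm_num) h2]
    ring
  · intro k hk hi h
    have h3 := aux1 _ _ _ hi h
    rw [← hν, two_mul] at h3
    rw [Stmt5.card_merge_eq (by omega) h3, Stmt5.P_eq, hν, h] at h2
    rw [Multiset.count_cons_self, Multiset.count_cons_self,
      Multiset.count_erase_of_ne (by omega)] at h2
    have e : k * (μ.parts.count k + 1 + 1) - k = k * (μ.parts.count k + 1) := by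
      rw [mul_add k _ 1, mul_one, Nat.add_sub_cancel]
    rw [e] at h2
    symm
    apply Nat.div_eq_of_eq_mul_right (by norm_num)
    rw [h2]
    ring
  · intro i k hi hk hik h
    have h3 := aux2 _ _ _ hi ((Multiset.mem_erase_of_ne hik.symm).2 hk) h
    have hi0 := μ.parts_pos hi
    have hk0 := μ.parts_pos hk
    rw [← hν] at h3
    rw [Stmt5.card_split_ne hi0 hk0 hik h3, Stmt5.P_eq, hν, h, Multiset.count_cons_self,
      Multiset.count_erase_of_ne (by omega), Multiset.count_erase_of_ne (by omega)] at h2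
    exact Nat.eq_of_mul_eq_mul_left (by norm_num) h2
  · intro i hi h
    have hi' : i ∈ μ.parts := Multiset.count_pos.1 (by omega)
    have hi2 : i ∈ μ.parts.erase i := Multiset.count_pos.1 (by
      rw [Multiset.count_erase_self]; omega)
    have h3 := aux2 _ _ _ hi' hi2 h
    have hi0 := μ.parts_pos hi'
    rw [← hν, two_mul] at h3
    rw [Stmt5.card_split_eq hi0 h3, Stmt5.P_eq, hν, h, ← two_mul, Multiset.count_cons_self,
      Multiset.count_erase_of_ne (by omega), Multiset.count_erase_of_ne (by omega), mul_assoc] at h2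
    exact Nat.eq_of_mul_eq_mul_left (by norm_num) h2
  · intro n1 n2 n3 n4
    by_contra hN0
    have hne : (Stmt5.Q π μ.parts).Nonempty := by
      rw [← Finset.card_pos]; omega
    obtain ⟨⟨a, b⟩, hab⟩ := hne
    simp only [Stmt5.Q, Finset.mem_filter, Finset.mem_univ, true_and] at hab
    obtain ⟨hab, hm⟩ := hab
    by_cases hs : π.SameCycle a b
    · obtain ⟨j, h0, hj, e⟩ := Stmt5.same_split hab hs
      have h3 := Stmt5.split_pt h0 hj e
      rw [hm, hν] at h3
      obtain ⟨l, hl⟩ : ∃ l, Stmt5.L π a = j + l := ⟨Stmt5.L π a - j, by omega⟩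
      rw [hl, Nat.add_sub_cancel_left] at h3
      have hl0 : 0 < l := by omega
      have hmem : j + l ∈ ν.parts := by
        have : j + l ∈ ν.parts + {j, l} := by rw [← h3]; simp
        simp at this
        rcases this with h | h | h <;> first | exact h | omega
      obtain ⟨C, hC⟩ := Multiset.exists_cons_of_mem hmem
      have hμ : μ.parts = j ::ₘ l ::ₘ C := by
        rw [hC] at h3
        apply add_right_cancel (b := ({j + l} : Multiset ℕ))
        rw [h3]
        simp only [← Multiset.singleton_add, Multiset.insert_eq_cons]
        abel
      by_cases hjl : j = l
      · subst hjl
        apply n4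
        refine ⟨j, ?_, ?_⟩
        · rw [hμ]; simp
        · rw [hC, hμ, two_mul]; simp
      · apply n3
        refine ⟨j, l, ?_, ?_, hjl, ?_⟩
        · rw [hμ]; simp
        · rw [hμ]; simp
        · rw [hC, hμ]; simp
    · have h3 := Stmt5.merge_pt hs
      rw [hm, hν] at h3
      have hx := Stmt5.L_pos π a
      have hy := Stmt5.L_pos π b
      have main : ∀ x y : ℕ, 0 < x → x ≤ y → μ.parts + {x, y} = ν.parts + {x + y} → False := by
        intro x y hx hxy h3
        have hmem : x + y ∈ μ.parts := by
          have : x + y ∈ μ.parts + {x, y} := by rw [h3]; simp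
          simp at this
          rcases this with h | h | h <;> first | exact h | omega
        obtain ⟨C, hC⟩ := Multiset.exists_cons_of_mem hmem
        have hν' : ν.parts = x ::ₘ y ::ₘ C := by
          rw [hC] at h3
          apply add_right_cancel (b := ({x + y} : Multiset ℕ))
          rw [← h3]
          simp only [← Multiset.singleton_add, Multiset.insert_eq_cons]
          abel
        rcases hxy.eq_or_lt with rfl | hlt
        · apply n2
          refine ⟨x, hx, by rw [two_mul]; exact hmem, ?_⟩
          rw [hν', hC, two_mul]; simp
        · apply n1
          refine ⟨x + y, x, hmem, hx, by omega, ?_⟩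
          rw [hν', hC]; simp
      rcases le_total (Stmt5.L π a) (Stmt5.L π b) with hle | hle
      · exact main _ _ hx hle h3
      · refine main _ _ hy hle ?_
        rw [Multiset.pair_comm, add_comm (Stmt5.L π b)]
        exact h3
end

section
/- For all proper partitions λ, δ, ρ there exists a unique polynomial f ∈ ℚ[X] such that c_{λδ}^{ρ}(n) = f(n) for every integer n ≥ max(|λ|, |δ|, |ρ|). -/
open Classical in
noncomputable def cntG (lam del : Multiset ℕ) {k : ℕ} (π : Equiv.Perm (Fin k)) : ℕ :=
  (Finset.univ.filter fun p : Equiv.Perm (Fin k) × Equiv.Perm (Fin k) =>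
    (p.1.cycleType = lam ∧ p.2.cycleType = del ∧ p.1 * p.2 = π) ∧
      ∀ x, p.1 x ≠ x ∨ p.2 x ≠ x).card

open Classical in
noncomputable def coefA (lam del rho : Multiset ℕ) (k : ℕ) : ℕ :=
  if h : ∃ π : Equiv.Perm (Fin k), π.cycleType = rho then cntG lam del h.choose else 0

theorem cntG_conj_le (lam del : Multiset ℕ) {k : ℕ} (π c : Equiv.Perm (Fin k)) :
    cntG lam del π ≤ cntG lam del (c * π * c⁻¹) := by
  classical
  unfold cntG
  apply Finset.card_le_card_of_injOn (fun p => (c * p.1 * c⁻¹, c * p.2 * c⁻¹))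
  · intro p hp
    simp only [Finset.coe_filter, Finset.mem_univ, true_and, Set.mem_ofPred_eq] at hp ⊢
    obtain ⟨⟨h1, h2, h3⟩, h4⟩ := hp
    refine ⟨⟨by simpa using h1, by simpa using h2, by rw [← h3]; group⟩, fun x => ?_⟩
    have := h4 (c⁻¹ x)
    refine this.imp (fun h h' => h ?_) (fun h h' => h ?_)
    · conv_rhs => rw [← h']
      simp
    · conv_rhs => rw [← h']
      simp
  · rintro ⟨a, b⟩ - ⟨a', b'⟩ - h
    simpa using h

theorem cntG_eq (lam del : Multiset ℕ) {k : ℕ} (π π' : Equiv.Perm (Fin k))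
    (h : π.cycleType = π'.cycleType) : cntG lam del π = cntG lam del π' := by
  apply le_antisymm
  · obtain ⟨c, hc⟩ := isConj_iff.1 (Equiv.Perm.isConj_iff_cycleType_eq.2 h)
    rw [← hc]; exact cntG_conj_le _ _ _ _
  · obtain ⟨c, hc⟩ := isConj_iff.1 (Equiv.Perm.isConj_iff_cycleType_eq.2 h.symm)
    rw [← hc]; exact cntG_conj_le _ _ _ _

theorem coefA_eq (lam del rho : Multiset ℕ) {k : ℕ} (π : Equiv.Perm (Fin k))
    (h : π.cycleType = rho) : coefA lam del rho k = cntG lam del π := by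
  have hex : ∃ π : Equiv.Perm (Fin k), π.cycleType = rho := ⟨π, h⟩
  rw [coefA, dif_pos hex]
  exact cntG_eq _ _ _ _ (hex.choose_spec.trans h.symm)

theorem coefA_zero (lam del rho : Multiset ℕ) (k : ℕ) (hk : lam.sum + del.sum < k) :
    coefA lam del rho k = 0 := by
  classical
  unfold coefA
  split_ifs with h
  · unfold cntG
    rw [Finset.card_eq_zero, Finset.filter_eq_empty_iff]
    rintro ⟨a, b⟩ - ⟨⟨h1, h2, -⟩, h4⟩
    have hu : a.support ∪ b.support = Finset.univ := by
      ext x; simpa using h4 x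
    have h5 := Finset.card_union_le a.support b.support
    rw [hu, ← Equiv.Perm.sum_cycleType, ← Equiv.Perm.sum_cycleType] at h5
    simp only at h1 h2
    rw [h1, h2] at h5
    simp at h5
    omega
  · rfl

theorem exists_ext {α : Type*} [DecidableEq α] {k : ℕ} (S : Finset α)
    (f : Fin k ≃ {x // x ∈ S}) (σ : Equiv.Perm α) (h : ∀ x, σ x ≠ x → x ∈ S) :
    ∃ g : Equiv.Perm (Fin k), g.extendDomain f = σ := by
  have hS : ∀ x, σ x ∈ S ↔ x ∈ S := by
    intro x
    by_cases hx : σ x = x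
    · rw [hx]
    · exact ⟨fun _ => h x hx, fun _ => h _ (fun h' => hx (σ.injective h'))⟩
  refine ⟨f.symm.permCongr (σ.subtypePerm hS), ?_⟩
  ext x
  by_cases hx : x ∈ S
  · rw [Equiv.Perm.extendDomain_apply_subtype _ _ hx]
    simp [Equiv.permCongr_apply]
  · rw [Equiv.Perm.extendDomain_apply_not_subtype _ _ hx]
    by_contra h'
    exact hx (h x (fun h'' => h' h''.symm))

theorem ext_ne_iff {α : Type*} [DecidableEq α] {k : ℕ} (S : Finset α)
    (f : Fin k ≃ {x // x ∈ S}) (g : Equiv.Perm (Fin k)) (y : Fin k) :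
    g.extendDomain f (f y) ≠ f y ↔ g y ≠ y := by
  rw [Equiv.Perm.extendDomain_apply_image, Ne, Subtype.coe_inj, f.apply_eq_iff_eq]

open Classical in
theorem card_fiber (lam del rho : Multiset ℕ) {n : ℕ} (π : Equiv.Perm (Fin n))
    (hπ : π.cycleType = rho) (S : Finset (Fin n)) (hS : π.support ⊆ S) :
    (Finset.univ.filter fun p : Equiv.Perm (Fin n) × Equiv.Perm (Fin n) =>
      (p.1.cycleType = lam ∧ p.2.cycleType = del ∧ p.1 * p.2 = π) ∧
        p.1.support ∪ p.2.support = S).card = coefA lam del rho S.card := by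
  have f : Fin S.card ≃ {x // x ∈ S} := S.equivFin.symm
  obtain ⟨π0, h0⟩ := exists_ext S f π (fun x hx => hS (by simpa using hx))
  have hinj := Equiv.Perm.extendDomainHom_injective f
  have ht : π0.cycleType = rho := by
    rw [← hπ, ← h0, Equiv.Perm.cycleType_extendDomain]
  rw [coefA_eq lam del rho π0 ht, cntG]
  symm
  refine Finset.card_bij (fun p _ => (p.1.extendDomain f, p.2.extendDomain f)) ?_ ?_ ?_
  · rintro ⟨a, b⟩ hp
    simp only [Finset.mem_filter, Finset.mem_univ, true_and] at hp ⊢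
    obtain ⟨⟨h1, h2, h3⟩, h4⟩ := hp
    refine ⟨⟨by rw [Equiv.Perm.cycleType_extendDomain, h1],
      by rw [Equiv.Perm.cycleType_extendDomain, h2],
      by rw [Equiv.Perm.extendDomain_mul, h3, h0]⟩, ?_⟩
    ext x
    simp only [Finset.mem_union, Equiv.Perm.mem_support]
    by_cases hx : x ∈ S
    · obtain ⟨y, hy⟩ := f.surjective ⟨x, hx⟩
      have hy' : x = f y := by rw [hy]
      subst hy'
      simp only [ext_ne_iff, hx, iff_true]
      exact h4 y
    · simp [Equiv.Perm.extendDomain_apply_not_subtype _ _ hx, hx]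
  · rintro ⟨a, b⟩ - ⟨a', b'⟩ - h
    simp only [Prod.mk.injEq] at h ⊢
    exact ⟨hinj h.1, hinj h.2⟩
  · rintro ⟨a, b⟩ hp
    simp only [Finset.mem_filter, Finset.mem_univ, true_and] at hp
    obtain ⟨⟨h1, h2, h3⟩, h4⟩ := hp
    obtain ⟨a', rfl⟩ := exists_ext S f a (fun x hx => by
      rw [← h4]; simp [hx])
    obtain ⟨b', rfl⟩ := exists_ext S f b (fun x hx => by
      rw [← h4]; simp [hx])
    refine ⟨(a', b'), ?_, rfl⟩
    rw [Equiv.Perm.cycleType_extendDomain] at h1 h2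
    simp only [Finset.mem_filter, Finset.mem_univ, true_and]
    refine ⟨⟨h1, h2, ?_⟩, fun y => ?_⟩
    · apply hinj
      rw [← h0, Equiv.Perm.extendDomain_mul] at h3
      exact h3
    · have : (f y : Fin n) ∈ S := (f y).2
      replace this := (Finset.ext_iff.1 h4 _).2 this
      simpa only [Finset.mem_union, Equiv.Perm.mem_support, ext_ne_iff] using this

theorem count_eq (lam del rho : Multiset ℕ) {n : ℕ} (π : Equiv.Perm (Fin n))
    (hπ : π.cycleType = rho) :
    Nat.card {p : Equiv.Perm (Fin n) × Equiv.Perm (Fin n) //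
      p.1.cycleType = lam ∧ p.2.cycleType = del ∧ p.1 * p.2 = π} =
    ∑ j ∈ Finset.range (lam.sum + del.sum + 1),
      (n - rho.sum).choose j * coefA lam del rho (rho.sum + j) := by
  classical
  have hr : π.support.card = rho.sum := by rw [← hπ, Equiv.Perm.sum_cycleType]
  rw [Nat.card_eq_fintype_card, Fintype.card_subtype]
  rw [Finset.card_eq_sum_card_fiberwise (t := (π.supportᶜ).powerset)
    (f := fun p => (p.1.support ∪ p.2.support) \ π.support)
    (by
      intro p _
      simp only [Finset.coe_powerset, Set.mem_preimage, Set.mem_powerset_iff, Finset.coe_subset]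
      intro x hx
      simp only [Finset.mem_sdiff] at hx
      simpa using hx.2)]
  have hc : (π.supportᶜ).card = n - rho.sum := by
    rw [Finset.card_compl, hr, Fintype.card_fin]
  trans ∑ T ∈ (π.supportᶜ).powerset, coefA lam del rho (rho.sum + T.card)
  · apply Finset.sum_congr rfl
    intro T hT
    rw [Finset.mem_powerset] at hT
    have hd : Disjoint π.support T :=
      (Finset.disjoint_left.2 fun x hx hx' => (Finset.mem_compl.1 (hT hx')) hx)
    rw [← hr, ← Finset.card_union_of_disjoint hd,
      ← card_fiber lam del rho π hπ _ Finset.subset_union_left, Finset.filter_filter]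
    congr 1
    apply Finset.filter_congr
    rintro ⟨a, b⟩ -
    apply and_congr_right
    rintro ⟨-, -, h3⟩
    have hsub : π.support ⊆ a.support ∪ b.support := by
      rw [← h3]; exact Equiv.Perm.support_mul_le a b
    constructor
    · rintro rfl
      exact (Finset.union_sdiff_of_subset hsub).symm
    · intro h
      simp only at h ⊢
      rw [h, Finset.union_sdiff_cancel_left hd]
  · rw [Finset.sum_powerset_apply_card (fun j => coefA lam del rho (rho.sum + j)), hc]
    simp only [smul_eq_mul]
    trans ∑ j ∈ Finset.range (max (n - rho.sum) (lam.sum + del.sum) + 1),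
      (n - rho.sum).choose j * coefA lam del rho (rho.sum + j)
    · apply Finset.sum_subset
      · intro j; simp only [Finset.mem_range]; omega
      · intro j _ hj
        simp only [Finset.mem_range] at hj
        rw [Nat.choose_eq_zero_of_lt (by omega), zero_mul]
    · symm
      apply Finset.sum_subset
      · intro j; simp only [Finset.mem_range]; omega
      · intro j _ hj
        simp only [Finset.mem_range] at hj
        rw [coefA_zero _ _ _ _ (by omega), mul_zero]

noncomputable def polyF (lam del rho : Multiset ℕ) : Polynomial ℚ :=
  ∑ j ∈ Finset.range (lam.sum + del.sum + 1),
    Polynomial.C ((coefA lam del rho (rho.sum + j) : ℚ) / (j.factorial : ℚ)) *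
      (descPochhammer ℚ j).comp (Polynomial.X - Polynomial.C (rho.sum : ℚ))

theorem polyF_eval (lam del rho : Multiset ℕ) (n : ℕ) (hn : rho.sum ≤ n) :
    (polyF lam del rho).eval (n : ℚ) =
    ((∑ j ∈ Finset.range (lam.sum + del.sum + 1),
      (n - rho.sum).choose j * coefA lam del rho (rho.sum + j) : ℕ) : ℚ) := by
  rw [polyF, Polynomial.eval_finsetSum, Nat.cast_sum]
  apply Finset.sum_congr rfl
  intro j _
  simp only [Polynomial.eval_mul, Polynomial.eval_C, Polynomial.eval_comp, Polynomial.eval_sub,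
    Polynomial.eval_X]
  rw [← Nat.cast_sub hn, descPochhammer_eval_eq_descFactorial, Nat.descFactorial_eq_factorial_mul_choose,
    Nat.cast_mul, Nat.cast_mul]
  have : (j.factorial : ℚ) ≠ 0 := by positivity
  field_simp

/-- **Farahat–Higman polynomiality** (uniqueness form): for proper partitions `λ`, `δ`, `ρ`
(encoded as multisets of parts, all `≥ 2`), there is a unique polynomial `f ∈ ℚ[X]` such that
the structure coefficient `c_{λδ}^{ρ}(n)` of `Z(ℂ[S_n])` equals `f(n)` for every
`n ≥ max(|λ|, |δ|, |ρ|)`. -/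
theorem stmt6 (lam del rho : Multiset ℕ)
    (hlam : ∀ p ∈ lam, 2 ≤ p) (hdel : ∀ p ∈ del, 2 ≤ p) (hrho : ∀ p ∈ rho, 2 ≤ p) :
    ∃! f : Polynomial ℚ,
      ∀ n : ℕ, lam.sum ≤ n → del.sum ≤ n → rho.sum ≤ n →
        ∀ π : Equiv.Perm (Fin n), π.cycleType = rho →
          (Nat.card {p : Equiv.Perm (Fin n) × Equiv.Perm (Fin n) //
              p.1.cycleType = lam ∧ p.2.cycleType = del ∧ p.1 * p.2 = π} : ℚ) =
            f.eval (n : ℚ) := by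
  refine ⟨polyF lam del rho, ?_, ?_⟩
  · intro n _ _ hn π hπ
    rw [polyF_eval _ _ _ _ hn, count_eq lam del rho π hπ]
  · intro g hg
    apply Polynomial.eq_of_infinite_eval_eq
    apply Set.Infinite.mono (s := (fun n : ℕ => (n : ℚ)) '' Set.Ici (lam.sum + del.sum + rho.sum))
    · rintro _ ⟨n, hn, rfl⟩
      simp only [Set.mem_Ici] at hn
      obtain ⟨π, hπ⟩ := (Equiv.Perm.exists_with_cycleType_iff (Fin n) (m := rho)).2
        ⟨by rw [Fintype.card_fin]; omega, hrho⟩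
      simp only [Set.mem_ofPred_eq]
      rw [← hg n (by omega) (by omega) (by omega) π hπ, polyF_eval _ _ _ _ (by omega),
        count_eq lam del rho π hπ]
    · exact (Set.Ici_infinite _).image (Nat.cast_injective.injOn)
end

section
/- For all proper partitions λ, δ, ρ there exist natural numbers a_0, a_1, …, a_{|λ|+|δ|−|ρ|}, independent of n (the list being empty when |ρ| > |λ|+|δ|), such that for every integer n ≥ max(|λ|, |δ|, |ρ|): c_{λδ}^{ρ}(n) = Σ_{k=0}^{|λ|+|δ|−|ρ|} a_k · binom(n−|ρ|, k), where binom denotes the binomial coefficient. -/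
open Equiv Equiv.Perm in
def PP (lam del : Multiset ℕ) (β : Type) [Fintype β] [DecidableEq β] (π : Perm β) (S : Finset β) : Type :=
  {p : Perm β × Perm β //
    p.1.cycleType = lam ∧ p.2.cycleType = del ∧ p.1 * p.2 = π ∧ p.1.support ∪ p.2.support = S}

open Equiv Equiv.Perm in
lemma exists_extend {α β : Type} [Fintype β] [DecidableEq β]
    (S : Finset β) (f : α ≃ Subtype (· ∈ S)) (σ : Perm β) (h : σ.support ⊆ S) :
    ∃ σ' : Perm α, σ'.extendDomain f = σ := by
  have hS : ∀ x, σ x ∈ S ↔ x ∈ S := by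
    intro x
    by_cases hx : σ x = x
    · rw [hx]
    · have h1 : x ∈ σ.support := by simpa using hx
      have h2 : σ x ∈ σ.support := by simpa using hx
      exact ⟨fun _ => h h1, fun _ => h h2⟩
  refine ⟨f.symm.permCongr (σ.subtypePerm hS), ?_⟩
  ext x
  by_cases hx : x ∈ S
  · rw [extendDomain_apply_subtype _ _ hx]
    simp [Equiv.permCongr_apply]
  · rw [extendDomain_apply_not_subtype _ _ hx]
    by_contra h3
    exact hx (h (by simpa using Ne.symm h3))

open Equiv Equiv.Perm in
lemma supp_ext {α β : Type} [Fintype α] [DecidableEq α] [Fintype β] [DecidableEq β]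
    (S : Finset β) (f : α ≃ Subtype (· ∈ S)) (σ τ : Perm α) :
    (σ.extendDomain f).support ∪ (τ.extendDomain f).support = S ↔
      σ.support ∪ τ.support = Finset.univ := by
  have key : ∀ (σ : Perm α) (a : α), (f a : β) ∈ (σ.extendDomain f).support ↔ a ∈ σ.support := by
    intro σ a
    simp only [mem_support, extendDomain_apply_image, ne_eq]
    rw [Subtype.val_inj, f.injective.eq_iff]
  have key2 : ∀ (σ : Perm α) (x : β), x ∈ (σ.extendDomain f).support → x ∈ S := by
    intro σ x hx
    by_contra h
    exact (mem_support.mp hx) (extendDomain_apply_not_subtype _ _ h)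
  constructor
  · intro h
    ext a
    have : (f a : β) ∈ (σ.extendDomain f).support ∪ (τ.extendDomain f).support := by
      rw [h]; exact (f a).2
    rw [Finset.mem_union, key, key] at this
    simpa using this
  · intro h
    ext x
    constructor
    · intro hx
      rcases Finset.mem_union.mp hx with hx | hx <;> exact key2 _ _ hx
    · intro hx
      obtain ⟨a, ha⟩ := f.surjective ⟨x, hx⟩
      have h2 : a ∈ σ.support ∪ τ.support := by rw [h]; simp
      have hx' : x = (f a : β) := by rw [ha]
      rw [hx', Finset.mem_union, key, key]
      simpa using h2

open Equiv Equiv.Perm in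
lemma card_PP (lam del : Multiset ℕ) {α β : Type} [Fintype α] [DecidableEq α] [Fintype β]
    [DecidableEq β] (S : Finset β) (f : α ≃ Subtype (· ∈ S)) (π₀ : Perm α) (π : Perm β)
    (h : π₀.extendDomain f = π) :
    Nat.card (PP lam del α π₀ Finset.univ) = Nat.card (PP lam del β π S) := by
  have inj : Function.Injective (fun σ : Perm α => σ.extendDomain f) :=
    extendDomainHom_injective f
  refine Nat.card_congr (Equiv.ofBijective (fun p => ⟨(p.1.1.extendDomain f, p.1.2.extendDomain f),
    by simpa using p.2.1, by simpa using p.2.2.1, by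
      rw [extendDomain_mul, p.2.2.2.1, h], (supp_ext S f _ _).2 p.2.2.2.2⟩) ⟨?_, ?_⟩)
  · intro p q hpq
    have := congrArg Subtype.val hpq
    simp only [Prod.mk.injEq] at this
    exact Subtype.ext (Prod.ext (inj this.1) (inj this.2))
  · rintro ⟨⟨σ, τ⟩, h1, h2, h3, h4⟩
    obtain ⟨σ', rfl⟩ := exists_extend S f σ (h4 ▸ Finset.subset_union_left)
    obtain ⟨τ', rfl⟩ := exists_extend S f τ (h4 ▸ Finset.subset_union_right)
    refine ⟨⟨(σ', τ'), by simpa using h1, by simpa using h2, ?_, (supp_ext S f _ _).1 h4⟩, rfl⟩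
    apply inj
    simp only at h3 ⊢
    rw [← extendDomain_mul, h3, h]

open Equiv Equiv.Perm in
lemma card_PP' (lam del : Multiset ℕ) {α β : Type} [Fintype α] [DecidableEq α] [Fintype β]
    [DecidableEq β] (S : Finset β) (hc : Fintype.card α = S.card) (π₀ : Perm α) (π : Perm β)
    (hS : π.support ⊆ S) (h : π₀.cycleType = π.cycleType) :
    Nat.card (PP lam del α π₀ Finset.univ) = Nat.card (PP lam del β π S) := by
  have g : α ≃ Subtype (· ∈ S) := Fintype.equivOfCardEq (by simpa using hc)
  obtain ⟨π₁, h1⟩ := exists_extend S g π hS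
  have h2 : IsConj π₀ π₁ := by
    rw [isConj_iff_cycleType_eq, h, ← h1, cycleType_extendDomain]
  obtain ⟨c, hc⟩ := isConj_iff.mp h2
  refine card_PP lam del S (c.trans g) π₀ π ?_
  rw [← h1, ← hc]
  ext x
  by_cases hx : x ∈ S
  · rw [extendDomain_apply_subtype _ _ hx, extendDomain_apply_subtype _ _ hx]
    rfl
  · rw [extendDomain_apply_not_subtype _ _ hx, extendDomain_apply_not_subtype _ _ hx]

open Equiv Equiv.Perm Classical in
noncomputable def aa (lam del rho : Multiset ℕ) (k : ℕ) : ℕ :=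
  if h : ∃ π : Perm (Fin (rho.sum + k)), π.cycleType = rho then
    Nat.card (PP lam del _ h.choose Finset.univ) else 0

open Equiv Equiv.Perm in
lemma aa_zero (lam del rho : Multiset ℕ) (k : ℕ) (hk : lam.sum + del.sum < rho.sum + k) :
    aa lam del rho k = 0 := by
  unfold aa
  split_ifs with h
  · have : IsEmpty (PP lam del _ h.choose Finset.univ) := by
      refine ⟨?_⟩
      rintro ⟨⟨σ, τ⟩, h1, h2, h3, h4⟩
      have h5 := Finset.card_union_le σ.support τ.support
      simp only at h1 h2 h4
      rw [h4, ← sum_cycleType, ← sum_cycleType, h1, h2] at h5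
      simp at h5
      omega
    exact Nat.card_of_isEmpty
  · rfl

open Equiv Equiv.Perm in
lemma card_eq_aa (lam del rho : Multiset ℕ) (k n : ℕ) (π : Perm (Fin n)) (hπ : π.cycleType = rho)
    (S : Finset (Fin n)) (hS : π.support ⊆ S) (hc : S.card = rho.sum + k) :
    Nat.card (PP lam del _ π S) = aa lam del rho k := by
  have h : ∃ π : Perm (Fin (rho.sum + k)), π.cycleType = rho := by
    have g : Fin (rho.sum + k) ≃ Subtype (· ∈ S) := Fintype.equivOfCardEq (by simpa using hc.symm)
    obtain ⟨π₁, h1⟩ := exists_extend S g π hS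
    exact ⟨π₁, by rw [← h1, cycleType_extendDomain] at hπ; exact hπ⟩
  unfold aa
  rw [dif_pos h]
  exact (card_PP' lam del S (by simp [hc]) _ π hS (by rw [h.choose_spec, hπ])).symm

/-- Ivanov–Kerov form of the Farahat–Higman theorem: the structure coefficients
`c_{λδ}^{ρ}(n)` of `Z(ℂ[S_n])`, for proper partitions `λ`, `δ`, `ρ` (encoded as multisets of
parts, all `≥ 2`), are nonnegative-integer combinations of the binomials `C(n-|ρ|, k)`,
`0 ≤ k ≤ |λ|+|δ|-|ρ|`, with coefficients independent of `n`. -/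
theorem stmt7 (lam del rho : Multiset ℕ)
    (hlam : ∀ p ∈ lam, 2 ≤ p) (hdel : ∀ p ∈ del, 2 ≤ p) (hrho : ∀ p ∈ rho, 2 ≤ p) :
    ∃ a : ℕ → ℕ,
      ∀ n : ℕ, lam.sum ≤ n → del.sum ≤ n → rho.sum ≤ n →
        ∀ π : Equiv.Perm (Fin n), π.cycleType = rho →
          Nat.card {p : Equiv.Perm (Fin n) × Equiv.Perm (Fin n) //
              p.1.cycleType = lam ∧ p.2.cycleType = del ∧ p.1 * p.2 = π} =
            ∑ k ∈ Finset.range (lam.sum + del.sum + 1 - rho.sum),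
              a k * Nat.choose (n - rho.sum) k := by
  classical
  refine ⟨aa lam del rho, ?_⟩
  intro n _ _ hr π hπ
  have hR : π.support.card = rho.sum := by rw [← Equiv.Perm.sum_cycleType, hπ]
  have hRc : (π.supportᶜ).card = n - rho.sum := by
    rw [Finset.card_compl, hR, Fintype.card_fin]
  set F : Finset (Equiv.Perm (Fin n) × Equiv.Perm (Fin n)) := Finset.univ.filter
    (fun p => p.1.cycleType = lam ∧ p.2.cycleType = del ∧ p.1 * p.2 = π) with hF
  have e1 : Nat.card {p : Equiv.Perm (Fin n) × Equiv.Perm (Fin n) //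
              p.1.cycleType = lam ∧ p.2.cycleType = del ∧ p.1 * p.2 = π} = F.card := by
    rw [Nat.card_eq_fintype_card, Fintype.card_subtype]
  have e2 : F.card = ∑ T ∈ (π.supportᶜ).powerset,
      (F.filter (fun p => (p.1.support ∪ p.2.support) \ π.support = T)).card := by
    apply Finset.card_eq_sum_card_fiberwise
    intro p _
    simp only [Finset.coe_powerset, Set.mem_preimage, Set.mem_powerset_iff, Finset.coe_subset]
    intro x hx
    simp only [Finset.mem_sdiff] at hx
    simpa using hx.2
  have e3 : ∀ T ∈ (π.supportᶜ).powerset,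
      (F.filter (fun p => (p.1.support ∪ p.2.support) \ π.support = T)).card
        = aa lam del rho T.card := by
    intro T hT
    have hd : Disjoint π.support T :=
      (Finset.subset_compl_iff_disjoint_left.mp (Finset.mem_powerset.mp hT))
    rw [← card_eq_aa lam del rho T.card n π hπ (π.support ∪ T) Finset.subset_union_left
      (by rw [Finset.card_union_of_disjoint hd, hR])]
    unfold PP
    rw [Nat.card_eq_fintype_card, Fintype.card_subtype]
    congr 1
    ext p
    simp only [hF, Finset.mem_filter, Finset.mem_univ, true_and, and_assoc]
    refine and_congr_right fun _ => and_congr_right fun _ => and_congr_right fun h3 => ?_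
    have hsub : π.support ⊆ p.1.support ∪ p.2.support := by
      rw [← h3]; exact Equiv.Perm.support_mul_le _ _
    constructor
    · rintro rfl
      rw [Finset.union_sdiff_of_subset hsub]
    · intro h
      rw [h, Finset.union_sdiff_cancel_left hd]
  rw [e1, e2, Finset.sum_congr rfl e3, Finset.sum_powerset_apply_card, hRc]
  simp only [smul_eq_mul]
  have c1 : ∀ M, n - rho.sum + 1 ≤ M → ∑ m ∈ Finset.range (n - rho.sum + 1), (n - rho.sum).choose m * aa lam del rho m
      = ∑ m ∈ Finset.range M, (n - rho.sum).choose m * aa lam del rho m := by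
    intro M hM
    apply Finset.sum_subset (Finset.range_mono hM)
    intro x _ hx
    rw [Nat.choose_eq_zero_of_lt (by simpa using hx), zero_mul]
  have c2 : ∀ M, lam.sum + del.sum + 1 - rho.sum ≤ M → ∑ k ∈ Finset.range (lam.sum + del.sum + 1 - rho.sum),
      aa lam del rho k * (n - rho.sum).choose k
      = ∑ k ∈ Finset.range M, aa lam del rho k * (n - rho.sum).choose k := by
    intro M hM
    apply Finset.sum_subset (Finset.range_mono hM)
    intro x _ hx
    rw [aa_zero, zero_mul]
    rw [Finset.mem_range] at hx
    omega
  rw [c1 _ (le_max_left _ (lam.sum + del.sum + 1 - rho.sum)), c2 _ (le_max_right (n - rho.sum + 1) _)]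
  exact Finset.sum_congr rfl fun _ _ => mul_comm _ _
end

section
/- For all proper partitions λ, δ, ρ there exists a polynomial f ∈ ℚ[X] with 2·deg(f) ≤ |λ| + |δ| − |ρ| (with the convention that the zero polynomial has degree −∞) such that c_{λδ}^{ρ}(n) = f(n) for every integer n ≥ max(|λ|, |δ|, |ρ|); in particular, if |ρ| > |λ| + |δ| then c_{λδ}^{ρ}(n) = 0 for all such n. -/
open Equiv.Perm in
/-- Pairs with prescribed types, product and support union. -/
def fhPairs {α : Type} [Fintype α] [DecidableEq α] (lam del : Multiset ℕ) (π : Equiv.Perm α)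
    (S : Finset α) : Finset (Equiv.Perm α × Equiv.Perm α) :=
  Finset.univ.filter (fun p => p.1.cycleType = lam ∧ p.2.cycleType = del ∧ p.1 * p.2 = π ∧
    p.1.support ∪ p.2.support = S)

theorem fh_lift {n k : ℕ} (S : Finset (Fin n)) (f : Fin k ≃ {x // x ∈ S})
    (σ : Equiv.Perm (Fin n)) (h : σ.support ⊆ S) :
    ∃ σ1 : Equiv.Perm (Fin k), σ1.extendDomain f = σ := by
  have hS : ∀ x, σ x ∈ S ↔ x ∈ S := by
    intro x
    by_cases hx : σ x = x
    · rw [hx]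
    · have h1 : x ∈ S := h (Equiv.Perm.mem_support.2 hx)
      have h2 : σ x ∈ S := h (Equiv.Perm.apply_mem_support.2 (Equiv.Perm.mem_support.2 hx))
      simp [h1, h2]
  refine ⟨(Equiv.permCongr f.symm) (σ.subtypePerm hS), ?_⟩
  ext x
  by_cases hx : x ∈ S
  · rw [Equiv.Perm.extendDomain_apply_subtype _ _ hx]
    simp [Equiv.permCongr_apply]
  · rw [Equiv.Perm.extendDomain_apply_not_subtype _ _ hx]
    have : σ x = x := by
      by_contra hc
      exact hx (h (Equiv.Perm.mem_support.2 hc))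
    rw [this]

theorem fh_map_univ {n k : ℕ} (S : Finset (Fin n)) (f : Fin k ≃ {x // x ∈ S}) :
    (Finset.univ : Finset (Fin k)).map f.asEmbedding = S := by
  ext x
  simp only [Finset.mem_map, Finset.mem_univ, true_and]
  constructor
  · rintro ⟨a, rfl⟩
    exact (f a).2
  · intro hx
    exact ⟨f.symm ⟨x, hx⟩, by simp [Equiv.asEmbedding]⟩

theorem fh_extend {n k : ℕ} (lam del : Multiset ℕ) (S : Finset (Fin n))
    (f : Fin k ≃ {x // x ∈ S}) (π1 : Equiv.Perm (Fin k)) :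
    (fhPairs lam del π1 Finset.univ).card = (fhPairs lam del (π1.extendDomain f) S).card := by
  have hinj : Function.Injective (fun σ : Equiv.Perm (Fin k) => σ.extendDomain f) :=
    Equiv.Perm.extendDomainHom_injective f
  have hiff : ∀ σ τ : Equiv.Perm (Fin k),
      ((σ.extendDomain f).support ∪ (τ.extendDomain f).support = S ↔
        σ.support ∪ τ.support = Finset.univ) := by
    intro σ τ
    rw [Equiv.Perm.support_extend_domain, Equiv.Perm.support_extend_domain, ← Finset.map_union]
    conv_lhs => rhs; rw [← fh_map_univ S f]
    exact Finset.map_inj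
  have hmul : ∀ σ τ : Equiv.Perm (Fin k),
      (σ.extendDomain f * τ.extendDomain f = π1.extendDomain f ↔ σ * τ = π1) := by
    intro σ τ
    rw [Equiv.Perm.extendDomain_mul]
    exact hinj.eq_iff
  refine Finset.card_bij (fun p _ => (p.1.extendDomain f, p.2.extendDomain f)) ?_ ?_ ?_
  · intro p hp
    simp only [fhPairs, Finset.mem_filter, Finset.mem_univ, true_and] at hp ⊢
    rw [hiff, hmul, Equiv.Perm.cycleType_extendDomain, Equiv.Perm.cycleType_extendDomain]
    exact hp
  · rintro ⟨a, b⟩ _ ⟨c, d⟩ _ h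
    simp only [Prod.mk.injEq] at h
    rw [Prod.mk.injEq]
    exact ⟨hinj h.1, hinj h.2⟩
  · rintro ⟨σ, τ⟩ hp
    have hp' := hp
    simp only [fhPairs, Finset.mem_filter, Finset.mem_univ, true_and] at hp'
    obtain ⟨σ1, rfl⟩ := fh_lift S f σ (by rw [← hp'.2.2.2]; exact Finset.subset_union_left)
    obtain ⟨τ1, rfl⟩ := fh_lift S f τ (by rw [← hp'.2.2.2]; exact Finset.subset_union_right)
    refine ⟨(σ1, τ1), ?_, rfl⟩
    simp only [fhPairs, Finset.mem_filter, Finset.mem_univ, true_and]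
    rw [hiff, hmul, Equiv.Perm.cycleType_extendDomain, Equiv.Perm.cycleType_extendDomain] at hp'
    exact hp'

theorem fh_conj_le {k : ℕ} (lam del : Multiset ℕ) (π g : Equiv.Perm (Fin k)) :
    (fhPairs lam del π Finset.univ).card ≤
      (fhPairs lam del (g * π * g⁻¹) Finset.univ).card := by
  refine Finset.card_le_card_of_injOn (fun p => (g * p.1 * g⁻¹, g * p.2 * g⁻¹)) ?_ ?_
  · rintro ⟨σ, τ⟩ hp
    simp only [fhPairs, Finset.coe_filter, Set.mem_setOf_eq, Finset.mem_univ, true_and] at hp ⊢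
    obtain ⟨h1, h2, h3, h4⟩ := hp
    refine ⟨by rw [Equiv.Perm.cycleType_conj, h1], by rw [Equiv.Perm.cycleType_conj, h2],
      by rw [← h3]; group, ?_⟩
    rw [Equiv.Perm.support_conj, Equiv.Perm.support_conj, ← Finset.map_union, h4]
    simp
  · rintro ⟨a, b⟩ _ ⟨c, d⟩ _ h
    simpa using h

theorem fh_card_eq {n k : ℕ} (lam del : Multiset ℕ) (π0 : Equiv.Perm (Fin k))
    (π : Equiv.Perm (Fin n)) (hc : π0.cycleType = π.cycleType) (S : Finset (Fin n))
    (hS : π.support ⊆ S) (hk : S.card = k) :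
    (fhPairs lam del π S).card = (fhPairs lam del π0 Finset.univ).card := by
  let f : Fin k ≃ {x // x ∈ S} := (S.equivFinOfCardEq hk).symm
  obtain ⟨π1, rfl⟩ := fh_lift S f π hS
  rw [← fh_extend]
  rw [Equiv.Perm.cycleType_extendDomain] at hc
  obtain ⟨g, rfl⟩ := isConj_iff.1 (Equiv.Perm.isConj_iff_cycleType_eq.2 hc)
  refine le_antisymm ?_ (fh_conj_le _ _ _ _)
  have := fh_conj_le lam del (g * π0 * g⁻¹) g⁻¹
  have e : g⁻¹ * (g * π0 * g⁻¹) * g⁻¹⁻¹ = π0 := by group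
  rwa [e] at this

theorem fh_vanish {k : ℕ} (lam del : Multiset ℕ) (π : Equiv.Perm (Fin k))
    (h : lam.sum + del.sum + π.cycleType.sum < 2 * k) :
    (fhPairs lam del π Finset.univ).card = 0 := by
  rw [Finset.card_eq_zero, Finset.eq_empty_iff_forall_notMem]
  rintro ⟨σ, τ⟩ hp
  simp only [fhPairs, Finset.mem_filter, Finset.mem_univ, true_and] at hp
  obtain ⟨rfl, rfl, rfl, h4⟩ := hp
  simp only [Equiv.Perm.sum_cycleType] at h
  have h5 : Finset.univ \ (σ * τ).support ⊆ σ.support ∩ τ.support := by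
    intro x hx
    simp only [Finset.mem_sdiff, Finset.mem_univ, true_and, Equiv.Perm.mem_support, not_not,
      Equiv.Perm.mul_apply, Finset.mem_inter] at hx ⊢
    have hu : x ∈ σ.support ∪ τ.support := by rw [h4]; exact Finset.mem_univ x
    simp only [Finset.mem_union, Equiv.Perm.mem_support] at hu
    by_cases ht : τ x = x
    · rw [ht] at hx
      tauto
    · refine ⟨fun hs => ht ?_, ht⟩
      exact σ.injective (hx.trans hs.symm)
  have h6 := Finset.card_le_card h5
  have h7 := Finset.card_union_add_card_inter σ.support τ.support
  rw [h4] at h7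
  have h8 := Finset.le_card_sdiff (σ * τ).support (Finset.univ : Finset (Fin k))
  simp only [Finset.card_univ, Fintype.card_fin] at h7 h8
  omega

open Classical in
/-- Universal coefficient. -/
noncomputable def fhCoef (lam del rho : Multiset ℕ) (k : ℕ) : ℕ :=
  if h : ∃ π : Equiv.Perm (Fin k), π.cycleType = rho then
    (fhPairs lam del h.choose Finset.univ).card else 0

theorem fhCoef_eq {n : ℕ} (lam del rho : Multiset ℕ) (π : Equiv.Perm (Fin n))
    (hc : π.cycleType = rho) (S : Finset (Fin n)) (hS : π.support ⊆ S) :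
    (fhPairs lam del π S).card = fhCoef lam del rho S.card := by
  have h : ∃ π : Equiv.Perm (Fin S.card), π.cycleType = rho := by
    obtain ⟨π1, h1⟩ := fh_lift S (S.equivFinOfCardEq rfl).symm π hS
    refine ⟨π1, ?_⟩
    rw [← hc, ← h1, Equiv.Perm.cycleType_extendDomain]
  rw [fhCoef, dif_pos h]
  exact fh_card_eq lam del _ π (h.choose_spec.trans hc.symm) S hS rfl

theorem fhCoef_zero (lam del rho : Multiset ℕ) (k : ℕ)
    (h : lam.sum + del.sum + rho.sum < 2 * k) : fhCoef lam del rho k = 0 := by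
  unfold fhCoef
  split_ifs with hh
  · apply fh_vanish
    rw [hh.choose_spec]
    exact h
  · rfl

theorem fh_total {n : ℕ} (lam del rho : Multiset ℕ) (π : Equiv.Perm (Fin n))
    (hc : π.cycleType = rho) :
    Nat.card {p : Equiv.Perm (Fin n) × Equiv.Perm (Fin n) //
              p.1.cycleType = lam ∧ p.2.cycleType = del ∧ p.1 * p.2 = π} =
      ∑ k ∈ Finset.range (n - rho.sum + 1),
        (n - rho.sum).choose k * fhCoef lam del rho (rho.sum + k) := by
  have hs : π.support.card = rho.sum := by rw [← hc, Equiv.Perm.sum_cycleType]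
  rw [Nat.card_eq_fintype_card, Fintype.card_subtype]
  rw [Finset.card_eq_sum_card_fiberwise (t := π.supportᶜ.powerset)
    (f := fun p => (p.1.support ∪ p.2.support) \ π.support)]
  · have hcard : π.supportᶜ.card = n - rho.sum := by
      rw [Finset.card_compl, Fintype.card_fin, hs]
    have := Finset.sum_powerset_apply_card (fun m => fhCoef lam del rho (rho.sum + m))
      (x := π.supportᶜ)
    rw [hcard] at this
    simp only [smul_eq_mul] at this
    rw [← this]
    refine Finset.sum_congr rfl fun T hT => ?_
    rw [Finset.mem_powerset] at hT
    have hd : Disjoint π.support T := by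
      rw [Finset.disjoint_left]
      intro x hx hxT
      exact (Finset.mem_compl.1 (hT hxT)) hx
    rw [← hs, ← Finset.card_union_of_disjoint hd,
      ← fhCoef_eq lam del rho π hc _ Finset.subset_union_left]
    congr 1
    ext ⟨σ, τ⟩
    simp only [fhPairs, Finset.mem_filter, Finset.mem_univ, true_and, and_assoc]
    refine and_congr_right fun _ => and_congr_right fun _ => and_congr_right fun h3 => ?_
    have hsub : π.support ⊆ σ.support ∪ τ.support := by
      rw [← h3]; exact Equiv.Perm.support_mul_le σ τ
    constructor
    · intro h
      rw [← h, Finset.union_sdiff_of_subset hsub]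
    · intro h
      rw [h, Finset.union_sdiff_cancel_left hd]
  · intro p _
    simp only [Finset.coe_powerset, Set.mem_preimage, Set.mem_powerset_iff, Finset.coe_subset]
    intro x hx
    simp only [Finset.mem_sdiff] at hx
    exact Finset.mem_compl.2 hx.2

/-- The polynomial. -/
noncomputable def fhPoly (lam del rho : Multiset ℕ) : Polynomial ℚ :=
  ∑ k ∈ (Finset.range (lam.sum + del.sum + 1)).filter
      (fun k => 2 * k + rho.sum ≤ lam.sum + del.sum),
    Polynomial.C ((fhCoef lam del rho (rho.sum + k) : ℚ) / (k.factorial : ℚ)) *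
      (descPochhammer ℚ k).comp (Polynomial.X - Polynomial.C (rho.sum : ℚ))

theorem fhPoly_eval (lam del rho : Multiset ℕ) (n : ℕ) (hn : rho.sum ≤ n) :
    (fhPoly lam del rho).eval (n : ℚ) =
      ((∑ k ∈ Finset.range (n - rho.sum + 1),
        (n - rho.sum).choose k * fhCoef lam del rho (rho.sum + k) : ℕ) : ℚ) := by
  have h1 : (fhPoly lam del rho).eval (n : ℚ) =
      ((∑ k ∈ (Finset.range (lam.sum + del.sum + 1)).filter
      (fun k => 2 * k + rho.sum ≤ lam.sum + del.sum),
        (n - rho.sum).choose k * fhCoef lam del rho (rho.sum + k) : ℕ) : ℚ) := by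
    rw [fhPoly, Polynomial.eval_finsetSum, Nat.cast_sum]
    refine Finset.sum_congr rfl fun k _ => ?_
    simp only [Polynomial.eval_mul, Polynomial.eval_C, Polynomial.eval_comp,
      Polynomial.eval_sub, Polynomial.eval_X]
    rw [← Nat.cast_sub hn, descPochhammer_eval_eq_descFactorial,
      Nat.descFactorial_eq_factorial_mul_choose]
    rw [Nat.cast_mul, Nat.cast_mul]
    have : (k.factorial : ℚ) ≠ 0 := by exact_mod_cast k.factorial_ne_zero
    field_simp
  rw [h1]
  congr 1
  have e1 := Finset.sum_subset
    (f := fun k => (n - rho.sum).choose k * fhCoef lam del rho (rho.sum + k))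
    (s₁ := (Finset.range (lam.sum + del.sum + 1)).filter
      (fun k => 2 * k + rho.sum ≤ lam.sum + del.sum))
    (s₂ := Finset.range (lam.sum + del.sum + n + 1))
    (by intro k hk; simp only [Finset.mem_filter, Finset.mem_range] at hk ⊢; omega)
    (by
      intro k _ hk
      simp only [Finset.mem_filter, Finset.mem_range] at hk
      rw [fhCoef_zero _ _ _ _ (by omega), mul_zero])
  have e2 := Finset.sum_subset
    (f := fun k => (n - rho.sum).choose k * fhCoef lam del rho (rho.sum + k))
    (s₁ := Finset.range (n - rho.sum + 1))
    (s₂ := Finset.range (lam.sum + del.sum + n + 1))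
    (by intro k hk; simp only [Finset.mem_range] at hk ⊢; omega)
    (by
      intro k _ hk
      simp only [Finset.mem_range] at hk
      rw [Nat.choose_eq_zero_of_lt (by omega), zero_mul])
  exact e1.trans e2.symm

theorem fhPoly_zero (lam del rho : Multiset ℕ) (h : lam.sum + del.sum < rho.sum) :
    fhPoly lam del rho = 0 := by
  rw [fhPoly, Finset.filter_false_of_mem, Finset.sum_empty]
  intro k _
  omega

theorem fhPoly_deg (lam del rho : Multiset ℕ) (h : rho.sum ≤ lam.sum + del.sum) :
    2 * (fhPoly lam del rho).natDegree + rho.sum ≤ lam.sum + del.sum := by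
  have : (fhPoly lam del rho).natDegree ≤ (lam.sum + del.sum - rho.sum) / 2 := by
    refine Polynomial.natDegree_sum_le_of_forall_le _ _ fun k hk => ?_
    simp only [Finset.mem_filter] at hk
    refine (Polynomial.natDegree_C_mul_le _ _).trans ?_
    refine Polynomial.natDegree_comp_le.trans ?_
    rw [Polynomial.natDegree_X_sub_C, mul_one, descPochhammer_natDegree]
    omega
  omega

/-- Degree bound for the Farahat–Higman polynomials: for proper partitions `λ`, `δ`, `ρ`
(multisets of parts, all `≥ 2`), the structure coefficient `c_{λδ}^{ρ}(n)` of `Z(ℂ[S_n])`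
agrees, for `n ≥ max(|λ|,|δ|,|ρ|)`, with a polynomial `f ∈ ℚ[X]` satisfying
`2·deg f ≤ |λ| + |δ| - |ρ|` (zero polynomial having degree `-∞`); in particular the
coefficient vanishes when `|ρ| > |λ| + |δ|`. -/
theorem stmt8 (lam del rho : Multiset ℕ)
    (hlam : ∀ p ∈ lam, 2 ≤ p) (hdel : ∀ p ∈ del, 2 ≤ p) (hrho : ∀ p ∈ rho, 2 ≤ p) :
    ∃ f : Polynomial ℚ,
      (f = 0 ∨ 2 * f.natDegree + rho.sum ≤ lam.sum + del.sum) ∧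
      (∀ n : ℕ, lam.sum ≤ n → del.sum ≤ n → rho.sum ≤ n →
        ∀ π : Equiv.Perm (Fin n), π.cycleType = rho →
          (Nat.card {p : Equiv.Perm (Fin n) × Equiv.Perm (Fin n) //
              p.1.cycleType = lam ∧ p.2.cycleType = del ∧ p.1 * p.2 = π} : ℚ) =
            f.eval (n : ℚ)) ∧
      (lam.sum + del.sum < rho.sum →
        ∀ n : ℕ, lam.sum ≤ n → del.sum ≤ n → rho.sum ≤ n →
          ∀ π : Equiv.Perm (Fin n), π.cycleType = rho →
            Nat.card {p : Equiv.Perm (Fin n) × Equiv.Perm (Fin n) //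
                p.1.cycleType = lam ∧ p.2.cycleType = del ∧ p.1 * p.2 = π} = 0) := by
  refine ⟨fhPoly lam del rho, ?_, ?_, ?_⟩
  · rcases Nat.lt_or_ge (lam.sum + del.sum) rho.sum with h | h
    · exact Or.inl (fhPoly_zero _ _ _ h)
    · exact Or.inr (fhPoly_deg _ _ _ h)
  · intro n _ _ hn π hπ
    rw [fhPoly_eval _ _ _ _ hn, fh_total _ _ _ π hπ]
  · intro h n _ _ hn π hπ
    have h1 := fhPoly_eval lam del rho n hn
    rw [fhPoly_zero _ _ _ h, ← fh_total _ _ _ π hπ, Polynomial.eval_zero] at h1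
    exact_mod_cast h1.symm
end

section
/- For all proper partitions λ, δ, ρ there exists a polynomial f ∈ ℚ[X] with deg(f) ≤ (|λ| − ℓ(λ)) + (|δ| − ℓ(δ)) − (|ρ| − ℓ(ρ)) = |λ| + |δ| − |ρ| + ℓ(ρ) − ℓ(λ) − ℓ(δ) (with the convention that the zero polynomial has degree −∞; in particular, if this bound is negative then c_{λδ}^{ρ}(n) = 0) such that c_{λδ}^{ρ}(n) = f(n) for every integer n ≥ max(|λ|, |δ|, |ρ|). -/
set_option linter.unusedSectionVars false
set_option linter.unusedSimpArgs false

namespace Feray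
open Equiv Equiv.Perm

variable {α : Type*} [Fintype α] [DecidableEq α]

/-- invariant functions -/
def V (A : Perm α) : Submodule ℚ (α → ℚ) where
  carrier := {f | ∀ x, f (A x) = f x}
  add_mem' := by intro a b ha hb x; simp [ha x, hb x]
  zero_mem' := by intro x; rfl
  smul_mem' := by intro c a ha x; simp [ha x]

theorem mem_V {A : Perm α} {f : α → ℚ} : f ∈ V A ↔ ∀ x, f (A x) = f x := Iff.rfl

theorem V_sameCycle {A : Perm α} {f : α → ℚ} (hf : f ∈ V A) {x y : α} (h : A.SameCycle x y) :
    f x = f y := by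
  obtain ⟨j, _, _, hj⟩ := h.exists_pow_eq''
  clear h
  rw [← hj]
  rename_i h1 h2
  clear h1 h2 hj
  induction j with
  | zero => rfl
  | succ k ih => rw [pow_succ', Perm.mul_apply, hf]; exact ih

def key (A : Perm α) (x : α) : A.cycleFactorsFinset ⊕ {x // A x = x} :=
  if h : A x = x then Sum.inr ⟨x, h⟩
  else Sum.inl ⟨A.cycleOf x, cycleOf_mem_cycleFactorsFinset_iff.2 (mem_support.2 h)⟩

theorem key_surj (A : Perm α) : Function.Surjective (key A) := by
  rintro (⟨c, hc⟩ | ⟨x, hx⟩)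
  · obtain ⟨x, hx⟩ := (mem_cycleFactorsFinset_iff.1 hc).1.nonempty_support
    refine ⟨x, ?_⟩
    have h1 : A x ≠ x := mem_support.1 (mem_cycleFactorsFinset_support_le hc hx)
    rw [key, dif_neg h1]
    congr 2
    exact ((cycle_is_cycleOf hx hc)).symm
  · exact ⟨x, by rw [key, dif_pos hx]⟩

theorem key_same {A : Perm α} {x y : α} (h : key A x = key A y) : A.SameCycle x y := by
  unfold key at h
  split_ifs at h with h1 h2 h2
  · simp at h; subst h; exact SameCycle.refl _ _
  · simp at h
    have : y ∈ (A.cycleOf x).support := by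
      rw [h]; exact mem_support_cycleOf_iff.2 ⟨SameCycle.refl _ _, mem_support.2 h2⟩
    exact (mem_support_cycleOf_iff.1 this).1

theorem key_apply (A : Perm α) (x : α) : key A (A x) = key A x := by
  unfold key
  by_cases h : A x = x
  · simp [h]
  · have h2 : A (A x) ≠ A x := fun h' => h (A.injective h')
    rw [dif_neg h, dif_neg h2]
    congr 2
    exact (SameCycle.cycleOf_eq ((sameCycle_apply_right).2 (SameCycle.refl A x))).symm

theorem finrank_V (A : Perm α) :
    Module.finrank ℚ (V A) + A.cycleType.sum = Multiset.card A.cycleType + Fintype.card α := by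
  have h1 : V A = LinearMap.range (LinearMap.funLeft ℚ ℚ (key A)) := by
    ext f
    constructor
    · intro hf
      refine ⟨fun q => f (Function.surjInv (key_surj A) q), ?_⟩
      ext x
      apply V_sameCycle hf
      apply key_same
      exact Function.surjInv_eq (key_surj A) _
    · rintro ⟨g, rfl⟩ x
      simp [LinearMap.funLeft_apply, key_apply]
  rw [h1, LinearMap.finrank_range_of_inj (LinearMap.funLeft_injective_of_surjective _ _ _ (key_surj A)),
    Module.finrank_fintype_fun_eq_card, Fintype.card_sum, Fintype.card_coe, sum_cycleType,
    cycleType_def, Multiset.card_map]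
  have h2 : Fintype.card {x // A x = x} + A.support.card = Fintype.card α := by
    rw [Fintype.card_subtype, ← Finset.card_univ (α := α),
      ← Finset.card_filter_add_card_filter_not (s := Finset.univ) (fun x => A x = x)]
    rfl
  have : A.cycleFactorsFinset.val.card = A.cycleFactorsFinset.card := rfl
  omega

/-- number of cycles -/
noncomputable def orb (A : Perm α) : ℕ := Module.finrank ℚ (V A)

theorem orb_mul_swap (A : Perm α) (y z : α) : orb A ≤ orb (A * swap y z) + 1 := by
  let φ : V A →ₗ[ℚ] ℚ :=
    ((LinearMap.proj y : (α → ℚ) →ₗ[ℚ] ℚ) - LinearMap.proj z).comp (V A).subtype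
  have h1 := LinearMap.finrank_range_add_finrank_ker φ
  have h2 : Module.finrank ℚ (LinearMap.range φ) ≤ 1 := by
    simpa using Submodule.finrank_le (LinearMap.range φ)
  have h3 : Module.finrank ℚ (LinearMap.ker φ) ≤ orb (A * swap y z) := by
    let ψ : LinearMap.ker φ →ₗ[ℚ] V (A * swap y z) :=
      ((V A).subtype.comp (LinearMap.ker φ).subtype).codRestrict _ (by
        rintro ⟨⟨f, hf⟩, hk⟩ x
        have hk' : f y = f z := sub_eq_zero.1 hk
        change f (A (swap y z x)) = f x
        rw [hf, swap_apply_def]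
        split_ifs with h1 h2
        · rw [h1, hk']
        · rw [h2, hk']
        · rfl)
    apply LinearMap.finrank_le_finrank_of_injective (f := ψ)
    intro a b hab
    apply Subtype.ext
    apply Subtype.ext
    have := congrArg (Subtype.val : V (A * swap y z) → (α → ℚ)) hab
    exact this
  unfold orb at *
  omega

theorem orb_lt {C D : Perm α} {y z : α} (hyz : y ≠ z) (hD : D y = y) (hCy : C.SameCycle y z)
    (hle : V C ≤ V D) : orb C < orb D := by
  apply Submodule.finrank_lt_finrank_of_lt
  refine lt_of_le_of_ne hle ?_
  intro he
  have h1 : Pi.single y (1:ℚ) ∈ V D := by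
    intro x
    by_cases hx : x = y
    · subst hx; rw [hD]
    · have : D x ≠ y := fun h' => hx (D.injective (h'.trans hD.symm))
      simp [Pi.single_apply, hx, this]
  rw [← he] at h1
  have := V_sameCycle h1 hCy
  simp [Pi.single_apply, hyz.symm] at this


theorem orb_fixed {A : Perm α} {y z : α} (hyz : y ≠ z) (hA : A y = y) :
    orb (A * swap y z) < orb A := by
  refine orb_lt hyz hA (z := z) ?_ ?_
  · have : (A * swap y z) z = y := by simp [hA]
    exact SameCycle.symm ⟨1, by simpa using this⟩
  · intro f hf x
    have hz : f y = f z := by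
      have := hf z
      simpa [hA] using this
    have := hf (swap y z x)
    simp only [Perm.mul_apply, swap_apply_self] at this
    rw [this, swap_apply_def]
    split_ifs with h1 h2
    · rw [h1, hz]
    · rw [h2, hz]
    · rfl

theorem orb_split {B : Perm α} {y : α} (hy : B y ≠ y) :
    orb B < orb (swap y (B y) * B) := by
  refine orb_lt (y := y) (z := B y) hy.symm ?_ ?_ ?_
  · simp
  · exact ⟨1, by simp⟩
  · intro f hf x
    have hz : f (B y) = f y := hf y
    rw [Perm.mul_apply, ← hf x, swap_apply_def]
    split_ifs with h1 h2
    · rw [h1, hz]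
    · rw [h2, hz]
    · rfl

theorem main_ineq (m : ℕ) : ∀ A B : Perm α, B.support.card ≤ m →
    orb (A * B) + orb B + (B.support.filter (fun x => A x = x)).card ≤ orb A + Fintype.card α := by
  induction m with
  | zero =>
    intro A B h
    have hB : B = 1 := by simpa using h
    subst hB
    have : orb (1 : Perm α) = Fintype.card α := by
      have := finrank_V (1 : Perm α)
      simpa [orb] using this
    simp [this]
  | succ m ih =>
    intro A B h
    by_cases hB : B = 1
    · subst hB; exact ih A 1 (by simp)
    obtain ⟨y, hy⟩ : ∃ y, B y ≠ y := by
      by_contra hc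
      push Not at hc
      exact hB (Equiv.ext hc)
    have h1 := orb_split hy
    have hs := card_support_swap_mul hy
    have h2 := ih (A * swap y (B y)) (swap y (B y) * B) (by omega)
    have h3 : A * swap y (B y) * (swap y (B y) * B) = A * B := by
      rw [mul_assoc, ← mul_assoc (swap y (B y)), swap_mul_self, one_mul]
    rw [h3] at h2
    have key : ∀ x, x ≠ y → x ≠ B y → x ∈ B.support.filter (fun x => A x = x) →
        x ∈ (swap y (B y) * B).support.filter (fun x => (A * swap y (B y)) x = x) := by
      intro x hx1 hx2 hx
      rw [Finset.mem_filter, mem_support] at hx ⊢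
      simp only [Perm.mul_apply]
      rw [swap_apply_of_ne_of_ne hx1 hx2]
      refine ⟨?_, hx.2⟩
      intro h'
      rw [swap_apply_eq_iff, swap_apply_of_ne_of_ne hx1 hx2] at h'
      exact hx.1 h'
    by_cases hf : A y = y ∨ A (B y) = B y
    · have h4 : orb (A * swap y (B y)) < orb A := by
        rcases hf with hf | hf
        · exact orb_fixed hy.symm hf
        · rw [swap_comm]; exact orb_fixed hy hf
      have h5 : (B.support.filter (fun x => A x = x)).card ≤
          (insert y (insert (B y) ((swap y (B y) * B).support.filter
            (fun x => (A * swap y (B y)) x = x)))).card := by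
        apply Finset.card_le_card
        intro x hx
        by_cases e1 : x = y
        · simp [e1]
        by_cases e2 : x = B y
        · simp [e2]
        exact Finset.mem_insert_of_mem (Finset.mem_insert_of_mem (key x e1 e2 hx))
      have h6 := Finset.card_insert_le y (insert (B y) ((swap y (B y) * B).support.filter
            (fun x => (A * swap y (B y)) x = x)))
      have h7 := Finset.card_insert_le (B y) ((swap y (B y) * B).support.filter
            (fun x => (A * swap y (B y)) x = x))
      omega
    · push Not at hf
      have h4 : orb (A * swap y (B y)) ≤ orb A + 1 := by
        have := orb_mul_swap (A * swap y (B y)) y (B y)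
        rwa [mul_assoc, swap_mul_self, mul_one] at this
      have h5 : (B.support.filter (fun x => A x = x)).card ≤
          ((swap y (B y) * B).support.filter (fun x => (A * swap y (B y)) x = x)).card := by
        apply Finset.card_le_card
        intro x hx
        have hx' := (Finset.mem_filter.1 hx).2
        refine key x ?_ ?_ hx
        · rintro rfl; exact hf.1 hx'
        · rintro rfl; exact hf.2 hx'
      omega

/-- the degree bound -/
theorem bound {σ τ π : Perm α} (h : σ * τ = π) (hs : ∀ x, π x = x → σ x ≠ x) :
    (Fintype.card α : ℤ) - π.cycleType.sum ≤
      ((σ.cycleType.sum : ℤ) - Multiset.card σ.cycleType)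
      + ((τ.cycleType.sum : ℤ) - Multiset.card τ.cycleType)
      - ((π.cycleType.sum : ℤ) - Multiset.card π.cycleType) := by
  have h1 := main_ineq _ π⁻¹ σ le_rfl
  have e1 : π⁻¹ * σ = τ⁻¹ := by rw [← h]; group
  have e2 : (σ.support.filter (fun x => π⁻¹ x = x)) = π.supportᶜ := by
    ext x
    simp only [Finset.mem_filter, mem_support, Finset.mem_compl, not_not]
    rw [Perm.inv_eq_iff_eq, eq_comm (a := x)]
    exact ⟨fun h => h.2, fun h => ⟨hs x h, h⟩⟩
  rw [e1, e2, Finset.card_compl] at h1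
  have h2 := finrank_V σ
  have h3 := finrank_V τ⁻¹
  have h4 := finrank_V π⁻¹
  have h5 := sum_cycleType π
  have h6 := sum_cycleType_le π
  simp only [cycleType_inv] at h3 h4
  unfold orb at h1
  omega

/-- pairs using all fixed points of `π` -/
def cnt (lam del : Multiset ℕ) (π : Perm α) : ℕ :=
  (Finset.univ.filter (fun p : Perm α × Perm α => p.1.cycleType = lam ∧ p.2.cycleType = del ∧
    p.1 * p.2 = π ∧ ∀ x, π x = x → p.1 x ≠ x)).card

theorem cycleType_permCongr {β : Type*} [Fintype β] [DecidableEq β] (e : α ≃ β) (σ : Perm α) :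
    (e.permCongr σ).cycleType = σ.cycleType := by
  let g : α ≃ Subtype (fun _ : β => True) := e.trans (Equiv.subtypeUnivEquiv (fun _ => trivial)).symm
  have : e.permCongr σ = σ.extendDomain g := by
    ext x
    rw [Perm.extendDomain_apply_subtype _ _ trivial]
    rfl
  rw [this, cycleType_extendDomain]

theorem cnt_congr {β : Type*} [Fintype β] [DecidableEq β] (e : α ≃ β) (lam del : Multiset ℕ)
    (π : Perm α) : cnt lam del (e.permCongr π) = cnt lam del π := by
  symm
  unfold cnt
  refine Finset.card_equiv (e.permCongr.prodCongr e.permCongr) ?_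
  rintro ⟨σ, τ⟩
  simp only [Finset.mem_filter, Finset.mem_univ, true_and, Equiv.prodCongr_apply, Prod.map,
    cycleType_permCongr]
  have h1 : e.permCongr σ * e.permCongr τ = e.permCongr π ↔ σ * τ = π := by
    rw [← e.permCongr.injective.eq_iff]
    have : e.permCongr (σ * τ) = e.permCongr σ * e.permCongr τ := by
      ext x; simp
    rw [this]
  have h2 : (∀ x, (e.permCongr π) x = x → (e.permCongr σ) x ≠ x) ↔ ∀ x, π x = x → σ x ≠ x := by
    rw [← e.forall_congr_right]
    simp
  rw [h1, h2]

theorem cnt_eq {β : Type*} [Fintype β] [DecidableEq β] (lam del : Multiset ℕ)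
    (π : Perm α) (π' : Perm β) (hc : Fintype.card α = Fintype.card β)
    (h : π.cycleType = π'.cycleType) : cnt lam del π = cnt lam del π' := by
  let e : α ≃ β := Fintype.equivOfCardEq hc
  have h1 : IsConj (e.permCongr π) π' := by
    rw [isConj_iff_cycleType_eq, cycleType_permCongr, h]
  obtain ⟨g, hg⟩ := isConj_iff.1 h1
  have h2 : Equiv.permCongr g (e.permCongr π) = π' := by
    rw [← hg]; rfl
  rw [← cnt_congr e, ← cnt_congr g, h2]

open Classical in
noncomputable def coef (lam del rho : Multiset ℕ) (k : ℕ) : ℕ :=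
  if h : ∃ π : Perm (Fin (rho.sum + k)), π.cycleType = rho then cnt lam del h.choose else 0

theorem cnt_eq_coef (lam del rho : Multiset ℕ) (k : ℕ) (π : Perm α) (h : π.cycleType = rho)
    (hc : Fintype.card α = rho.sum + k) : cnt lam del π = coef lam del rho k := by
  have hex : ∃ π : Perm (Fin (rho.sum + k)), π.cycleType = rho := by
    let e : α ≃ Fin (rho.sum + k) := Fintype.equivOfCardEq (by simpa using hc)
    exact ⟨e.permCongr π, by rw [cycleType_permCongr, h]⟩
  rw [coef, dif_pos hex]
  exact cnt_eq _ _ _ _ (by simpa using hc) (by rw [h, hex.choose_spec])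

theorem coef_bound (lam del rho : Multiset ℕ) (k : ℕ) (h : coef lam del rho k ≠ 0) :
    (k : ℤ) ≤ ((lam.sum : ℤ) - (Multiset.card lam : ℤ)) +
          ((del.sum : ℤ) - (Multiset.card del : ℤ)) -
          ((rho.sum : ℤ) - (Multiset.card rho : ℤ)) := by
  unfold coef at h
  split_ifs at h with hex
  · have hsp := hex.choose_spec
    obtain ⟨⟨σ, τ⟩, hp⟩ := Finset.card_ne_zero.1 h
    simp only [Finset.mem_filter, Finset.mem_univ, true_and] at hp
    obtain ⟨h1, h2, h3, h4⟩ := hp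
    have := bound h3 h4
    rw [h1, h2, hsp, Fintype.card_fin] at this
    rw [Nat.cast_add] at this
    linarith
  · exact absurd rfl h

theorem fiber_card (lam del rho : Multiset ℕ) (π : Perm α) (h : π.cycleType = rho)
    (S : Finset α) (hS : S ⊆ π.supportᶜ) :
    ((Finset.univ.filter (fun p : Perm α × Perm α => p.1.cycleType = lam ∧ p.2.cycleType = del ∧
      p.1 * p.2 = π)).filter (fun p => p.1.support ∩ π.supportᶜ = S)).card =
      coef lam del rho S.card := by
  let T : α → Prop := fun x => x ∈ π.support ∪ S
  have hT : ∀ x, ¬ T x → π x = x ∧ x ∉ S := by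
    intro x hx
    simpa [T] using hx
  obtain ⟨πT, hπ⟩ : ∃ πT : Perm (Subtype T), ofSubtype πT = π := by
    refine ⟨((Perm.subtypeEquivSubtypePerm T).symm ⟨π, fun a ha => (hT a ha).1⟩), ?_⟩
    exact congrArg Subtype.val ((Perm.subtypeEquivSubtypePerm T).apply_symm_apply
      ⟨π, fun a ha => (hT a ha).1⟩)
  have hty : πT.cycleType = rho := by
    have h0 := congrArg cycleType hπ
    rw [cycleType_ofSubtype, h] at h0
    exact h0
  have hcard : Fintype.card (Subtype T) = rho.sum + S.card := by
    have : Fintype.card (Subtype T) = (π.support ∪ S).card := Fintype.card_coe _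
    rw [this, Finset.card_union_of_disjoint, ← h, sum_cycleType]
    exact Finset.disjoint_left.2 (fun x hx hx' => (Finset.mem_compl.1 (hS hx')) hx)
  rw [← cnt_eq_coef lam del rho S.card πT hty hcard]
  symm
  unfold cnt
  have hfix : ∀ x : Subtype T, πT x = x ↔ π x = x := by
    intro x
    rw [← hπ, ofSubtype_apply_coe, Subtype.ext_iff]
  refine Finset.card_bij (fun p _ => (ofSubtype p.1, ofSubtype p.2)) ?_ ?_ ?_
  · rintro ⟨σ, τ⟩ hp
    simp only [Finset.mem_filter, Finset.mem_univ, true_and] at hp ⊢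
    obtain ⟨h1, h2, h3, h4⟩ := hp
    refine ⟨⟨by rw [cycleType_ofSubtype, h1], by rw [cycleType_ofSubtype, h2],
      by rw [← map_mul, h3, hπ]⟩, ?_⟩
    ext x
    simp only [Finset.mem_inter, mem_support, Finset.mem_compl, not_not]
    constructor
    · rintro ⟨a, b⟩
      by_contra hx
      have : ¬ T x := by simp [T, hx, b]
      exact a (ofSubtype_apply_of_not_mem _ this)
    · intro hx
      have hb : π x = x := by simpa using hS hx
      have ht : T x := by simp [T, hx]
      refine ⟨?_, hb⟩
      rw [ofSubtype_apply_of_mem _ ht]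
      intro hc
      exact h4 ⟨x, ht⟩ ((hfix ⟨x, ht⟩).2 hb) (Subtype.ext hc)
  · rintro ⟨σ, τ⟩ _ ⟨σ', τ'⟩ _ he
    simp only [Prod.mk.injEq] at he
    rw [ofSubtype_injective he.1, ofSubtype_injective he.2]
  · rintro ⟨σ, τ⟩ hp
    simp only [Finset.mem_filter, Finset.mem_univ, true_and] at hp
    obtain ⟨⟨h1, h2, h3⟩, h4⟩ := hp
    have hσ : ∀ x, ¬ T x → σ x = x := by
      intro x hx
      obtain ⟨a, b⟩ := hT x hx
      rw [← h4] at b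
      by_contra hc
      exact b (by simp [hc, a])
    have hτ : ∀ x, ¬ T x → τ x = x := by
      intro x hx
      apply σ.injective
      rw [hσ x hx, ← Perm.mul_apply, h3, (hT x hx).1]
    obtain ⟨s, hs⟩ : ∃ s : Perm (Subtype T), ofSubtype s = σ :=
      ⟨_, congrArg Subtype.val ((Perm.subtypeEquivSubtypePerm T).apply_symm_apply ⟨σ, hσ⟩)⟩
    obtain ⟨t, ht⟩ : ∃ s : Perm (Subtype T), ofSubtype s = τ :=
      ⟨_, congrArg Subtype.val ((Perm.subtypeEquivSubtypePerm T).apply_symm_apply ⟨τ, hτ⟩)⟩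
    refine ⟨(s, t), ?_, by simp [hs, ht]⟩
    simp only [Finset.mem_filter, Finset.mem_univ, true_and]
    refine ⟨by rw [← cycleType_ofSubtype, hs, h1], by rw [← cycleType_ofSubtype, ht, h2], ?_, ?_⟩
    · apply ofSubtype_injective
      rw [map_mul, hs, ht, h3, hπ]
    · intro x hx hc
      have hx' := (hfix x).1 hx
      have hxS : (x : α) ∈ S := by
        have := x.2
        simpa [T, hx'] using this
      rw [← h4] at hxS
      have := mem_support.1 (Finset.mem_inter.1 hxS).1
      apply this
      rw [← hs, ofSubtype_apply_coe, hc]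

theorem total (lam del rho : Multiset ℕ) (π : Perm α) (h : π.cycleType = rho) :
    Nat.card {p : Perm α × Perm α // p.1.cycleType = lam ∧ p.2.cycleType = del ∧ p.1 * p.2 = π} =
    ∑ k ∈ Finset.range (Fintype.card α - rho.sum + 1),
      (Fintype.card α - rho.sum).choose k * coef lam del rho k := by
  rw [Nat.card_eq_fintype_card, Fintype.card_subtype,
    Finset.card_eq_sum_card_fiberwise (f := fun p => p.1.support ∩ π.supportᶜ)
      (t := π.supportᶜ.powerset) (by
        intro p _
        exact Finset.mem_coe.2 (Finset.mem_powerset.2 Finset.inter_subset_right)),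
    Finset.sum_congr rfl (fun S hS => fiber_card lam del rho π h S (Finset.mem_powerset.1 hS)),
    Finset.sum_powerset_apply_card, Finset.card_compl, ← sum_cycleType, h]
  simp

open Polynomial in
noncomputable def poly (lam del rho : Multiset ℕ) (M : ℕ) : Polynomial ℚ :=
  ∑ k ∈ Finset.range M, C ((coef lam del rho k : ℚ) / (k.factorial : ℚ)) *
    (descPochhammer ℚ k).comp (X - C (rho.sum : ℚ))

theorem poly_eval (lam del rho : Multiset ℕ) (M n : ℕ) (hn : rho.sum ≤ n) :
    (poly lam del rho M).eval (n : ℚ) =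
      ∑ k ∈ Finset.range M, ((n - rho.sum).choose k * coef lam del rho k : ℕ) := by
  unfold poly
  rw [Polynomial.eval_finset_sum]
  rw [Nat.cast_sum]
  refine Finset.sum_congr rfl fun k _ => ?_
  simp only [Polynomial.eval_mul, Polynomial.eval_C, Polynomial.eval_comp, Polynomial.eval_sub,
    Polynomial.eval_X]
  rw [← Nat.cast_sub hn, descPochhammer_eval_eq_descFactorial, Nat.descFactorial_eq_factorial_mul_choose]
  have : (k.factorial : ℚ) ≠ 0 := by exact_mod_cast k.factorial_ne_zero
  rw [Nat.cast_mul, Nat.cast_mul]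
  field_simp

theorem poly_deg (lam del rho : Multiset ℕ) (M : ℕ) :
    (poly lam del rho (M + 1)).natDegree ≤ M := by
  unfold poly
  refine Polynomial.natDegree_sum_le_of_forall_le _ _ fun k hk => ?_
  refine (Polynomial.natDegree_C_mul_le _ _).trans ?_
  rw [Polynomial.natDegree_comp, Polynomial.natDegree_X_sub_C, mul_one, descPochhammer_natDegree]
  have := Finset.mem_range.1 hk
  omega

end Feray


/-- Féray's degree bound: for proper partitions `λ`, `δ`, `ρ` (multisets of parts, all `≥ 2`),
the structure coefficient `c_{λδ}^{ρ}(n)` of `Z(ℂ[S_n])` agrees, for `n ≥ max(|λ|,|δ|,|ρ|)`,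
with a polynomial `f ∈ ℚ[X]` of degree at most
`(|λ|-ℓ(λ)) + (|δ|-ℓ(δ)) - (|ρ|-ℓ(ρ))` (zero polynomial having degree `-∞`); in particular
the coefficient vanishes when this bound is negative. -/
theorem stmt9 (lam del rho : Multiset ℕ)
    (hlam : ∀ p ∈ lam, 2 ≤ p) (hdel : ∀ p ∈ del, 2 ≤ p) (hrho : ∀ p ∈ rho, 2 ≤ p) :
    ∃ f : Polynomial ℚ,
      (f = 0 ∨ (f.natDegree : ℤ) ≤
          ((lam.sum : ℤ) - (Multiset.card lam : ℤ)) +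
          ((del.sum : ℤ) - (Multiset.card del : ℤ)) -
          ((rho.sum : ℤ) - (Multiset.card rho : ℤ))) ∧
      (∀ n : ℕ, lam.sum ≤ n → del.sum ≤ n → rho.sum ≤ n →
        ∀ π : Equiv.Perm (Fin n), π.cycleType = rho →
          (Nat.card {p : Equiv.Perm (Fin n) × Equiv.Perm (Fin n) //
              p.1.cycleType = lam ∧ p.2.cycleType = del ∧ p.1 * p.2 = π} : ℚ) =
            f.eval (n : ℚ)) ∧
      (((lam.sum : ℤ) - (Multiset.card lam : ℤ)) +
          ((del.sum : ℤ) - (Multiset.card del : ℤ)) -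
          ((rho.sum : ℤ) - (Multiset.card rho : ℤ)) < 0 →
        ∀ n : ℕ, lam.sum ≤ n → del.sum ≤ n → rho.sum ≤ n →
          ∀ π : Equiv.Perm (Fin n), π.cycleType = rho →
            Nat.card {p : Equiv.Perm (Fin n) × Equiv.Perm (Fin n) //
                p.1.cycleType = lam ∧ p.2.cycleType = del ∧ p.1 * p.2 = π} = 0) := by
  have hsecond : ∃ f : Polynomial ℚ,
      (f = 0 ∨ (f.natDegree : ℤ) ≤
          ((lam.sum : ℤ) - (Multiset.card lam : ℤ)) +
          ((del.sum : ℤ) - (Multiset.card del : ℤ)) -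
          ((rho.sum : ℤ) - (Multiset.card rho : ℤ))) ∧
      (∀ n : ℕ, lam.sum ≤ n → del.sum ≤ n → rho.sum ≤ n →
        ∀ π : Equiv.Perm (Fin n), π.cycleType = rho →
          (Nat.card {p : Equiv.Perm (Fin n) × Equiv.Perm (Fin n) //
              p.1.cycleType = lam ∧ p.2.cycleType = del ∧ p.1 * p.2 = π} : ℚ) =
            f.eval (n : ℚ)) := by
    have hb := Feray.coef_bound lam del rho
    generalize ((lam.sum : ℤ) - (Multiset.card lam : ℤ)) +
          ((del.sum : ℤ) - (Multiset.card del : ℤ)) -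
          ((rho.sum : ℤ) - (Multiset.card rho : ℤ)) = b at hb ⊢
    refine ⟨Feray.poly lam del rho (b + 1).toNat, ?_, ?_⟩
    · by_cases hb0 : b < 0
      · left
        have : (b + 1).toNat = 0 := by omega
        rw [this]
        simp [Feray.poly]
      · right
        have : (b + 1).toNat = b.toNat + 1 := by omega
        rw [this]
        have := Feray.poly_deg lam del rho b.toNat
        omega
    · intro n _ _ hn π hπ
      rw [Feray.total lam del rho π hπ, Feray.poly_eval lam del rho _ n hn, Fintype.card_fin]
      norm_cast
      have e2 : ∀ M M', (∀ k, M ≤ k → (n - rho.sum).choose k * Feray.coef lam del rho k = 0) →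
          M ≤ M' → 
          ∑ k ∈ Finset.range M, (n - rho.sum).choose k * Feray.coef lam del rho k =
          ∑ k ∈ Finset.range M', (n - rho.sum).choose k * Feray.coef lam del rho k := by
        intro M M' hM hMM
        refine Finset.sum_subset (Finset.range_subset_range.2 hMM) ?_
        intro k _ hk
        exact hM k (by simpa using hk)
      have z1 : ∀ k, n - rho.sum + 1 ≤ k →
          (n - rho.sum).choose k * Feray.coef lam del rho k = 0 := by
        intro k hk
        rw [Nat.choose_eq_zero_of_lt (by omega), zero_mul]
      have z2 : ∀ k, (b + 1).toNat ≤ k →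
          (n - rho.sum).choose k * Feray.coef lam del rho k = 0 := by
        intro k hk
        have : Feray.coef lam del rho k = 0 := by
          by_contra hne
          have := hb k hne
          omega
        rw [this, mul_zero]
      rw [e2 _ (max (n - rho.sum + 1) (b + 1).toNat) z1 (le_max_left _ _),
        e2 _ (max (n - rho.sum + 1) (b + 1).toNat) z2 (le_max_right _ _)]
  obtain ⟨f, h1, h2⟩ := hsecond
  refine ⟨f, h1, h2, ?_⟩
  intro hneg n a1 a2 a3 π hπ
  have hf : f = 0 := by
    rcases h1 with h1 | h1
    · exact h1
    · omega
  have := h2 n a1 a2 a3 π hπ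
  rw [hf, Polynomial.eval_zero] at this
  exact_mod_cast this
end

section
/- Let d₁, d₂ be finite subsets of ℕ and let σ₁, σ₂ be permutations of ℕ such that σ₁(x) = x for all x ∉ d₁ and σ₂(x) = x for all x ∉ d₂. Then |d₁ ∪ d₂| + #{x ∈ d₁ ∪ d₂ : σ₁(σ₂(x)) = x} ≤ (|d₁| + #{x ∈ d₁ : σ₁(x) = x}) + (|d₂| + #{x ∈ d₂ : σ₂(x) = x}). (This says that deg₂(d,ω) := |d| + #{fixed points of ω in d} is a filtration on the algebra of partial permutations: the product of partial permutations (d₁,σ₁)·(d₂,σ₂) = (d₁∪d₂, σ₁∘σ₂) satisfies deg₂(product) ≤ deg₂(d₁,σ₁) + deg₂(d₂,σ₂).) -/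
/-- The function `deg₂(d, ω) = |d| + #{fixed points of ω in d}` is a filtration on the
algebra of partial permutations: it is subadditive with respect to the product
`(d₁,σ₁)·(d₂,σ₂) = (d₁ ∪ d₂, σ₁∘σ₂)`. -/
theorem stmt10 (d₁ d₂ : Finset ℕ) (σ₁ σ₂ : Equiv.Perm ℕ)
    (h₁ : ∀ x ∉ d₁, σ₁ x = x) (h₂ : ∀ x ∉ d₂, σ₂ x = x) :
    (d₁ ∪ d₂).card + ((d₁ ∪ d₂).filter (fun x => σ₁ (σ₂ x) = x)).card ≤
      (d₁.card + (d₁.filter (fun x => σ₁ x = x)).card) +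
      (d₂.card + (d₂.filter (fun x => σ₂ x = x)).card) := by
  have hsub : (d₁ ∪ d₂).filter (fun x => σ₁ (σ₂ x) = x) ⊆
      (d₁ ∩ d₂) ∪ (d₁.filter (fun x => σ₁ x = x) ∪ d₂.filter (fun x => σ₂ x = x)) := by
    intro x hx
    simp only [Finset.mem_filter, Finset.mem_union, Finset.mem_inter] at hx ⊢
    obtain ⟨hx, hfix⟩ := hx
    by_cases hs : σ₂ x = x
    · rw [hs] at hfix
      tauto
    · have hd2 : x ∈ d₂ := by
        by_contra h
        exact hs (h₂ x h)
      have hd1 : x ∈ d₁ := by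
        by_contra h
        exact hs (σ₁.injective (hfix.trans (h₁ x h).symm))
      exact Or.inl ⟨hd1, hd2⟩
  have hc := Finset.card_le_card hsub
  have hu := Finset.card_union_le (d₁ ∩ d₂)
    (d₁.filter (fun x => σ₁ x = x) ∪ d₂.filter (fun x => σ₂ x = x))
  have hv := Finset.card_union_le (d₁.filter (fun x => σ₁ x = x)) (d₂.filter (fun x => σ₂ x = x))
  have hw := Finset.card_union_add_card_inter d₁ d₂
  omega
end

section
/- Let d₁, d₂ be finite subsets of ℕ and let σ₁, σ₂ be permutations of ℕ such that σ₁(x) = x for all x ∉ d₁ and σ₂(x) = x for all x ∉ d₂. For a partial permutation (d,σ) let ℓ(d,σ) denote the number of orbits of σ contained in d (fixed points of σ lying in d counted as orbits) and m₁(d,σ) := #{x ∈ d : σ(x) = x}. Then |d₁ ∪ d₂| − ℓ(d₁∪d₂, σ₁∘σ₂) + m₁(d₁∪d₂, σ₁∘σ₂) ≤ (|d₁| − ℓ(d₁,σ₁) + m₁(d₁,σ₁)) + (|d₂| − ℓ(d₂,σ₂) + m₁(d₂,σ₂)). (This says that deg₄(d,ω) := |d| − ℓ(ω) + m₁(ω)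 is a filtration on the algebra of partial permutations.) -/
/-- The number of orbits of `σ` (equivalence classes of the relation `SameCycle σ`, fixed
points giving singleton orbits) that are contained in `d`. -/
noncomputable def orbitCountIn (σ : Equiv.Perm ℕ) (d : Finset ℕ) : ℕ :=
  Nat.card {s : Set ℕ // (∃ x : ℕ, s = {y : ℕ | σ.SameCycle x y}) ∧ s ⊆ ↑d}

/-- The number of fixed points of `σ` lying in `d`. -/
def fixCountIn (σ : Equiv.Perm ℕ) (d : Finset ℕ) : ℕ :=
  (d.filter (fun x => σ x = x)).card

open Classical in
noncomputable def orbN (σ : Equiv.Perm ℕ) (d : Finset ℕ) : ℕ :=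
  (d.image (fun x => {y : ℕ | σ.SameCycle x y})).card

theorem orb_eq_iff (σ : Equiv.Perm ℕ) (a b : ℕ) :
    ({y : ℕ | σ.SameCycle a y} = {y : ℕ | σ.SameCycle b y}) ↔ σ.SameCycle a b := by
  constructor
  · intro h
    have : b ∈ {y : ℕ | σ.SameCycle b y} := Equiv.Perm.SameCycle.refl σ b
    rw [← h] at this
    exact this
  · intro h
    ext y
    exact ⟨fun h' => h.symm.trans h', fun h' => h.trans h'⟩

theorem const_of_sameCycle {α : Type*} (σ : Equiv.Perm ℕ) (f : ℕ → α)
    (hf : ∀ z, f (σ z) = f z) {a b : ℕ} (h : σ.SameCycle a b) : f a = f b := by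
  obtain ⟨i, rfl⟩ := h
  induction i using Int.induction_on with
  | zero => simp
  | succ n ih => rw [add_comm, zpow_add, zpow_one, Equiv.Perm.mul_apply, hf]; exact ih
  | pred n ih =>
    rw [ih, ← hf ((σ ^ (-(n:ℤ) - 1)) a), ← Equiv.Perm.mul_apply]
    congr 2
    rw [← zpow_one_add]; congr 1; ring

theorem factor {α : Type*} (σ : Equiv.Perm ℕ) (f : ℕ → α)
    (hf : ∀ z, f (σ z) = f z) : ∃ g : Set ℕ → α, ∀ z, g {y : ℕ | σ.SameCycle z y} = f z := by
  refine ⟨fun s => f (sInf s), fun z => ?_⟩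
  have : sInf {y : ℕ | σ.SameCycle z y} ∈ {y : ℕ | σ.SameCycle z y} :=
    Nat.sInf_mem ⟨z, Equiv.Perm.SameCycle.refl σ z⟩
  exact (const_of_sameCycle σ f hf this).symm

open Classical in
theorem orbN_split (σ σ' : Equiv.Perm ℕ) (D : Finset ℕ) (x y : ℕ) (hx : x ∈ D) (hy : y ∈ D)
    (hxy : x ≠ y) (hfix : σ' x = x) (hs : σ.SameCycle x y)
    (h : ∀ z, σ.SameCycle z (σ' z)) : orbN σ D + 1 ≤ orbN σ' D := by
  obtain ⟨g, hg⟩ := factor σ' (fun x => {y : ℕ | σ.SameCycle x y})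
    (fun z => ((orb_eq_iff σ _ _).2 (h z)).symm)
  have himg : D.image (fun x => {y : ℕ | σ.SameCycle x y}) =
      (D.image (fun x => {y : ℕ | σ'.SameCycle x y})).image g := by
    rw [Finset.image_image]
    apply Finset.image_congr
    intro z _
    exact (hg z).symm
  have hle : orbN σ D ≤ orbN σ' D := by
    unfold orbN; rw [himg]; exact Finset.card_image_le
  rcases hle.lt_or_eq with h1 | h1
  · exact h1
  · exfalso
    unfold orbN at h1
    rw [himg, Finset.card_image_iff] at h1
    have := h1 (by simpa using ⟨x, hx, rfl⟩) (by simpa using ⟨y, hy, rfl⟩)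
      ((hg x).trans (((orb_eq_iff σ _ _).2 hs).trans (hg y).symm))
    have h2 : σ'.SameCycle x y := (orb_eq_iff σ' _ _).1 this
    obtain ⟨i, rfl⟩ := h2
    exact hxy (Equiv.Perm.zpow_apply_eq_self_of_apply_eq_self hfix i).symm

open Classical in
theorem orbN_merge (σ : Equiv.Perm ℕ) (D : Finset ℕ) (x y : ℕ) :
    orbN σ D ≤ orbN (σ * Equiv.swap x y) D + 1 := by
  set O : ℕ → Set ℕ := fun x => {y : ℕ | σ.SameCycle x y} with hO
  have hOσ : ∀ z, O (σ z) = O z := fun z =>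
    (orb_eq_iff σ _ _).2 (Equiv.Perm.sameCycle_apply_left.2 (Equiv.Perm.SameCycle.refl σ z))
  set F : ℕ → Set ℕ := fun z => if O z = O y then O x else O z with hF
  have hFi : ∀ z, F ((σ * Equiv.swap x y) z) = F z := by
    intro z
    simp only [hF, Equiv.Perm.mul_apply, hOσ]
    rcases Equiv.swap_apply_eq_iff.1 (rfl : Equiv.swap x y z = _) with h
    by_cases h1 : z = x
    · subst h1; simp
    · by_cases h2 : z = y
      · subst h2; simp
      · rw [Equiv.swap_apply_of_ne_of_ne h1 h2]
  obtain ⟨g, hg⟩ := factor _ F hFi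
  have h1 : (D.image F).card ≤ orbN (σ * Equiv.swap x y) D := by
    have : D.image F = (D.image (fun u => {v : ℕ | (σ * Equiv.swap x y).SameCycle u v})).image g := by
      rw [Finset.image_image]
      apply Finset.image_congr
      intro z _
      exact (hg z).symm
    rw [this]; exact Finset.card_image_le
  have h2 : D.image O ⊆ insert (O y) (D.image F) := by
    intro s hs
    obtain ⟨z, hz, rfl⟩ := Finset.mem_image.1 hs
    by_cases h : O z = O y
    · simp [h]
    · apply Finset.mem_insert_of_mem
      exact Finset.mem_image.2 ⟨z, hz, by simp [hF, h]⟩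
  calc orbN σ D = (D.image O).card := rfl
    _ ≤ _ := Finset.card_le_card h2
    _ ≤ (D.image F).card + 1 := Finset.card_insert_le _ _
    _ ≤ _ := by omega

theorem apply_mem_of {σ : Equiv.Perm ℕ} {D : Finset ℕ} (h : ∀ z ∉ D, σ z = z) {x : ℕ}
    (hx : x ∈ D) : σ x ∈ D := by
  by_contra hc
  have := σ.injective (h _ hc)
  rw [this] at hc
  exact hc hx

theorem main_ineq (D : Finset ℕ) : ∀ n : ℕ, ∀ σ₁ σ₂ : Equiv.Perm ℕ,
    (∀ z ∉ D, σ₁ z = z) → (∀ z ∉ D, σ₂ z = z) →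
    (D.filter (fun z => σ₂ z ≠ z)).card ≤ n →
    orbN σ₁ D + orbN σ₂ D + (D.filter (fun z => σ₂ z ≠ z ∧ (σ₁ * σ₂) z = z)).card
      ≤ D.card + orbN (σ₁ * σ₂) D := by
  intro n
  induction n with
  | zero =>
    intro σ₁ σ₂ h1 h2 hc
    have hc' := Finset.card_eq_zero.1 (Nat.le_zero.1 hc)
    have hall : ∀ z, σ₂ z = z := by
      intro z
      by_cases hz : z ∈ D
      · by_contra hne
        have : z ∈ D.filter (fun z => σ₂ z ≠ z) := by simp [hz, hne]
        rw [hc'] at this; simp at this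
      · exact h2 z hz
    have : σ₂ = 1 := by ext z; simp [hall]
    subst this
    have : orbN 1 D ≤ D.card := Finset.card_image_le
    simp; omega
  | succ n ih =>
    intro σ₁ σ₂ h1 h2 hc
    -- generic step
    have step : ∀ x ∈ D, σ₂ x ≠ x →
        orbN (σ₁ * Equiv.swap x (σ₂ x)) D + (orbN σ₂ D + 1) +
          (D.filter (fun z => (Equiv.swap x (σ₂ x) * σ₂) z ≠ z ∧ (σ₁ * σ₂) z = z)).card
          ≤ D.card + orbN (σ₁ * σ₂) D := by
      intro x hx hne
      have hy : σ₂ x ∈ D := apply_mem_of h2 hx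
      have hsw : ∀ z ∉ D, Equiv.swap x (σ₂ x) z = z := fun z hz =>
        Equiv.swap_apply_of_ne_of_ne (fun h => hz (h ▸ hx)) (fun h => hz (h ▸ hy))
      have hprod : (σ₁ * Equiv.swap x (σ₂ x)) * (Equiv.swap x (σ₂ x) * σ₂) = σ₁ * σ₂ := by
        rw [mul_assoc, ← mul_assoc (Equiv.swap x (σ₂ x)), Equiv.swap_mul_self, one_mul]
      have := ih (σ₁ * Equiv.swap x (σ₂ x)) (Equiv.swap x (σ₂ x) * σ₂)
        (fun z hz => by rw [Equiv.Perm.mul_apply, hsw z hz, h1 z hz])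
        (fun z hz => by rw [Equiv.Perm.mul_apply, h2 z hz, hsw z hz])
        (by
          have : D.filter (fun z => (Equiv.swap x (σ₂ x) * σ₂) z ≠ z) ⊂
              D.filter (fun z => σ₂ z ≠ z) := by
            rw [Finset.ssubset_iff_of_subset]
            · exact ⟨x, by simp [hx, hne], by rw [Finset.mem_filter]; simp⟩
            · intro z hz
              rw [Finset.mem_filter] at hz ⊢
              refine ⟨hz.1, fun hzz => hz.2 ?_⟩
              rw [Equiv.Perm.mul_apply, hzz]
              apply Equiv.swap_apply_of_ne_of_ne
              · rintro rfl; exact hne hzz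
              · rintro rfl; exact hne (σ₂.injective hzz)
          have := Finset.card_lt_card this
          omega)
      rw [hprod] at this
      have hsp := orbN_split σ₂ (Equiv.swap x (σ₂ x) * σ₂) D x (σ₂ x) hx hy hne.symm (by simp)
        (Equiv.Perm.sameCycle_apply_right.2 (Equiv.Perm.SameCycle.refl _ _))
        (by
          intro z
          have hz : σ₂.SameCycle z (σ₂ z) :=
            Equiv.Perm.sameCycle_apply_right.2 (Equiv.Perm.SameCycle.refl _ _)
          have hx' : σ₂.SameCycle x (σ₂ x) :=
            Equiv.Perm.sameCycle_apply_right.2 (Equiv.Perm.SameCycle.refl _ _)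
          rw [Equiv.Perm.mul_apply]
          by_cases ha : σ₂ z = x
          · rw [ha, Equiv.swap_apply_left]; rw [ha] at hz; exact hz.trans hx'
          · by_cases hb : σ₂ z = σ₂ x
            · rw [hb, Equiv.swap_apply_right, σ₂.injective hb]
            · rw [Equiv.swap_apply_of_ne_of_ne ha hb]; exact hz)
      omega
    by_cases hB : ∃ x ∈ D, σ₂ x ≠ x ∧ (σ₁ * σ₂) x = x
    · obtain ⟨x, hx, hne, hfix⟩ := hB
      have hs := step x hx hne
      have hy : σ₂ x ∈ D := apply_mem_of h2 hx
      rw [Equiv.Perm.mul_apply] at hfix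
      have hyx : σ₁.SameCycle (σ₂ x) x := by
        have : σ₁.SameCycle (σ₂ x) (σ₁ (σ₂ x)) :=
          Equiv.Perm.sameCycle_apply_right.2 (Equiv.Perm.SameCycle.refl _ _)
        rwa [hfix] at this
      have hsp := orbN_split σ₁ (σ₁ * Equiv.swap x (σ₂ x)) D x (σ₂ x) hx hy hne.symm
        (by simp [hfix]) hyx.symm
        (by
          intro z
          rw [Equiv.Perm.mul_apply, Equiv.Perm.sameCycle_apply_right]
          by_cases ha : z = x
          · rw [ha, Equiv.swap_apply_left]; exact hyx.symm
          · by_cases hb : z = σ₂ x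
            · rw [hb, Equiv.swap_apply_right]; exact hyx
            · rw [Equiv.swap_apply_of_ne_of_ne ha hb])
      have hsub : D.filter (fun z => σ₂ z ≠ z ∧ (σ₁ * σ₂) z = z) ⊆
          insert x (insert (σ₂ x) (D.filter
            (fun z => (Equiv.swap x (σ₂ x) * σ₂) z ≠ z ∧ (σ₁ * σ₂) z = z))) := by
        intro z hz
        rw [Finset.mem_filter] at hz
        rw [Finset.mem_insert, Finset.mem_insert, Finset.mem_filter]
        by_cases ha : z = x
        · exact Or.inl ha
        by_cases hb : z = σ₂ x
        · exact Or.inr (Or.inl hb)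
        refine Or.inr (Or.inr ⟨hz.1, ?_, hz.2.2⟩)
        intro hzz
        rw [Equiv.Perm.mul_apply, Equiv.swap_apply_eq_iff,
          Equiv.swap_apply_of_ne_of_ne ha hb] at hzz
        exact hz.2.1 hzz
      have c1 := Finset.card_le_card hsub
      have c2 := Finset.card_insert_le x (insert (σ₂ x) (D.filter
            (fun z => (Equiv.swap x (σ₂ x) * σ₂) z ≠ z ∧ (σ₁ * σ₂) z = z)))
      have c3 := Finset.card_insert_le (σ₂ x) (D.filter
            (fun z => (Equiv.swap x (σ₂ x) * σ₂) z ≠ z ∧ (σ₁ * σ₂) z = z))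
      omega
    · have hB0 : (D.filter (fun z => σ₂ z ≠ z ∧ (σ₁ * σ₂) z = z)).card = 0 := by
        rw [Finset.card_eq_zero, Finset.filter_eq_empty_iff]
        intro z hz h
        exact hB ⟨z, hz, h⟩
      by_cases hne : ∃ x ∈ D, σ₂ x ≠ x
      · obtain ⟨x, hx, hne⟩ := hne
        have hs := step x hx hne
        have hm := orbN_merge σ₁ D x (σ₂ x)
        omega
      · apply ih σ₁ σ₂ h1 h2
        have : (D.filter (fun z => σ₂ z ≠ z)).card = 0 := by
          rw [Finset.card_eq_zero, Finset.filter_eq_empty_iff]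
          intro z hz h
          exact hne ⟨z, hz, h⟩
        omega

open Classical in
theorem orbitCountIn_eq (σ : Equiv.Perm ℕ) (d : Finset ℕ) (h : ∀ z ∉ d, σ z = z) :
    orbitCountIn σ d = orbN σ d := by
  unfold orbitCountIn orbN
  apply Nat.subtype_card
  intro s
  rw [Finset.mem_image]
  constructor
  · rintro ⟨x, hx, rfl⟩
    refine ⟨⟨x, rfl⟩, ?_⟩
    intro y hy
    have := const_of_sameCycle σ (fun z => z ∈ d) (fun z => by
      by_cases hz : z ∈ d
      · simp [hz, apply_mem_of h hz]
      · rw [h z hz]) hy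
    exact this ▸ hx
  · rintro ⟨⟨x, rfl⟩, hs⟩
    exact ⟨x, hs (Equiv.Perm.SameCycle.refl σ x), rfl⟩

theorem orbN_union (σ : Equiv.Perm ℕ) (d D : Finset ℕ) (hd : d ⊆ D) (h : ∀ z ∉ d, σ z = z) :
    orbN σ D = orbN σ d + (D \ d).card := by
  classical
  have key : ∀ a b, a ∉ d → σ.SameCycle a b → a = b := by
    intro a b ha hab
    obtain ⟨i, rfl⟩ := hab
    exact (Equiv.Perm.zpow_apply_eq_self_of_apply_eq_self (h a ha) i).symm
  unfold orbN
  conv_lhs => rw [← Finset.union_sdiff_of_subset hd]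
  rw [Finset.image_union, Finset.card_union_of_disjoint]
  · have : ((D \ d).image (fun x => {y : ℕ | σ.SameCycle x y})).card = (D \ d).card := by
      apply Finset.card_image_of_injOn
      intro a ha b hb hab
      exact key a b (Finset.mem_sdiff.1 ha).2 ((orb_eq_iff σ a b).1 hab)
    rw [← this]
  · rw [Finset.disjoint_left]
    intro s hs hs'
    obtain ⟨a, ha, rfl⟩ := Finset.mem_image.1 hs
    obtain ⟨b, hb, hab⟩ := Finset.mem_image.1 hs'
    have := key b a (Finset.mem_sdiff.1 hb).2 ((orb_eq_iff σ b a).1 hab)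
    subst this
    exact (Finset.mem_sdiff.1 hb).2 ha

/-- The function `deg₄(d, ω) = |d| - ℓ(ω) + m₁(ω)` is a filtration on the algebra of
partial permutations. -/
theorem stmt11 (d₁ d₂ : Finset ℕ) (σ₁ σ₂ : Equiv.Perm ℕ)
    (h₁ : ∀ x ∉ d₁, σ₁ x = x) (h₂ : ∀ x ∉ d₂, σ₂ x = x) :
    ((d₁ ∪ d₂).card : ℤ) - orbitCountIn (σ₁ * σ₂) (d₁ ∪ d₂) + fixCountIn (σ₁ * σ₂) (d₁ ∪ d₂) ≤
      ((d₁.card : ℤ) - orbitCountIn σ₁ d₁ + fixCountIn σ₁ d₁) +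
      ((d₂.card : ℤ) - orbitCountIn σ₂ d₂ + fixCountIn σ₂ d₂) := by
  have hD₁ : ∀ z ∉ d₁ ∪ d₂, σ₁ z = z := fun z hz => h₁ z (fun h => hz (Finset.mem_union_left _ h))
  have hD₂ : ∀ z ∉ d₁ ∪ d₂, σ₂ z = z := fun z hz => h₂ z (fun h => hz (Finset.mem_union_right _ h))
  have hD : ∀ z ∉ d₁ ∪ d₂, (σ₁ * σ₂) z = z := fun z hz => by
    rw [Equiv.Perm.mul_apply, hD₂ z hz, hD₁ z hz]
  rw [orbitCountIn_eq _ _ hD, orbitCountIn_eq _ _ h₁, orbitCountIn_eq _ _ h₂]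
  have m := main_ineq (d₁ ∪ d₂) _ σ₁ σ₂ hD₁ hD₂ le_rfl
  have u₁ := orbN_union σ₁ d₁ (d₁ ∪ d₂) Finset.subset_union_left h₁
  have u₂ := orbN_union σ₂ d₂ (d₁ ∪ d₂) Finset.subset_union_right h₂
  have c₁ := Finset.card_sdiff_add_card_eq_card (Finset.subset_union_left : d₁ ⊆ d₁ ∪ d₂)
  have c₂ := Finset.card_sdiff_add_card_eq_card (Finset.subset_union_right : d₂ ⊆ d₁ ∪ d₂)
  have hsub : (d₁ ∪ d₂).filter (fun x => (σ₁ * σ₂) x = x) ⊆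
      (d₁ ∪ d₂).filter (fun z => σ₂ z ≠ z ∧ (σ₁ * σ₂) z = z) ∪
        (d₁.filter (fun x => σ₁ x = x) ∪ d₂.filter (fun x => σ₂ x = x)) := by
    intro z hz
    rw [Finset.mem_filter] at hz
    by_cases h : σ₂ z = z
    · have h' : σ₁ z = z := by
        have := hz.2
        rwa [Equiv.Perm.mul_apply, h] at this
      apply Finset.mem_union_right
      rcases Finset.mem_union.1 hz.1 with hd | hd
      · exact Finset.mem_union_left _ (Finset.mem_filter.2 ⟨hd, h'⟩)
      · exact Finset.mem_union_right _ (Finset.mem_filter.2 ⟨hd, h⟩)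
    · exact Finset.mem_union_left _ (Finset.mem_filter.2 ⟨hz.1, h, hz.2⟩)
  have e := Finset.card_le_card hsub
  have e₁ := Finset.card_union_le ((d₁ ∪ d₂).filter (fun z => σ₂ z ≠ z ∧ (σ₁ * σ₂) z = z))
    (d₁.filter (fun x => σ₁ x = x) ∪ d₂.filter (fun x => σ₂ x = x))
  have e₂ := Finset.card_union_le (d₁.filter (fun x => σ₁ x = x)) (d₂.filter (fun x => σ₂ x = x))
  unfold fixCountIn
  omega
end
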